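/- Let H be a coquasitriangular Hopf algebra with coquasitriangular structure R. Then the transmutation algebra H̲ — the vector space H with product h • g = h₍₂₎ g₍₃₎ R(h₍₃₎ ⊗ S(g₍₁₎)) R(h₍₁₎ ⊗ g₍₂₎) — equipped with the right adjoint coaction Ad_R(h) = h₍₂₎ ⊗ (S h₍₁₎) h₍₃₎ and the right action h ◁ g = h₍₂₎ R(g₍₁₎ ⊗ h₍₁₎) R(h₍₃₎ ⊗ g₍₂₎), is a braided-commutative right-right H-crossed module algebra; consequently the action bialgebroid H̲ # H^op is a left and anti-left Hopf algebroid. -/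

import Mathlib

open scoped TensorProduct
open TensorProduct

noncomputable section
attribute [local instance] Classical.propDecidable

/-- Choice-based lift of a (bilinear) function to the tensor product: if a linear map agreeing
with `f` on pure tensors exists, this is it (it is then unique); otherwise `0`. -/
def tlift (R : Type*) [CommRing R] {M N Q : Type*} [AddCommGroup M] [Module R M]
    [AddCommGroup N] [Module R N] [AddCommGroup Q] [Module R Q]
    (f : M → N → Q) : M ⊗[R] N →ₗ[R] Q :=
  if h : ∃ F : M ⊗[R] N →ₗ[R] Q, ∀ x y, F (x ⊗ₜ[R] y) = f x y then h.choose else 0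

/-- Choice-based lift of a (bilinear, balanced) function to a quotient of the tensor product. -/
def qtlift (R : Type*) [CommRing R] {M N Q : Type*} [AddCommGroup M] [Module R M]
    [AddCommGroup N] [Module R N] [AddCommGroup Q] [Module R Q]
    (p : Submodule R (M ⊗[R] N)) (f : M → N → Q) : ((M ⊗[R] N) ⧸ p) →ₗ[R] Q :=
  if h : ∃ F : ((M ⊗[R] N) ⧸ p) →ₗ[R] Q,
      ∀ x y, F (Submodule.Quotient.mk (x ⊗ₜ[R] y)) = f x y then h.choose else 0

variable (k : Type*) [Field k]

/-- Source and target data for a left bialgebroid over `B`: an algebra map `s : B → L` and an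
anti-algebra map `t : B → L` with commuting ranges. -/
structure BgdST (B L : Type*) [Ring B] [Algebra k B] [Ring L] [Algebra k L] where
  s : B →ₐ[k] L
  t : B →ₗ[k] L
  t_one : t 1 = 1
  t_mul : ∀ a b : B, t (a * b) = t b * t a
  st_comm : ∀ a b : B, s a * t b = t b * s a

namespace BgdST

variable {k} {B L : Type*} [Ring B] [Algebra k B] [Ring L] [Algebra k L]
variable (st : BgdST k B L)

/-- The relations defining `L ⊗_B L`: `t a · X ⊗ Y  ~  X ⊗ s a · Y`. -/
def rel : Submodule k (L ⊗[k] L) :=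
  Submodule.span k {z | ∃ (a : B) (X Y : L), z = (st.t a * X) ⊗ₜ[k] Y - X ⊗ₜ[k] (st.s a * Y)}

/-- `L ⊗_B L` (the coring tensor square). -/
abbrev T2 := (L ⊗[k] L) ⧸ st.rel

/-- Class of a pure tensor in `L ⊗_B L`. -/
def mk2 (X Y : L) : st.T2 := Submodule.Quotient.mk (X ⊗ₜ[k] Y)

/-- Evaluate a balanced bilinear expression on an element of `L ⊗_B L`. -/
def lift2 {Q : Type*} [AddCommGroup Q] [Module k Q] (f : L → L → Q) : st.T2 →ₗ[k] Q :=
  qtlift k st.rel f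

/-- The relations defining `L ⊗_{B^{op}} L`: `X·t a ⊗ Y ~ X ⊗ t a · Y`. -/
def relOp : Submodule k (L ⊗[k] L) :=
  Submodule.span k {z | ∃ (a : B) (X Y : L), z = (X * st.t a) ⊗ₜ[k] Y - X ⊗ₜ[k] (st.t a * Y)}

/-- `L ⊗_{B^{op}} L` (domain of the canonical map `λ`). -/
abbrev TOp := (L ⊗[k] L) ⧸ st.relOp

def mkOp (X Y : L) : st.TOp := Submodule.Quotient.mk (X ⊗ₜ[k] Y)

def liftOp {Q : Type*} [AddCommGroup Q] [Module k Q] (f : L → L → Q) : st.TOp →ₗ[k] Q :=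
  qtlift k st.relOp f

/-- The relations defining `L ⊗^{B^{op}} L`: `s a · X ⊗ Y ~ X ⊗ Y · s a`. -/
def relA : Submodule k (L ⊗[k] L) :=
  Submodule.span k {z | ∃ (a : B) (X Y : L), z = (st.s a * X) ⊗ₜ[k] Y - X ⊗ₜ[k] (Y * st.s a)}

/-- `L ⊗^{B^{op}} L` (domain of the canonical map `μ`). -/
abbrev TA := (L ⊗[k] L) ⧸ st.relA

def mkA (X Y : L) : st.TA := Submodule.Quotient.mk (X ⊗ₜ[k] Y)

def liftA {Q : Type*} [AddCommGroup Q] [Module k Q] (f : L → L → Q) : st.TA →ₗ[k] Q :=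
  qtlift k st.relA f

/-- Relations for the triple tensor `L ⊗_B L ⊗_B L`. -/
def rel3 : Submodule k (L ⊗[k] (L ⊗[k] L)) :=
  Submodule.span k
    ({z | ∃ (a : B) (X Y Z : L),
        z = (st.t a * X) ⊗ₜ[k] (Y ⊗ₜ[k] Z) - X ⊗ₜ[k] ((st.s a * Y) ⊗ₜ[k] Z)} ∪
     {z | ∃ (a : B) (X Y Z : L),
        z = X ⊗ₜ[k] ((st.t a * Y) ⊗ₜ[k] Z) - X ⊗ₜ[k] (Y ⊗ₜ[k] (st.s a * Z))})

/-- `L ⊗_B L ⊗_B L`. -/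
abbrev T3 := (L ⊗[k] (L ⊗[k] L)) ⧸ st.rel3

def mk3 (X Y Z : L) : st.T3 := Submodule.Quotient.mk (X ⊗ₜ[k] (Y ⊗ₜ[k] Z))

/-- The factorwise product of two elements of `L ⊗_B L`, whenever it is well defined
on representatives (as it is when the left factor lies in the Takeuchi product);
junk value `0` otherwise. -/
def mulT2 (z w : st.T2) : st.T2 :=
  if h : ∃ u : st.T2, ∀ zr wr : L ⊗[k] L, Submodule.Quotient.mk zr = z →
      Submodule.Quotient.mk wr = w → Submodule.Quotient.mk (zr * wr) = u
  then h.choose else 0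

variable (cop : L →ₗ[k] st.T2) (cou : L →ₗ[k] B)

/-- The axioms of a left bialgebroid over `B` with structure `(s,t,Δ,ε) = (st.s, st.t, cop, cou)`
(Definition 2.3 of the paper): `L` is a `B^e`-ring and a `B`-coring, the coproduct corestricts
to an algebra map into the Takeuchi product, and the counit is a left character. -/
structure IsLeftBialgebroid : Prop where
  comul_one : cop 1 = st.mk2 1 1
  comul_mul : ∀ X Y : L, cop (X * Y) = st.mulT2 (cop X) (cop Y)
  comul_s : ∀ (b : B) (X : L),
    cop (st.s b * X) = st.lift2 (fun x y => st.mk2 (st.s b * x) y) (cop X)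
  comul_t : ∀ (b : B) (X : L),
    cop (st.t b * X) = st.lift2 (fun x y => st.mk2 x (st.t b * y)) (cop X)
  takeuchi : ∀ (b : B) (X : L),
    st.lift2 (fun x y => st.mk2 (x * st.t b) y) (cop X) =
      st.lift2 (fun x y => st.mk2 x (y * st.s b)) (cop X)
  coassoc : ∀ X : L,
    st.lift2 (fun x1 x2 => st.lift2 (fun y1 y2 => st.mk3 x1 y1 y2) (cop x2)) (cop X) =
      st.lift2 (fun x12 x3 => st.lift2 (fun x1 x2 => st.mk3 x1 x2 x3) (cop x12)) (cop X)
  counit_comul_left : ∀ X : L, st.lift2 (fun x1 x2 => st.s (cou x1) * x2) (cop X) = X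
  counit_comul_right : ∀ X : L, st.lift2 (fun x1 x2 => st.t (cou x2) * x1) (cop X) = X
  counit_one : cou 1 = 1
  counit_s : ∀ (b : B) (X : L), cou (st.s b * X) = b * cou X
  counit_t : ∀ (b : B) (X : L), cou (st.t b * X) = cou X * b
  counit_char_s : ∀ X Y : L, cou (X * st.s (cou Y)) = cou (X * Y)
  counit_char_t : ∀ X Y : L, cou (X * st.t (cou Y)) = cou (X * Y)

/-- The canonical map `λ : L ⊗_{B^{op}} L → L ⊗_B L`, `X ⊗ Y ↦ X₍₁₎ ⊗ X₍₂₎Y`. -/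
def lam : st.TOp →ₗ[k] st.T2 :=
  st.liftOp (fun X Y => st.lift2 (fun x1 x2 => st.mk2 x1 (x2 * Y)) (cop X))

/-- A left bialgebroid is a left Hopf algebroid if `λ` is bijective. -/
def IsLeftHopf : Prop := Function.Bijective (st.lam cop)

/-- The canonical map `μ : L ⊗^{B^{op}} L → L ⊗_B L`, `X ⊗ Y ↦ Y₍₁₎X ⊗ Y₍₂₎`. -/
def mu : st.TA →ₗ[k] st.T2 :=
  st.liftA (fun X Y => st.lift2 (fun y1 y2 => st.mk2 (y1 * X) y2) (cop Y))

/-- A left bialgebroid is an anti-left Hopf algebroid if `μ` is bijective. -/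
def IsAntiLeftHopf : Prop := Function.Bijective (st.mu cop)

/-- `X₊ ⊗_{B^{op}} X₋ := λ⁻¹(X ⊗_B 1)` (meaningful when `λ` is bijective). -/
def plusMinus (X : L) : st.TOp := Function.invFun (st.lam cop) (st.mk2 X 1)

/-- `X₍₋₎ ⊗^{B^{op}} X₍₊₎ := μ⁻¹(1 ⊗_B X)` (meaningful when `μ` is bijective). -/
def minusPlus (X : L) : st.TA := Function.invFun (st.mu cop) (st.mk2 1 X)

/-- A left bisection of a left bialgebroid (Definition 3.1). -/
structure IsLeftBisection (σ : L →ₗ[k] B) : Prop where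
  unital : σ 1 = 1
  t_prop : ∀ (b : B) (X : L), σ (st.t b * X) = σ X * b
  s_mul : ∀ a b : B, σ (st.s (a * b)) = σ (st.s a) * σ (st.s b)
  s_bij : Function.Bijective (fun b => σ (st.s b))
  prod_t : ∀ X Y : L, σ (X * Y) = σ (X * st.t (σ Y))
  prod_s : ∀ X Y : L,
    σ (X * Y) = σ (X * st.s (Function.invFun (fun b => σ (st.s b)) (σ Y)))

/-- Convolution of left bisections:  `(σ * η)(X) := σ(s(η(X₍₁₎)) X₍₂₎)`. -/
def bconv (σ η : L →ₗ[k] B) : L →ₗ[k] B :=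
  (st.lift2 (fun x1 x2 => σ (st.s (η x1) * x2))).comp cop

/-- A right bisection of a left bialgebroid (Definition 3.6). -/
structure IsRightBisection (σ : L →ₗ[k] B) : Prop where
  unital : σ 1 = 1
  s_prop : ∀ (b : B) (X : L), σ (st.s b * X) = b * σ X
  t_mul : ∀ a b : B, σ (st.t (a * b)) = σ (st.t b) * σ (st.t a)
  t_bij : Function.Bijective (fun b => σ (st.t b))
  prod_s : ∀ X Y : L, σ (X * Y) = σ (X * st.s (σ Y))
  prod_t : ∀ X Y : L,
    σ (X * Y) = σ (X * st.t (Function.invFun (fun b => σ (st.t b)) (σ Y)))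

/-- Convolution of right bisections:  `(σ • η)(X) := σ(t(η(X₍₂₎)) X₍₁₎)`. -/
def rconv (σ η : L →ₗ[k] B) : L →ₗ[k] B :=
  (st.lift2 (fun x1 x2 => σ (st.t (η x2) * x1))).comp cop

/-- An automorphism `(Φ, φ)` of a left bialgebroid. -/
structure IsBgdAut (Φ : L →ₐ[k] L) (φ : B →ₐ[k] B) : Prop where
  bijL : Function.Bijective Φ
  bijB : Function.Bijective φ
  comp_s : ∀ b : B, Φ (st.s b) = st.s (φ b)
  comp_t : ∀ b : B, Φ (st.t b) = st.t (φ b)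
  comp_comul : ∀ X : L,
    cop (Φ X) = st.lift2 (fun x1 x2 => st.mk2 (Φ x1) (Φ x2)) (cop X)
  comp_counit : ∀ X : L, cou (Φ X) = φ (cou X)

/-- `Ad^L_σ(X) := s(σ(X₍₁₎)) X₍₂₎₊ t(σ(X₍₂₎₋))`, for a left Hopf algebroid. -/
def adL (σ : L →ₗ[k] B) (X : L) : L :=
  st.lift2 (fun x1 x2 => st.s (σ x1) *
    st.liftOp (fun p m => p * st.t (σ m)) (st.plusMinus cop x2)) (cop X)

/-- `Ad^R_σ(X) := t(σ(X₍₂₎)) X₍₁₎₍₊₎ s(σ(X₍₁₎₍₋₎))`, for an anti-left Hopf algebroid. -/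
def adR (σ : L →ₗ[k] B) (X : L) : L :=
  st.lift2 (fun x1 x2 => st.t (σ x2) *
    st.liftA (fun m p => p * st.s (σ m)) (st.minusPlus cop x1)) (cop X)

/-- The `B`-bimodule-map conditions on a map `L → B` used for `C¹(L,B)`. -/
def IsBimodMap (U : L →ₗ[k] B) : Prop :=
  (∀ (b : B) (X : L), U (st.t b * X) = U X * b) ∧
  (∀ (b : B) (X : L), U (st.s b * X) = b * U X)

/-- Convolution `(U * V)(X) = U(X₍₁₎) V(X₍₂₎)` of `B`-valued maps. -/
def cconv (U V : L →ₗ[k] B) : L →ₗ[k] B :=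
  (st.lift2 (fun x1 x2 => U x1 * V x2)).comp cop

/-- Extended vertical bisections `C¹(L,B)`: unital convolution-invertible `B`-bimodule maps
`U : L → B` with `U(X s(b)) = U(X t(b))`. -/
def IsC1 (U : L →ₗ[k] B) : Prop :=
  U 1 = 1 ∧ st.IsBimodMap U ∧
  (∀ (b : B) (X : L), U (X * st.s b) = U (X * st.t b)) ∧
  ∃ V : L →ₗ[k] B, st.IsBimodMap V ∧ st.cconv cop U V = cou ∧ st.cconv cop V U = cou

/-- Convolution product on `B`-bimodule maps `L ⊗_{B^e} L → B`:
`(f ⋆ g)(X,Y) = f(X₍₁₎,Y₍₁₎) g(X₍₂₎,Y₍₂₎)`. -/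
def conv2 (f g : L → L → B) (X Y : L) : B :=
  st.lift2 (fun y1 y2 =>
    st.lift2 (fun x1 x2 => f x1 y1 * g x2 y2) (cop X)) (cop Y)

/-- The unit `ε̃(X ⊗ Y) = ε(XY)` of the convolution algebra. -/
def unit2 (X Y : L) : B := cou (X * Y)

/-- Left-hand side of the 2-cocycle condition: `Γ(X, s(Γ(Y₍₁₎,Z₍₁₎)) Y₍₂₎Z₍₂₎)`. -/
def cocL (Γ : L → L → B) (X Y Z : L) : B :=
  st.lift2 (fun z1 z2 =>
    st.lift2 (fun y1 y2 => Γ X (st.s (Γ y1 z1) * (y2 * z2))) (cop Y)) (cop Z)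

/-- Right-hand side of the 2-cocycle condition: `Γ(s(Γ(X₍₁₎,Y₍₁₎)) X₍₂₎Y₍₂₎, Z)`. -/
def cocR (Γ : L → L → B) (X Y Z : L) : B :=
  st.lift2 (fun y1 y2 =>
    st.lift2 (fun x1 x2 => Γ (st.s (Γ x1 y1) * (x2 * y2)) Z) (cop X)) (cop Y)

/-- Membership of a bilinear map in `_B Hom_B (L ⊗_{B^e} L, B)`. -/
def IsBihom (Γ : L → L → B) : Prop :=
  (∃ Γ' : L →ₗ[k] L →ₗ[k] B, ∀ X Y, Γ' X Y = Γ X Y) ∧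
  (∀ (b c : B) (X Y : L), Γ (st.s b * (st.t c * X)) Y = b * Γ X Y * c) ∧
  (∀ (b c : B) (X Y : L), Γ (X * st.s b * st.t c) Y = Γ X (st.s b * (st.t c * Y)))

/-- An invertible normalised 2-cocycle on a left bialgebroid (Definition 2.6);
the collection of these is `Z²(L,B)`. -/
structure IsZ2 (Γ : L → L → B) : Prop where
  bihom : st.IsBihom Γ
  norm_left : ∀ X : L, Γ 1 X = cou X
  norm_right : ∀ X : L, Γ X 1 = cou X
  st_indep : ∀ (b : B) (X Y : L), Γ X (Y * st.s b) = Γ X (Y * st.t b)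
  cocycle : ∀ X Y Z : L, st.cocL cop Γ X Y Z = st.cocR cop Γ X Y Z
  inv : ∃ Γi : L → L → B, st.IsBihom Γi ∧
    (∀ X Y, st.conv2 cop Γ Γi X Y = unit2 cou X Y) ∧
    (∀ X Y, st.conv2 cop Γi Γ X Y = unit2 cou X Y)

/-- The coboundary `∂U(X,Y) = U⁻¹(X₍₁₎ t(U⁻¹(Y₍₁₎))) U(X₍₂₎Y₍₂₎)` of `U ∈ C¹(L,B)`. -/
def coboundary (U Ui : L →ₗ[k] B) (X Y : L) : B :=
  st.lift2 (fun y1 y2 =>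
    st.lift2 (fun x1 x2 => Ui (x1 * st.t (Ui y1)) * U (x2 * y2)) (cop X)) (cop Y)

/-- The transform `Γ^U(X,Y) = U⁻¹(X₍₁₎ t(U⁻¹(Y₍₁₎))) Γ(X₍₂₎,Y₍₂₎) U(X₍₃₎Y₍₃₎)`. -/
def gammaU (Γ : L → L → B) (U Ui : L →ₗ[k] B) (X Y : L) : B :=
  st.lift2 (fun y1 y23 => st.lift2 (fun y2 y3 =>
    st.lift2 (fun x1 x23 => st.lift2 (fun x2 x3 =>
      Ui (x1 * st.t (Ui y1)) * Γ x2 y2 * U (x3 * y3)) (cop x23)) (cop X))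
    (cop y23)) (cop Y)

/-- The cotwisted product `X ·_Γ Y := s(Γ(X₍₁₎,Y₍₁₎)) t(Γ⁻¹(X₍₃₎,Y₍₃₎)) X₍₂₎Y₍₂₎`. -/
def prodG (Γ Γi : L → L → B) (X Y : L) : L :=
  st.lift2 (fun y1 y23 => st.lift2 (fun y2 y3 =>
    st.lift2 (fun x1 x23 => st.lift2 (fun x2 x3 =>
      st.s (Γ x1 y1) * (st.t (Γi x3 y3) * (x2 * y2))) (cop x23)) (cop X))
    (cop y23)) (cop Y)

/-- `Ad_U(X) := s(U(X₍₁₎)) t(U⁻¹(X₍₃₎)) X₍₂₎`. -/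
def adU (U Ui : L →ₗ[k] B) (X : L) : L :=
  st.lift2 (fun x1 x23 => st.lift2 (fun x2 x3 =>
    st.s (U x1) * (st.t (Ui x3) * x2)) (cop x23)) (cop X)

end BgdST

end

/-! ## Crossed (Drinfeld–Yetter) module algebras and action Hopf algebroids -/

noncomputable section
attribute [local instance] Classical.propDecidable

universe u v

open scoped TensorProduct
open TensorProduct

variable {k : Type u} [Field k] {H : Type v} [Ring H] [HopfAlgebra k H]
  {B : Type v} [Ring B] [Algebra k B]

/-- A right-right `H`-crossed (Drinfeld–Yetter) module algebra structure on `B`, given by a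
right action `act` and a right coaction `coact`. -/
def IsRRCrossed (act : B → H → B) (coact : B → B ⊗[k] H) : Prop :=
  (∃ act' : B →ₗ[k] H →ₗ[k] B, ∀ (b : B) (h : H), act' b h = act b h) ∧
  (∃ coact' : B →ₗ[k] B ⊗[k] H, ∀ b : B, coact' b = coact b) ∧
  (∀ b : B, act b 1 = b) ∧
  (∀ (b : B) (g h : H), act (act b g) h = act b (g * h)) ∧
  (∀ h : H, act 1 h = algebraMap k B (Coalgebra.counit (R := k) h)) ∧
  (∀ (a b : B) (h : H), act (a * b) h =
    tlift k (fun h1 h2 => act a h1 * act b h2) (Coalgebra.comul (R := k) h)) ∧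
  (coact 1 = 1) ∧
  (∀ a b : B, coact (a * b) = coact a * coact b) ∧
  (∀ b : B,
    tlift k (fun b0 b1 => (b0 ⊗ₜ[k] (Coalgebra.comul (R := k) b1) : B ⊗[k] (H ⊗[k] H)))
      (coact b) =
    tlift k (fun b0 b1 => tlift k (fun c0 c1 => (c0 ⊗ₜ[k] (c1 ⊗ₜ[k] b1) : B ⊗[k] (H ⊗[k] H)))
      (coact b0)) (coact b)) ∧
  (∀ b : B, tlift k (fun b0 b1 => (Coalgebra.counit (R := k) b1 : k) • b0) (coact b) = b) ∧
  -- the Drinfeld–Yetter compatibility  (a ◁ h₂)₀ ⊗ h₁(a ◁ h₂)₁ = (a₀ ◁ h₁) ⊗ a₁h₂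
  (∀ (a : B) (h : H),
    tlift k (fun h1 h2 => tlift k (fun c0 c1 => c0 ⊗ₜ[k] (h1 * c1)) (coact (act a h2)))
      (Coalgebra.comul (R := k) h) =
    tlift k (fun b0 b1 => tlift k (fun h1 h2 => act b0 h1 ⊗ₜ[k] (b1 * h2))
      (Coalgebra.comul (R := k) h)) (coact a))

/-- Braided commutativity `a b = b₀ (a ◁ b₁)`. -/
def IsBraidedComm (act : B → H → B) (coact : B → B ⊗[k] H) : Prop :=
  ∀ a b : B, a * b = tlift k (fun b0 b1 => b0 * act a b1) (coact b)

/-- The smash product multiplication `(a # h)(b # g) = a (b ◁ h₁) # g h₂` on `B ⊗ H`. -/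
def smashMul (act : B → H → B) (z w : B ⊗[k] H) : B ⊗[k] H :=
  tlift k (fun a h => tlift k (fun b g => tlift k (fun h1 h2 =>
    (a * act b h1) ⊗ₜ[k] (g * h2)) (Coalgebra.comul (R := k) h)) w) z

/-- `ψ(b) = b₀ ϱ(b₁)` for `ϱ : H → B`. -/
def psiFun (coact : B → B ⊗[k] H) (ϱ : H → B) (b : B) : B :=
  tlift k (fun b0 b1 => b0 * ϱ b1) (coact b)

/-- `Z¹_◁(H,B)`: unital maps `ϱ : H → B` with `ϱ(gh) = (ϱ(g) ◁ h₁) ϱ(h₂)` and `ψ` bijective. -/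
def IsZ1cross (act : B → H → B) (coact : B → B ⊗[k] H) (ϱ : H →ₗ[k] B) : Prop :=
  ϱ 1 = 1 ∧
  (∀ g h : H, ϱ (g * h) =
    tlift k (fun h1 h2 => act (ϱ g) h1 * ϱ h2) (Coalgebra.comul (R := k) h)) ∧
  Function.Bijective (psiFun coact (⇑ϱ))

/-- The group product `(ϱ • ϱ')(h) = ϱ(h₁) ψ(ϱ'(h₂))` on `Z¹_◁(H,B)`. -/
def bulletFun (coact : B → B ⊗[k] H) (ϱ ϱ' : H → B) (h : H) : B :=
  tlift k (fun h1 h2 => ϱ h1 * psiFun coact ϱ (ϱ' h2)) (Coalgebra.comul (R := k) h)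

/-- The unit `h ↦ ε(h)1`. -/
def unitBmap : H →ₗ[k] B :=
  (Algebra.linearMap k B).comp (Coalgebra.counit (R := k) (A := H))

/-- Convolution of linear maps `H → B`. -/
def convHB (f g : H →ₗ[k] B) : H →ₗ[k] B :=
  (tlift k (fun h1 h2 => f h1 * g h2)).comp (Coalgebra.comul (R := k) (A := H))

/-- Convolution of maps `H ⊗ H → B`. -/
def convBB (γ δ : H → H → B) (h g : H) : B :=
  tlift k (fun h1 h2 => tlift k (fun g1 g2 => γ h1 g1 * δ h2 g2)
    (Coalgebra.comul (R := k) g)) (Coalgebra.comul (R := k) h)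

/-- `Z²_{◁,as}(H,B)`: convolution-invertible 2-cocycles of associative type. -/
def IsZ2as (act : B → H → B) (γ : H → H → B) : Prop :=
  (∃ γ' : H →ₗ[k] H →ₗ[k] B, ∀ h g, γ' h g = γ h g) ∧
  (∀ h : H, γ h 1 = algebraMap k B (Coalgebra.counit (R := k) h) ∧
    γ 1 h = algebraMap k B (Coalgebra.counit (R := k) h)) ∧
  (∀ h g f : H,
    tlift k (fun h1 h2 => tlift k (fun g1 g2 => tlift k (fun f1 f2 =>
      act (γ g1 f1) h1 * γ h2 (f2 * g2)) (Coalgebra.comul (R := k) f))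
        (Coalgebra.comul (R := k) g)) (Coalgebra.comul (R := k) h) =
    tlift k (fun h1 h2 => tlift k (fun g1 g2 =>
      γ h1 g1 * γ (g2 * h2) f) (Coalgebra.comul (R := k) g)) (Coalgebra.comul (R := k) h)) ∧
  (∀ (h g : H) (b : B),
    tlift k (fun h1 h2 => tlift k (fun g1 g2 => γ h1 g1 * act b (g2 * h2))
      (Coalgebra.comul (R := k) g)) (Coalgebra.comul (R := k) h) =
    tlift k (fun h1 h2 => tlift k (fun g1 g2 => act b (g1 * h1) * γ h2 g2)
      (Coalgebra.comul (R := k) g)) (Coalgebra.comul (R := k) h)) ∧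
  (∃ γi : H → H → B, (∃ γi' : H →ₗ[k] H →ₗ[k] B, ∀ h g, γi' h g = γi h g) ∧
    (∀ h g : H, convBB (k := k) γ γi h g =
      algebraMap k B (Coalgebra.counit (R := k) h * Coalgebra.counit (R := k) g)) ∧
    (∀ h g : H, convBB (k := k) γi γ h g =
      algebraMap k B (Coalgebra.counit (R := k) h * Coalgebra.counit (R := k) g)))

/-- `Z²_◁(H,B)`: the subset of `Z²_{◁,as}(H,B)` satisfying the two extra conditions. -/
def IsZ2cross (act : B → H → B) (coact : B → B ⊗[k] H) (γ : H → H → B) : Prop :=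
  IsZ2as (k := k) act γ ∧
  (∀ (h g : H) (c : B),
    tlift k (fun h1 h2 => γ h1 g * act c h2) (Coalgebra.comul (R := k) h) =
    tlift k (fun c0 c1 => tlift k (fun h1 h2 => act c0 h1 * γ h2 (g * c1))
      (Coalgebra.comul (R := k) h)) (coact c)) ∧
  (∀ (h g : H) (c : B),
    tlift k (fun c0 c1 => c0 * γ (h * c1) g) (coact c) = γ h g * c)

/-- `C¹_{◁,ver}(H,B)`: unital convolution-invertible maps `ϱ : H → B` with
`b₀ ϱ(h b₁) = ϱ(h) b` and `ϱ(h₁)(b ◁ h₂) = (b ◁ h₁) ϱ(h₂)`. -/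
def IsC1ver (act : B → H → B) (coact : B → B ⊗[k] H) (ϱ : H →ₗ[k] B) : Prop :=
  ϱ 1 = 1 ∧
  (∀ (h : H) (b : B), tlift k (fun b0 b1 => b0 * ϱ (h * b1)) (coact b) = ϱ h * b) ∧
  (∀ (h : H) (b : B),
    tlift k (fun h1 h2 => ϱ h1 * act b h2) (Coalgebra.comul (R := k) h) =
    tlift k (fun h1 h2 => act b h1 * ϱ h2) (Coalgebra.comul (R := k) h)) ∧
  ∃ ϱi : H →ₗ[k] B, convHB ϱ ϱi = unitBmap ∧ convHB ϱi ϱ = unitBmap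

/-- `γ^ϱ(h,g) = ϱ⁻¹(h₁)(ϱ⁻¹(g₁) ◁ h₂) γ(h₃, g₂) ϱ(g₃ h₄)`. -/
def gamRho (act : B → H → B) (ϱ ϱi : H → B) (γ : H → H → B) (h g : H) : B :=
  tlift k (fun h1 h234 => tlift k (fun h2 h34 => tlift k (fun h3 h4 =>
    tlift k (fun g1 g23 => tlift k (fun g2 g3 =>
      ϱi h1 * act (ϱi g1) h2 * γ h3 g2 * ϱ (g3 * h4)) (Coalgebra.comul (R := k) g23))
      (Coalgebra.comul (R := k) g))
    (Coalgebra.comul (R := k) h34)) (Coalgebra.comul (R := k) h234))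
    (Coalgebra.comul (R := k) h)

/-- The value `Γ_γ(a # h, b # g) = a (b ◁ h₁) γ(h₂, g)` computed through `ψ`. -/
def gammaSmash {L0 : Type v} [AddCommGroup L0] [Module k L0]
    (act : B → H → B) (ψ : L0 ≃ₗ[k] B ⊗[k] H) (γ : H → H → B) (z w : L0) : B :=
  tlift k (fun a h => tlift k (fun b g => tlift k (fun h1 h2 =>
    a * act b h1 * γ h2 g) (Coalgebra.comul (R := k) h)) (ψ w)) (ψ z)

end

/-! ## Coquasitriangular Hopf algebras and transmutation -/

noncomputable section
attribute [local instance] Classical.propDecidable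
universe u3 v3
open scoped TensorProduct
open TensorProduct

variable {k : Type u3} [Field k] {H : Type v3} [Ring H] [HopfAlgebra k H]

/-- Convolution of bilinear forms on `H`. -/
def convKK (R2 R2i : H → H → k) (h g : H) : k :=
  tlift k (fun h1 h2 => tlift k (fun g1 g2 => R2 h1 g1 * R2i h2 g2)
    (Coalgebra.comul (R := k) g)) (Coalgebra.comul (R := k) h)

/-- A coquasitriangular structure `R` on `H` (with a specified convolution inverse). -/
def IsCQT (R2 R2i : H → H → k) : Prop :=
  (∃ R2' : H →ₗ[k] H →ₗ[k] k, ∀ h g, R2' h g = R2 h g) ∧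
  (∃ R2i' : H →ₗ[k] H →ₗ[k] k, ∀ h g, R2i' h g = R2i h g) ∧
  (∀ h g : H, convKK R2 R2i h g =
    (Coalgebra.counit (R := k) h : k) * Coalgebra.counit (R := k) g) ∧
  (∀ h g : H, convKK R2i R2 h g =
    (Coalgebra.counit (R := k) h : k) * Coalgebra.counit (R := k) g) ∧
  (∀ h g f : H, R2 h (g * f) =
    tlift k (fun h1 h2 => R2 h1 f * R2 h2 g) (Coalgebra.comul (R := k) h)) ∧
  (∀ h g f : H, R2 (h * g) f =
    tlift k (fun f1 f2 => R2 h f1 * R2 g f2) (Coalgebra.comul (R := k) f)) ∧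
  (∀ h g : H,
    tlift k (fun g1 g2 => tlift k (fun h1 h2 => (R2 h2 g2 : k) • (g1 * h1))
      (Coalgebra.comul (R := k) h)) (Coalgebra.comul (R := k) g) =
    tlift k (fun h1 h2 => tlift k (fun g1 g2 => (R2 h1 g1 : k) • (h2 * g2))
      (Coalgebra.comul (R := k) g)) (Coalgebra.comul (R := k) h))

/-- The transmutation product `h • g = h₂g₃ R(h₃ ⊗ Sg₁) R(h₁ ⊗ g₂)`. -/
def bulletTrans (R2 : H → H → k) (h g : H) : H :=
  tlift k (fun h1 h23 => tlift k (fun h2 h3 => tlift k (fun g1 g23 => tlift k (fun g2 g3 =>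
    (R2 h3 (HopfAlgebra.antipode (R := k) g1) * R2 h1 g2 : k) • (h2 * g3))
    (Coalgebra.comul (R := k) g23)) (Coalgebra.comul (R := k) g))
    (Coalgebra.comul (R := k) h23)) (Coalgebra.comul (R := k) h)

/-- The right adjoint coaction `Ad_R(h) = h₂ ⊗ (Sh₁)h₃`. -/
def adRTrans (h : H) : H ⊗[k] H :=
  tlift k (fun h1 h23 => tlift k (fun h2 h3 =>
    h2 ⊗ₜ[k] (HopfAlgebra.antipode (R := k) h1 * h3)) (Coalgebra.comul (R := k) h23))
    (Coalgebra.comul (R := k) h)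

/-- The transmutation action `h ◁ g = h₂ R(g₁ ⊗ h₁) R(h₃ ⊗ g₂)`. -/
def actTrans (R2 : H → H → k) (h g : H) : H :=
  tlift k (fun h1 h23 => tlift k (fun h2 h3 => tlift k (fun g1 g2 =>
    (R2 g1 h1 * R2 h3 g2 : k) • h2) (Coalgebra.comul (R := k) g))
    (Coalgebra.comul (R := k) h23)) (Coalgebra.comul (R := k) h)

end

set_option linter.unusedSectionVars false

/-! ## Bilinear functions and `tlift` -/

section Bilinear

variable {k : Type*} [CommRing k] {L M N Q : Type*} [AddCommGroup L] [Module k L]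
  [AddCommGroup M] [Module k M] [AddCommGroup N] [Module k N] [AddCommGroup Q] [Module k Q]

/-- Unbundled bilinearity. -/
def IsBil (k : Type*) [CommRing k] {M N Q : Type*} [AddCommGroup M] [Module k M]
    [AddCommGroup N] [Module k N] [AddCommGroup Q] [Module k Q] (f : M → N → Q) : Prop :=
  (∀ y, IsLinearMap k (fun x => f x y)) ∧ ∀ x, IsLinearMap k (f x)

/-- The bundled form of a bilinear function. -/
def IsBil.toLin {f : M → N → Q} (h : IsBil k f) : M →ₗ[k] N →ₗ[k] Q :=
  LinearMap.mk₂ k f (fun x x' y => (h.1 y).map_add x x') (fun c x y => (h.1 y).map_smul c x)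
    (fun x y y' => (h.2 x).map_add y y') (fun c x y => (h.2 x).map_smul c y)

theorem IsBil.toLin_apply {f : M → N → Q} (h : IsBil k f) (x : M) (y : N) :
    h.toLin x y = f x y := rfl

theorem isBil_lin (F : M →ₗ[k] N →ₗ[k] Q) : IsBil k (fun x y => F x y) :=
  ⟨fun y => (F.flip y).isLinear, fun x => (F x).isLinear⟩

theorem IsBil.eq_lift {f : M → N → Q} (h : IsBil k f) :
    tlift k f = TensorProduct.lift h.toLin := by
  have hex : ∃ F : M ⊗[k] N →ₗ[k] Q, ∀ x y, F (x ⊗ₜ[k] y) = f x y :=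
    ⟨TensorProduct.lift h.toLin, fun x y => by simp [IsBil.toLin_apply]⟩
  unfold tlift
  rw [dif_pos hex]
  refine TensorProduct.ext' fun x y => ?_
  rw [hex.choose_spec x y]
  simp [IsBil.toLin_apply]

theorem IsBil.tlift_tmul {f : M → N → Q} (h : IsBil k f) (x : M) (y : N) :
    tlift k f (x ⊗ₜ[k] y) = f x y := by
  rw [h.eq_lift]; simp [IsBil.toLin_apply]

theorem tlift_lin (F : M →ₗ[k] N →ₗ[k] Q) : tlift k (fun x y => F x y) = TensorProduct.lift F := by
  rw [(isBil_lin F).eq_lift]; rfl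

theorem isLinearMap_tlift {f : L → M → N → Q} (hb : ∀ a, IsBil k (f a))
    (hl : ∀ x y, IsLinearMap k (fun a => f a x y)) (t : M ⊗[k] N) :
    IsLinearMap k (fun a => tlift k (f a) t) := by
  constructor
  · intro a b
    induction t using TensorProduct.induction_on with
    | zero => simp
    | tmul x y => simp only [(hb _).tlift_tmul]; exact (hl x y).map_add a b
    | add t u ht hu => simp only [map_add, ht, hu]; abel
  · intro c a
    induction t using TensorProduct.induction_on with
    | zero => simp
    | tmul x y => simp only [(hb _).tlift_tmul]; exact (hl x y).map_smul c a
    | add t u ht hu => simp only [map_add, ht, hu, smul_add]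

theorem isLinearMap_tlift_comp (f : M → N → Q) (T : L →ₗ[k] M ⊗[k] N) :
    IsLinearMap k (fun a => tlift k f (T a)) :=
  ((tlift k f).comp T).isLinear

end Bilinear

/-! ## Matrices with entries in algebras -/

section MatrixBilinear

variable {k : Type*} [CommRing k] {A B C D : Type*} [Ring A] [Algebra k A] [Ring B] [Algebra k B]
  [Ring C] [Algebra k C] [Ring D] [Algebra k D] {N : Type*} [Fintype N] [DecidableEq N]

/-- A scalar matrix viewed in an algebra. -/
def sc (A : Type*) {k : Type*} [CommRing k] [Ring A] [Algebra k A] {N : Type*}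
    (r : Matrix N N k) : Matrix N N A :=
  r.map (algebraMap k A)

@[simp] theorem sc_apply (r : Matrix N N k) (I J : N) : sc A r I J = algebraMap k A (r I J) := rfl

theorem sc_mul (r s : Matrix N N k) : sc A (r * s) = sc A r * sc A s :=
  Matrix.map_mul

theorem sc_one : sc A (1 : Matrix N N k) = 1 :=
  Matrix.map_one _ (map_zero _) (map_one _)

/-- The matrix product in which entries are multiplied by a bilinear map. -/
def bm (F : A →ₗ[k] B →ₗ[k] C) (P : Matrix N N A) (Q : Matrix N N B) : Matrix N N C :=
  fun I J => ∑ E, F (P I E) (Q E J)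

theorem bm_apply (F : A →ₗ[k] B →ₗ[k] C) (P : Matrix N N A) (Q : Matrix N N B) (I J : N) :
    bm F P Q I J = ∑ E, F (P I E) (Q E J) := rfl

theorem sc_mul_apply (r : Matrix N N k) (P : Matrix N N A) (I J : N) :
    (sc A r * P) I J = ∑ E, r I E • P E J := by
  simp [Matrix.mul_apply, Algebra.smul_def]

theorem mul_sc_apply (r : Matrix N N k) (P : Matrix N N A) (I J : N) :
    (P * sc A r) I J = ∑ E, r E J • P I E := by
  simp [Matrix.mul_apply, Algebra.smul_def, Algebra.commutes]

theorem bm_sc_mid (F : A →ₗ[k] B →ₗ[k] C) (P : Matrix N N A) (r : Matrix N N k)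
    (Q : Matrix N N B) : bm F (P * sc A r) Q = bm F P (sc B r * Q) := by
  ext I J
  simp only [bm_apply, sc_mul_apply, mul_sc_apply, map_sum, map_smul, LinearMap.sum_apply,
    LinearMap.smul_apply]
  rw [Finset.sum_comm]

theorem bm_sc_left (F : A →ₗ[k] B →ₗ[k] C) (P : Matrix N N A) (r : Matrix N N k)
    (Q : Matrix N N B) : bm F (sc A r * P) Q = sc C r * bm F P Q := by
  ext I J
  simp only [bm_apply, sc_mul_apply, map_sum, map_smul, LinearMap.sum_apply,
    LinearMap.smul_apply, Finset.smul_sum]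
  rw [Finset.sum_comm]

theorem bm_sc_right (F : A →ₗ[k] B →ₗ[k] C) (P : Matrix N N A) (r : Matrix N N k)
    (Q : Matrix N N B) : bm F P (Q * sc B r) = bm F P Q * sc C r := by
  ext I J
  simp only [bm_apply, mul_sc_apply, map_sum, map_smul, Finset.smul_sum]
  rw [Finset.sum_comm]

/-- Two matrices over possibly different algebras commute in the tensor product. -/
def MComm (k : Type*) [CommRing k] {A B : Type*} [Ring A] [Algebra k A] [Ring B] [Algebra k B]
    {N : Type*} [Fintype N] (P : Matrix N N A) (Q : Matrix N N B) : Prop :=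
  ∀ I J, ∑ E, P I E ⊗ₜ[k] Q E J = ∑ E, P E J ⊗ₜ[k] Q I E

theorem MComm.apply {P : Matrix N N A} {Q : Matrix N N B} (h : MComm k P Q)
    {M : Type*} [AddCommGroup M] [Module k M] {f : A → B → M} (hf : IsBil k f) (I J : N) :
    ∑ E, f (P I E) (Q E J) = ∑ E, f (P E J) (Q I E) := by
  have := congrArg (TensorProduct.lift hf.toLin) (h I J)
  simpa [map_sum, IsBil.toLin_apply] using this

theorem MComm.symm {P : Matrix N N A} {Q : Matrix N N B} (h : MComm k P Q) : MComm k Q P := by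
  intro I J
  have := congrArg (TensorProduct.comm k A B) (h I J)
  simpa [map_sum] using this.symm

theorem MComm.map {P : Matrix N N A} {Q : Matrix N N B} (h : MComm k P Q)
    (f : A →ₗ[k] C) (g : B →ₗ[k] D) : MComm k (P.map f) (Q.map g) := by
  intro I J
  have := congrArg (TensorProduct.map f g) (h I J)
  simpa [map_sum] using this

theorem MComm.mul_right {P : Matrix N N A} {Q Q' : Matrix N N B} (h : MComm k P Q)
    (h' : MComm k P Q') : MComm k P (Q * Q') := by
  intro I J
  simp only [Matrix.mul_apply, TensorProduct.tmul_sum]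
  rw [Finset.sum_comm]
  have e1 : ∀ F, ∑ E, P I E ⊗ₜ[k] (Q E F * Q' F J) = ∑ E, P E F ⊗ₜ[k] (Q I E * Q' F J) := by
    intro F
    exact h.apply (f := fun a b => a ⊗ₜ[k] (b * Q' F J))
      ⟨fun y => ⟨fun _ _ => add_tmul _ _ _, fun _ _ => rfl⟩,
       fun x => ⟨fun _ _ => by simp only [add_mul, tmul_add], fun _ _ => by simp⟩⟩ I F
  have e2 : ∀ E, ∑ F, P E F ⊗ₜ[k] (Q I E * Q' F J) = ∑ F, P F J ⊗ₜ[k] (Q I E * Q' E F) := by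
    intro E
    exact h'.apply (f := fun a b => a ⊗ₜ[k] (Q I E * b))
      ⟨fun y => ⟨fun _ _ => add_tmul _ _ _, fun _ _ => rfl⟩,
       fun x => ⟨fun _ _ => by simp only [mul_add, tmul_add], fun _ _ => by simp⟩⟩ E J
  simp only [e1]
  rw [Finset.sum_comm]
  simp only [e2]
  rw [Finset.sum_comm]

theorem MComm.mul_left {P P' : Matrix N N A} {Q : Matrix N N B} (h : MComm k P Q)
    (h' : MComm k P' Q) : MComm k (P * P') Q :=
  (h.symm.mul_right h'.symm).symm

theorem MComm.one_right (P : Matrix N N A) : MComm k P (1 : Matrix N N B) := by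
  intro I J
  simp [Matrix.one_apply, tmul_ite]

end MatrixBilinear

/-! ## Comatrices -/

/-- A matrix of elements spanning a matrix coalgebra. -/
structure IsComat (k : Type*) [Field k] {H : Type*} [Ring H] [HopfAlgebra k H] {N : Type*}
    [Fintype N] [DecidableEq N] (P : Matrix N N H) : Prop where
  comul : ∀ I J, Coalgebra.comul (R := k) (P I J) = ∑ A, P I A ⊗ₜ[k] P A J
  counit : ∀ I J, (Coalgebra.counit (R := k) (P I J) : k) = if I = J then 1 else 0

section Existence

variable {k : Type*} [Field k] {H : Type*} [Ring H] [HopfAlgebra k H]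

/-- The left action of the dual on a coalgebra. -/
noncomputable def coact₂ (φ : Module.Dual k H) : H →ₗ[k] H :=
  (TensorProduct.rid k H).toLinearMap ∘ₗ (φ.lTensor H) ∘ₗ Coalgebra.comul

/-- Contraction of the first leg. -/
noncomputable def coact₁ (φ : Module.Dual k H) : H →ₗ[k] H :=
  (TensorProduct.lid k H).toLinearMap ∘ₗ (φ.rTensor H) ∘ₗ Coalgebra.comul

theorem tensor_ext_right {V W : Type*} [AddCommGroup V] [Module k V] [AddCommGroup W] [Module k W]
    {s t : V ⊗[k] W}
    (h : ∀ φ : Module.Dual k W, TensorProduct.rid k V (φ.lTensor V s) =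
      TensorProduct.rid k V (φ.lTensor V t)) : s = t := by
  classical
  let b := Module.Basis.ofVectorSpace k W
  apply (TensorProduct.equivFinsuppOfBasisRight (M := V) b).injective
  ext i
  have key : ∀ u : V ⊗[k] W, TensorProduct.equivFinsuppOfBasisRight (M := V) b u i =
      TensorProduct.rid k V ((b.coord i).lTensor V u) := by
    intro u
    induction u using TensorProduct.induction_on with
    | zero => simp
    | tmul x y => simp
    | add x y hx hy => simp [hx, hy]
  rw [key, key, h]

theorem coact₂_coact₂ (φ ψ : Module.Dual k H) (h : H) :
    coact₂ ψ (coact₂ φ h) =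
      coact₂ ((LinearMap.mul' k k) ∘ₗ (TensorProduct.map ψ φ) ∘ₗ Coalgebra.comul) h := by
  have := Coalgebra.coassoc_apply (R := k) h
  let G : H ⊗[k] (H ⊗[k] H) →ₗ[k] H := (TensorProduct.rid k H).toLinearMap ∘ₗ
    ((LinearMap.mul' k k) ∘ₗ (TensorProduct.map ψ φ)).lTensor H
  have h2 := congrArg G this
  have e1 : ∀ t : H ⊗[k] H, G ((TensorProduct.assoc k H H H) ((Coalgebra.comul).rTensor H t)) =
      coact₂ ψ (TensorProduct.rid k H (φ.lTensor H t)) := by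
    intro t
    induction t using TensorProduct.induction_on with
    | zero => simp
    | tmul x y =>
      simp only [LinearMap.rTensor_tmul, LinearMap.lTensor_tmul, TensorProduct.rid_tmul, map_smul]
      have : ∀ u : H ⊗[k] H, G ((TensorProduct.assoc k H H H) (u ⊗ₜ y)) =
          φ y • (TensorProduct.rid k H) (ψ.lTensor H u) := by
        intro u
        induction u using TensorProduct.induction_on with
        | zero => simp
        | tmul a b => simp [G, smul_smul, mul_comm]
        | add x y hx hy => simp only [add_tmul, map_add, hx, hy, smul_add]
      exact this _
    | add x y hx hy => simp only [map_add, hx, hy]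
  have e2 : ∀ t : H ⊗[k] H, G ((Coalgebra.comul).lTensor H t) = TensorProduct.rid k H
      (((LinearMap.mul' k k) ∘ₗ (TensorProduct.map ψ φ) ∘ₗ Coalgebra.comul).lTensor H t) := by
    intro t
    induction t using TensorProduct.induction_on with
    | zero => simp
    | tmul x y => simp [G]
    | add x y hx hy => simp only [map_add, hx, hy]
  rw [e1, e2] at h2
  exact h2

theorem exists_comat_basis (h : H) : ∃ (n : ℕ) (v : Fin n → H) (x : Matrix (Fin n) (Fin n) H),
    IsComat k x ∧ (∀ j, Coalgebra.comul (R := k) (v j) = ∑ i, v i ⊗ₜ[k] x i j) ∧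
    h ∈ Submodule.span k (Set.range v) := by
  let act : Module.Dual k H →ₗ[k] H :=
    { toFun := fun φ => coact₂ φ h
      map_add' := fun φ ψ => by simp [coact₂, LinearMap.lTensor_add]
      map_smul' := fun c φ => by simp [coact₂, LinearMap.lTensor_smul] }
  let V := LinearMap.range act
  have hfin : Module.Finite k V := by
    obtain ⟨s, hs⟩ := TensorProduct.exists_finset (Coalgebra.comul (R := k) h)
    have : V ≤ Submodule.span k ((fun p : H × H => p.1) '' (s : Set (H × H))) := by
      rintro _ ⟨φ, rfl⟩
      change coact₂ φ h ∈ _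
      simp only [coact₂, LinearMap.comp_apply, hs, map_sum, LinearMap.lTensor_tmul]
      refine Submodule.sum_mem _ fun p hp => ?_
      simp only [LinearEquiv.coe_coe, TensorProduct.rid_tmul]
      exact Submodule.smul_mem _ _ (Submodule.subset_span ⟨p, hp, rfl⟩)
    have hf : Module.Finite k (Submodule.span k ((fun p : H × H => p.1) '' (s : Set (H × H)))) :=
      Module.Finite.span_of_finite k (s.finite_toSet.image _)
    exact Submodule.finiteDimensional_of_le this
  have hhV : h ∈ V := ⟨Coalgebra.counit, by
    change coact₂ Coalgebra.counit h = h
    simp [coact₂]⟩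
  have hstab : ∀ (ψ : Module.Dual k H) (v : H), v ∈ V → coact₂ ψ v ∈ V := by
    rintro ψ _ ⟨φ, rfl⟩
    exact ⟨_, (coact₂_coact₂ φ ψ h).symm⟩
  let b := Module.finBasis k V
  let v : Fin (Module.finrank k V) → H := fun i => (b i : H)
  choose φ hφ using fun i => LinearMap.exists_extend (b.coord i)
  have hexp : ∀ u ∈ V, u = ∑ i, φ i u • v i := by
    intro u hu
    have := congrArg (V.subtype) (b.sum_repr ⟨u, hu⟩)
    rw [map_sum] at this
    simp only [map_smul] at this
    refine this.symm.trans (Finset.sum_congr rfl fun i _ => ?_)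
    have e : φ i u = b.repr ⟨u, hu⟩ i := by
      have : φ i u = b.coord i ⟨u, hu⟩ := by rw [← hφ i]; rfl
      rw [this, Module.Basis.coord_apply]
    rw [e]; rfl
  have hφv : ∀ i j, φ i (v j) = if i = j then 1 else 0 := by
    intro i j
    have : φ i (v j) = b.coord i (b j) := by rw [← hφ i]; rfl
    rw [this, Module.Basis.coord_apply, Module.Basis.repr_self, Finsupp.single_apply]
    simp [eq_comm]
  let x : Matrix (Fin (Module.finrank k V)) (Fin (Module.finrank k V)) H :=
    fun i j => coact₁ (φ i) (v j)
  have hx : ∀ j, Coalgebra.comul (R := k) (v j) = ∑ i, v i ⊗ₜ[k] x i j := by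
    intro j
    apply tensor_ext_right
    intro ψ
    have h1 : coact₂ ψ (v j) ∈ V := hstab ψ _ (b j).2
    have h2 := hexp _ h1
    change coact₂ ψ (v j) = _
    rw [h2]
    simp only [map_sum, LinearMap.lTensor_tmul, TensorProduct.rid_tmul]
    refine Finset.sum_congr rfl fun i _ => ?_
    congr 1
    simp only [x, coact₁, coact₂, LinearMap.comp_apply, LinearEquiv.coe_coe]
    generalize Coalgebra.comul (R := k) (v j) = t
    induction t using TensorProduct.induction_on with
    | zero => simp
    | tmul a b => simp [mul_comm]
    | add a b ha hb => simp only [map_add, ha, hb]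
  refine ⟨_, v, x, ⟨fun i j => ?_, fun i j => ?_⟩, hx, ?_⟩
  · have := Coalgebra.coassoc_apply (R := k) (v j)
    let G : H ⊗[k] (H ⊗[k] H) →ₗ[k] H ⊗[k] H :=
      (TensorProduct.lid k (H ⊗[k] H)).toLinearMap ∘ₗ (φ i).rTensor (H ⊗[k] H)
    have h2 := congrArg G this
    have e2 : ∀ t : H ⊗[k] H, G ((Coalgebra.comul).lTensor H t) =
        Coalgebra.comul (R := k) (TensorProduct.lid k H ((φ i).rTensor H t)) := by
      intro t
      induction t using TensorProduct.induction_on with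
      | zero => simp
      | tmul x y => simp [G]
      | add x y hx hy => simp only [map_add, hx, hy]
    rw [e2] at h2
    change _ = Coalgebra.comul (R := k) (x i j) at h2
    rw [← h2, hx j]
    simp only [map_sum, LinearMap.rTensor_tmul]
    refine Finset.sum_congr rfl fun l _ => ?_
    have : ∀ (u : H ⊗[k] H) (y : H), G ((TensorProduct.assoc k H H H) (u ⊗ₜ y)) =
        (TensorProduct.lid k H ((φ i).rTensor H u)) ⊗ₜ y := by
      intro u y
      induction u using TensorProduct.induction_on with
      | zero => simp
      | tmul a b => simp [G, smul_tmul']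
      | add a b ha hb => simp only [map_add, add_tmul, ha, hb]
    rw [this]; rfl
  · rw [← hφv i j]
    have e : ∀ t : H ⊗[k] H, (Coalgebra.counit (R := k)
        (TensorProduct.lid k H ((φ i).rTensor H t)) : k) =
        φ i (TensorProduct.rid k H ((Coalgebra.counit (R := k) (A := H)).lTensor H t)) := by
      intro t
      induction t using TensorProduct.induction_on with
      | zero => simp
      | tmul a b => simp [mul_comm]
      | add a b ha hb => simp only [map_add, ha, hb]
    have e2 := e (Coalgebra.comul (R := k) (v j))
    rw [Coalgebra.lTensor_counit_comul] at e2
    simp only [TensorProduct.rid_tmul, one_smul] at e2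
    exact e2
  · rw [hexp h hhV]
    exact Submodule.sum_mem _ fun i _ =>
      Submodule.smul_mem _ _ (Submodule.subset_span ⟨i, rfl⟩)

theorem comat_span :
    Submodule.span k {a : H | ∃ (n : ℕ) (x : Matrix (Fin n) (Fin n) H) (i j : Fin n),
    IsComat k x ∧ a = x i j} = ⊤ := by
  rw [eq_top_iff]
  intro h _
  obtain ⟨n, v, x, hx, hv, hh⟩ := exists_comat_basis (k := k) h
  refine Submodule.span_le.2 ?_ hh
  rintro _ ⟨j, rfl⟩
  have := Coalgebra.rTensor_counit_comul (R := k) (v j)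
  rw [hv j] at this
  have h2 := congrArg (TensorProduct.lid k H) this
  simp only [map_sum, LinearMap.rTensor_tmul, TensorProduct.lid_tmul, one_smul] at h2
  rw [← h2]
  exact Submodule.sum_mem _ fun i _ =>
    Submodule.smul_mem _ _ (Submodule.subset_span ⟨n, x, i, j, hx, rfl⟩)

/-- A linear identity may be checked on entries of comatrices. -/
theorem comat_ext {M : Type*} [AddCommGroup M] [Module k M] {F G : H →ₗ[k] M}
    (h : ∀ (n : ℕ) (x : Matrix (Fin n) (Fin n) H), IsComat k x → ∀ i j, F (x i j) = G (x i j)) :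
    F = G := by
  refine LinearMap.ext_on comat_span ?_
  rintro _ ⟨n, x, i, j, hx, rfl⟩
  exact h n x hx i j

end Existence

section Bil

variable {k : Type*} [CommRing k] {M N Q : Type*}
  [AddCommGroup M] [Module k M] [AddCommGroup N] [Module k N] [AddCommGroup Q] [Module k Q]

theorem IsBil.of {f : M → N → Q}
    (h1 : ∀ x x' y, f (x + x') y = f x y + f x' y) (h2 : ∀ (c : k) x y, f (c • x) y = c • f x y)
    (h3 : ∀ x y y', f x (y + y') = f x y + f x y') (h4 : ∀ (c : k) x y, f x (c • y) = c • f x y) :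
    IsBil k f :=
  ⟨fun y => ⟨fun x x' => h1 x x' y, fun c x => h2 c x y⟩,
    fun x => ⟨fun y y' => h3 x y y', fun c y => h4 c x y⟩⟩

end Bil

/-! ## Tensoring comatrices with identity matrices -/

section Kronecker

variable {k : Type*} [Field k] {H : Type*} [Ring H] [HopfAlgebra k H]
  {n m : Type} [Fintype n] [DecidableEq n] [Fintype m] [DecidableEq m]

/-- `x ⊗ 1`. -/
def kron₁ {A : Type*} [Zero A] (m : Type) [DecidableEq m] {n : Type} (x : Matrix n n A) :
    Matrix (n × m) (n × m) A :=
  fun I J => if I.2 = J.2 then x I.1 J.1 else 0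

/-- `1 ⊗ y`. -/
def kron₂ {A : Type*} [Zero A] (n : Type) [DecidableEq n] {m : Type} (y : Matrix m m A) :
    Matrix (n × m) (n × m) A :=
  fun I J => if I.1 = J.1 then y I.2 J.2 else 0

theorem isComat_kron₁ {x : Matrix n n H} (hx : IsComat k x) : IsComat k (kron₁ m x) := by
  constructor
  · rintro ⟨i, c⟩ ⟨j, d⟩
    simp only [kron₁, Fintype.sum_prod_type, apply_ite (Coalgebra.comul (R := k)), map_zero,
      hx.comul]
    rw [Finset.sum_congr rfl fun a _ => Finset.sum_eq_single c (fun b _ hb => by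
      rw [if_neg (Ne.symm hb), zero_tmul]) (by simp)]
    by_cases h : c = d <;> simp [h]
  · rintro ⟨i, c⟩ ⟨j, d⟩
    simp only [kron₁, apply_ite (Coalgebra.counit (R := k)), map_zero, hx.counit, Prod.mk.injEq,
      ite_and]
    split_ifs <;> rfl

theorem isComat_kron₂ {y : Matrix m m H} (hy : IsComat k y) : IsComat k (kron₂ n y) := by
  constructor
  · rintro ⟨i, c⟩ ⟨j, d⟩
    simp only [kron₂, Fintype.sum_prod_type_right, apply_ite (Coalgebra.comul (R := k)), map_zero,
      hy.comul]
    rw [Finset.sum_congr rfl fun a _ => Finset.sum_eq_single i (fun b _ hb => by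
      rw [if_neg (Ne.symm hb), zero_tmul]) (by simp)]
    by_cases h : i = j <;> simp [h]
  · rintro ⟨i, c⟩ ⟨j, d⟩
    simp only [kron₂, apply_ite (Coalgebra.counit (R := k)), map_zero, hy.counit, Prod.mk.injEq,
      ite_and]

theorem sum_kron₁_kron₂ {A B M : Type*} [AddCommGroup A] [Module k A] [AddCommGroup B]
    [Module k B] [AddCommGroup M] [Module k M]
    (F : A →ₗ[k] B →ₗ[k] M) (x : Matrix n n A) (y : Matrix m m B) (I J : n × m) :
    ∑ E, F (kron₁ m x I E) (kron₂ n y E J) = F (x I.1 J.1) (y I.2 J.2) := by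
  obtain ⟨i, c⟩ := I
  obtain ⟨j, d⟩ := J
  rw [Fintype.sum_prod_type, Finset.sum_eq_single j, Finset.sum_eq_single c]
  · simp [kron₁, kron₂]
  · intro b _ hb; simp [kron₁, Ne.symm hb]
  · simp
  · intro b _ hb; exact Finset.sum_eq_zero fun e _ => by simp [kron₂, hb]
  · simp

theorem sum_kron₂_kron₁ {A B M : Type*} [AddCommGroup A] [Module k A] [AddCommGroup B]
    [Module k B] [AddCommGroup M] [Module k M]
    (F : A →ₗ[k] B →ₗ[k] M) (x : Matrix n n A) (y : Matrix m m B) (I J : n × m) :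
    ∑ E, F (kron₁ m x E J) (kron₂ n y I E) = F (x I.1 J.1) (y I.2 J.2) := by
  obtain ⟨i, c⟩ := I
  obtain ⟨j, d⟩ := J
  rw [Fintype.sum_prod_type, Finset.sum_eq_single i, Finset.sum_eq_single d]
  · simp [kron₁, kron₂]
  · intro b _ hb; simp [kron₁, hb]
  · simp
  · intro b _ hb; exact Finset.sum_eq_zero fun e _ => by simp [kron₂, Ne.symm hb]
  · simp

theorem mcomm_kron₁_kron₂ (x : Matrix n n H) (y : Matrix m m H) :
    MComm k (kron₁ m x) (kron₂ n y) := by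
  intro I J
  exact (sum_kron₁_kron₂ (TensorProduct.mk k H H) x y I J).trans
    (sum_kron₂_kron₁ (TensorProduct.mk k H H) x y I J).symm

theorem sum_kron₁_kron₁ {A B M : Type*} [AddCommGroup A] [Module k A] [AddCommGroup B]
    [Module k B] [AddCommGroup M] [Module k M]
    (F : A →ₗ[k] B →ₗ[k] M) (x : Matrix n n A) (y : Matrix n n B) (I J : n × m) :
    ∑ E, F (kron₁ m x I E) (kron₁ m y E J) =
      kron₁ m (fun i j => ∑ e, F (x i e) (y e j)) I J := by
  obtain ⟨i, c⟩ := I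
  obtain ⟨j, d⟩ := J
  simp only [kron₁, Fintype.sum_prod_type]
  rw [Finset.sum_congr rfl fun a _ => Finset.sum_eq_single c (fun b _ hb => by
      rw [if_neg (Ne.symm hb), map_zero, LinearMap.zero_apply]) (by simp)]
  by_cases h : c = d <;> simp [h]

theorem mcomm_kron₁ {x y : Matrix n n H} (h : MComm k x y) :
    MComm k (kron₁ m x) (kron₁ m y) := by
  intro I J
  have h1 := sum_kron₁_kron₁ (m := m) (TensorProduct.mk k H H) x y I J
  have h2 := sum_kron₁_kron₁ (m := m) (TensorProduct.mk k H H).flip y x I J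
  simp only [TensorProduct.mk_apply, LinearMap.flip_apply] at h1 h2
  rw [h1, h2]
  congr 1
  ext i j
  exact h i j

end Kronecker

/-! ## Coquasitriangular structures on comatrices -/

/-- The axioms of a coquasitriangular structure, expressed on comatrices. -/
structure CQ {k : Type*} [Field k] {H : Type*} [Ring H] [HopfAlgebra k H]
    (R : H →ₗ[k] H →ₗ[k] k) : Prop where
  mul_right : ∀ {n : Type} [Fintype n] [DecidableEq n] {x : Matrix n n H}, IsComat k x →
    ∀ (i j : n) (g f : H), R (x i j) (g * f) = ∑ a, R (x i a) f * R (x a j) g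
  mul_left : ∀ {n : Type} [Fintype n] [DecidableEq n] {x : Matrix n n H}, IsComat k x →
    ∀ (i j : n) (h g : H), R (h * g) (x i j) = ∑ a, R h (x i a) * R g (x a j)
  one_left : ∀ h, R 1 h = Coalgebra.counit h
  one_right : ∀ h, R h 1 = Coalgebra.counit h
  rtt : ∀ {n : Type} [Fintype n] [DecidableEq n] {x y : Matrix n n H}, IsComat k x →
    IsComat k y → ∀ i j c d,
    ∑ e, ∑ a, R (x a j) (y e d) • (y c e * x i a) = ∑ a, ∑ e, R (x i a) (y c e) • (x a j * y e d)

section CQ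

variable {k : Type*} [Field k] {H : Type*} [Ring H] [HopfAlgebra k H]

theorem IsComat.tlift {n : Type} [Fintype n] [DecidableEq n] {x : Matrix n n H}
    (hx : IsComat k x) {M : Type*} [AddCommGroup M] [Module k M] {f : H → H → M}
    (hf : IsBil k f) (i j : n) :
    tlift k f (Coalgebra.comul (R := k) (x i j)) = ∑ a, f (x i a) (x a j) := by
  rw [hx.comul, map_sum]
  exact Finset.sum_congr rfl fun a _ => hf.tlift_tmul _ _

theorem idem_unit {A : Type*} [Ring A] {u v : A} (h : u * u = u) (h' : u * v = 1) : u = 1 := by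
  rw [← h', ← h, mul_assoc, h', mul_one, h]

theorem IsCQT.cq {R Ri : H →ₗ[k] H →ₗ[k] k}
    (hR : IsCQT (fun h g => R h g) (fun h g => Ri h g)) : CQ R := by
  obtain ⟨-, -, hinv, -, h1, h2, h3⟩ := hR
  have hmr : ∀ {n : Type} [Fintype n] [DecidableEq n] {x : Matrix n n H}, IsComat k x →
      ∀ (i j : n) (g f : H), R (x i j) (g * f) = ∑ a, R (x i a) f * R (x a j) g := by
    intro n _ _ x hx i j g f
    have := h1 (x i j) g f
    rwa [hx.tlift (f := fun h1 h2 => R h1 f * R h2 g)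
      (.of (by simp [add_mul]) (by simp [mul_assoc]) (by simp [mul_add])
        (by simp [mul_left_comm]))] at this
  have hml : ∀ {n : Type} [Fintype n] [DecidableEq n] {x : Matrix n n H}, IsComat k x →
      ∀ (i j : n) (h g : H), R (h * g) (x i j) = ∑ a, R h (x i a) * R g (x a j) := by
    intro n _ _ x hx i j h g
    have := h2 h g (x i j)
    rwa [hx.tlift (f := fun h1 h2 => R h h1 * R g h2)
      (.of (by simp [add_mul]) (by simp [mul_assoc]) (by simp [mul_add])
        (by simp [mul_left_comm]))] at this
  have one1 : IsComat k (fun _ _ => 1 : Matrix (Fin 1) (Fin 1) H) :=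
    ⟨fun i j => by simp [Algebra.TensorProduct.one_def], fun i j => by simp [Subsingleton.elim i j]⟩
  have hbil : ∀ h1 h2 : H, IsBil k (fun g1 g2 => R h1 g1 * Ri h2 g2) := fun h1 h2 =>
    .of (by simp [add_mul]) (by simp [mul_assoc]) (by simp [mul_add]) (by simp [mul_left_comm])
  have hconv : ∀ {n m : Type} [Fintype n] [DecidableEq n] [Fintype m] [DecidableEq m]
      {x : Matrix n n H} {y : Matrix m m H}, IsComat k x → IsComat k y → ∀ i j c d,
      ∑ a, ∑ e, R (x i a) (y c e) * Ri (x a j) (y e d) =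
        (if i = j then 1 else 0) * (if c = d then 1 else 0) := by
    intro n m _ _ _ _ x y hx hy i j c d
    have := hinv (x i j) (y c d)
    rw [hx.counit, hy.counit] at this
    rw [← this]
    unfold convKK
    rw [hx.tlift]
    · exact Finset.sum_congr rfl fun a _ => (hy.tlift (hbil _ _) c d).symm
    · constructor
      · intro h2
        exact isLinearMap_tlift (fun a => hbil a h2)
          (fun x y => ⟨by simp [add_mul], by simp [mul_assoc]⟩) _
      · intro h1
        exact isLinearMap_tlift (fun a => hbil h1 a)
          (fun x y => ⟨by simp [mul_add], by simp [mul_left_comm]⟩) _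
  refine ⟨hmr, hml, ?_, ?_, ?_⟩
  · suffices h : R 1 = Coalgebra.counit from fun g => by rw [h]
    refine comat_ext fun n x hx i j => ?_
    let U : Matrix (Fin n) (Fin n) k := fun i j => R 1 (x i j)
    let V : Matrix (Fin n) (Fin n) k := fun i j => Ri 1 (x i j)
    have hU : U * U = U := by
      ext i j
      have := hml hx i j 1 1
      rw [mul_one] at this
      rw [Matrix.mul_apply]; exact this.symm
    have hV : U * V = 1 := by
      ext i j
      have := hconv one1 hx 0 0 i j
      simpa [Matrix.mul_apply, Matrix.one_apply] using this
    have hU1 : U = 1 := idem_unit hU hV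
    have := congrFun (congrFun hU1 i) j
    rw [hx.counit]; simpa [U, Matrix.one_apply] using this
  · suffices h : R.flip 1 = Coalgebra.counit from fun g => by rw [← h]; rfl
    refine comat_ext fun n x hx i j => ?_
    let U : Matrix (Fin n) (Fin n) k := fun i j => R (x i j) 1
    let V : Matrix (Fin n) (Fin n) k := fun i j => Ri (x i j) 1
    have hU : U * U = U := by
      ext i j
      have := hmr hx i j 1 1
      rw [mul_one] at this
      rw [Matrix.mul_apply]; exact this.symm
    have hV : U * V = 1 := by
      ext i j
      have := hconv hx one1 i j 0 0
      simpa [Matrix.mul_apply, Matrix.one_apply] using this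
    have hU1 : U = 1 := idem_unit hU hV
    have := congrFun (congrFun hU1 i) j
    rw [hx.counit]; simpa [U, Matrix.one_apply] using this
  · intro n _ _ x y hx hy i j c d
    have := h3 (x i j) (y c d)
    have b1 : ∀ g1 g2 : H, IsBil k (fun h1 h2 => R h2 g2 • (g1 * h1)) := fun g1 g2 =>
      .of (by simp [mul_add]) (by simp [smul_smul, mul_comm]) (by simp [add_smul]) (by simp [mul_smul])
    have b2 : ∀ h1 h2 : H, IsBil k (fun g1 g2 => R h1 g1 • (h2 * g2)) := fun h1 h2 =>
      .of (by simp [add_smul]) (by simp [mul_smul]) (by simp [mul_add]) (by simp [smul_smul, mul_comm])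
    rw [hx.tlift, hy.tlift] at this
    · convert this using 3 with e _ e _
      · exact (hx.tlift (b1 _ _) i j).symm
      · exact (hy.tlift (b2 _ _) c d).symm
    · constructor
      · intro g2
        exact isLinearMap_tlift (fun a => b1 a g2)
          (fun x y => ⟨by simp [add_mul], by simp [smul_smul, mul_comm]⟩) _
      · intro g1
        exact isLinearMap_tlift (fun a => b1 g1 a)
          (fun x y => ⟨by simp [add_smul], by simp [mul_smul]⟩) _
    · constructor
      · intro g2
        exact isLinearMap_tlift (fun a => b2 a g2)
          (fun x y => ⟨by simp [add_smul], by simp [mul_smul]⟩) _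
      · intro g1
        exact isLinearMap_tlift (fun a => b2 g1 a)
          (fun x y => ⟨by simp [add_mul], by simp [smul_smul, mul_comm]⟩) _

end CQ

/-! ## The transmutation operations on comatrices -/

section Nested

variable {k : Type*} [CommRing k] {L M N Q A B : Type*} [AddCommGroup L] [Module k L]
  [AddCommGroup M] [Module k M] [AddCommGroup N] [Module k N] [AddCommGroup Q] [Module k Q]
  [AddCommGroup A] [Module k A] [AddCommGroup B] [Module k B]

theorem isBil_tlift {f : M → N → A → B → Q} (hb : ∀ x y, IsBil k (f x y))
    (hl : ∀ a b, IsBil k (fun x y => f x y a b)) (t : A ⊗[k] B) :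
    IsBil k (fun x y => tlift k (f x y) t) :=
  ⟨fun y => isLinearMap_tlift (fun x => hb x y) (fun a b => (hl a b).1 y) t,
    fun x => isLinearMap_tlift (hb x) (fun a b => (hl a b).2 x) t⟩

theorem isBil_tlift_right {f : M → A → B → Q} (T : N →ₗ[k] A ⊗[k] B) (hb : ∀ x, IsBil k (f x))
    (hl : ∀ a b, IsLinearMap k (fun x => f x a b)) :
    IsBil k (fun x y => tlift k (f x) (T y)) :=
  ⟨fun y => isLinearMap_tlift hb hl (T y), fun x => isLinearMap_tlift_comp (f x) T⟩

theorem isBil_tlift_left {f : N → A → B → Q} (T : M →ₗ[k] A ⊗[k] B) (hb : ∀ x, IsBil k (f x))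
    (hl : ∀ a b, IsLinearMap k (fun x => f x a b)) :
    IsBil k (fun x y => tlift k (f y) (T x)) :=
  ⟨fun y => isLinearMap_tlift_comp (f y) T, fun x => isLinearMap_tlift hb hl (T x)⟩

end Nested

section Operations

variable {k : Type*} [Field k] {H : Type*} [Ring H] [HopfAlgebra k H]

section Bullet

variable (R : H →ₗ[k] H →ₗ[k] k)

/-- The six-fold linear expression underlying the transmutation product. -/
noncomputable def bulletExpr (h1 h2 h3 g1 g2 g3 : H) : H :=
  (R h3 (HopfAlgebra.antipode k g1) * R h1 g2 : k) • (h2 * g3)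

noncomputable def bulletExpr₁ (h1 h2 h3 g1 g23 : H) : H :=
  tlift k (fun g2 g3 => bulletExpr R h1 h2 h3 g1 g2 g3) (Coalgebra.comul (R := k) g23)

noncomputable def bulletExpr₂ (g h1 h2 h3 : H) : H :=
  tlift k (fun g1 g23 => bulletExpr₁ R h1 h2 h3 g1 g23) (Coalgebra.comul (R := k) g)

noncomputable def bulletExpr₃ (g h1 h23 : H) : H :=
  tlift k (fun h2 h3 => bulletExpr₂ R g h1 h2 h3) (Coalgebra.comul (R := k) h23)

theorem bulletTrans_eq (h g : H) : bulletTrans (fun h g => R h g) h g =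
    tlift k (fun h1 h23 => bulletExpr₃ R g h1 h23) (Coalgebra.comul (R := k) h) := rfl

theorem bulletExpr_bil (h1 h2 h3 g1 : H) : IsBil k (bulletExpr R h1 h2 h3 g1) :=
  .of (by simp [bulletExpr, mul_add, add_smul]) (by simp [bulletExpr, smul_smul, mul_left_comm, mul_comm])
    (by simp [bulletExpr, mul_add]) (by simp [bulletExpr, smul_smul, mul_comm])

theorem bulletExpr₁_bil (h1 h2 h3 : H) : IsBil k (bulletExpr₁ R h1 h2 h3) :=
  isBil_tlift_right _ (fun _ => bulletExpr_bil R _ _ _ _)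
    fun _ _ => ⟨by simp [bulletExpr, add_mul, add_smul], by simp [bulletExpr, smul_smul, mul_assoc]⟩

theorem bulletExpr₁_lin1 (h2 h3 g1 g23 : H) : IsLinearMap k fun h1 => bulletExpr₁ R h1 h2 h3 g1 g23 :=
  isLinearMap_tlift (fun _ => bulletExpr_bil R _ _ _ _)
    (fun _ _ => ⟨by simp [bulletExpr, mul_add, add_smul], by simp [bulletExpr, smul_smul, mul_left_comm]⟩) _

theorem bulletExpr₁_lin2 (h1 h3 g1 g23 : H) : IsLinearMap k fun h2 => bulletExpr₁ R h1 h2 h3 g1 g23 :=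
  isLinearMap_tlift (fun _ => bulletExpr_bil R _ _ _ _)
    (fun _ _ => ⟨by simp [bulletExpr, add_mul], by simp [bulletExpr, smul_smul, mul_comm]⟩) _

theorem bulletExpr₁_lin3 (h1 h2 g1 g23 : H) : IsLinearMap k fun h3 => bulletExpr₁ R h1 h2 h3 g1 g23 :=
  isLinearMap_tlift (fun _ => bulletExpr_bil R _ _ _ _)
    (fun _ _ => ⟨by simp [bulletExpr, add_mul, add_smul], by simp [bulletExpr, smul_smul, mul_assoc]⟩) _

theorem bulletExpr₂_bil (g h1 : H) : IsBil k (bulletExpr₂ R g h1) :=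
  isBil_tlift (f := bulletExpr₁ R h1) (fun _ _ => bulletExpr₁_bil R _ _ _)
    (fun _ _ => ⟨fun _ => bulletExpr₁_lin2 R _ _ _ _, fun _ => bulletExpr₁_lin3 R _ _ _ _⟩) _

theorem bulletExpr₂_lin1 (g h2 h3 : H) : IsLinearMap k fun h1 => bulletExpr₂ R g h1 h2 h3 :=
  isLinearMap_tlift (fun _ => bulletExpr₁_bil R _ _ _) (fun _ _ => bulletExpr₁_lin1 R _ _ _ _) _

theorem bulletExpr₂_lin (h1 h2 h3 : H) : IsLinearMap k fun g => bulletExpr₂ R g h1 h2 h3 :=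
  isLinearMap_tlift_comp _ Coalgebra.comul

theorem bulletExpr₃_bil (g : H) : IsBil k (bulletExpr₃ R g) :=
  isBil_tlift_right _ (fun _ => bulletExpr₂_bil R _ _) (fun _ _ => bulletExpr₂_lin1 R _ _ _)

theorem bulletExpr₃_lin (h1 h23 : H) : IsLinearMap k fun g => bulletExpr₃ R g h1 h23 :=
  isLinearMap_tlift (fun _ => bulletExpr₂_bil R _ _) (fun _ _ => bulletExpr₂_lin R _ _ _) _

theorem bulletTrans_bil : IsBil k (bulletTrans (k := k) (fun h g => R h g)) :=
  isBil_tlift_left Coalgebra.comul (fun g => bulletExpr₃_bil R g) (fun _ _ => bulletExpr₃_lin R _ _)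

/-- The transmutation product as a bilinear map. -/
noncomputable def bulL : H →ₗ[k] H →ₗ[k] H := (bulletTrans_bil R).toLin

theorem bulL_apply (x y : H) : bulL R x y = bulletTrans (fun h g => R h g) x y := rfl

theorem bulL_comat {n m : Type} [Fintype n] [DecidableEq n] [Fintype m] [DecidableEq m]
    {x : Matrix n n H} {y : Matrix m m H} (hx : IsComat k x) (hy : IsComat k y)
    (i j : n) (c d : m) : bulL R (x i j) (y c d) = ∑ a, ∑ b, ∑ e, ∑ f,
      (R (x b j) (HopfAlgebra.antipode k (y c e)) * R (x i a) (y e f)) • (x a b * y f d) := by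
  rw [bulL_apply, bulletTrans_eq, hx.tlift (bulletExpr₃_bil R _)]
  refine Finset.sum_congr rfl fun a _ => ?_
  rw [bulletExpr₃, hx.tlift (bulletExpr₂_bil R _ _)]
  refine Finset.sum_congr rfl fun b _ => ?_
  rw [bulletExpr₂, hy.tlift (bulletExpr₁_bil R _ _ _)]
  refine Finset.sum_congr rfl fun e _ => ?_
  rw [bulletExpr₁, hy.tlift (bulletExpr_bil R _ _ _ _)]
  rfl

end Bullet

section Act

variable (R : H →ₗ[k] H →ₗ[k] k)

noncomputable def actExpr (h1 h2 h3 g1 g2 : H) : H := (R g1 h1 * R h3 g2 : k) • h2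

noncomputable def actExpr₁ (g h1 h2 h3 : H) : H :=
  tlift k (fun g1 g2 => actExpr R h1 h2 h3 g1 g2) (Coalgebra.comul (R := k) g)

noncomputable def actExpr₂ (g h1 h23 : H) : H :=
  tlift k (fun h2 h3 => actExpr₁ R g h1 h2 h3) (Coalgebra.comul (R := k) h23)

theorem actTrans_eq (h g : H) : actTrans (fun h g => R h g) h g =
    tlift k (fun h1 h23 => actExpr₂ R g h1 h23) (Coalgebra.comul (R := k) h) := rfl

theorem actExpr_bil (h1 h2 h3 : H) : IsBil k (actExpr R h1 h2 h3) :=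
  .of (by simp [actExpr, add_mul, add_smul]) (by simp [actExpr, smul_smul, mul_assoc])
    (by simp [actExpr, mul_add, add_smul]) (by simp [actExpr, smul_smul, mul_left_comm, mul_comm])

theorem actExpr₁_bil (g h1 : H) : IsBil k (actExpr₁ R g h1) :=
  isBil_tlift (f := actExpr R h1) (fun _ _ => actExpr_bil R _ _ _)
    (fun _ _ => .of (by simp [actExpr]) (by simp [actExpr, smul_smul, mul_comm])
      (by simp [actExpr, mul_add, add_smul])
      (by simp [actExpr, smul_smul, mul_left_comm])) _

theorem actExpr₁_lin1 (g h2 h3 : H) : IsLinearMap k fun h1 => actExpr₁ R g h1 h2 h3 :=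
  isLinearMap_tlift (fun _ => actExpr_bil R _ _ _)
    (fun _ _ => ⟨by simp [actExpr, add_mul, add_smul], by simp [actExpr, smul_smul, mul_assoc]⟩) _

theorem actExpr₁_lin (h1 h2 h3 : H) : IsLinearMap k fun g => actExpr₁ R g h1 h2 h3 :=
  isLinearMap_tlift_comp _ Coalgebra.comul

theorem actExpr₂_bil (g : H) : IsBil k (actExpr₂ R g) :=
  isBil_tlift_right _ (fun _ => actExpr₁_bil R _ _) (fun _ _ => actExpr₁_lin1 R _ _ _)

theorem actExpr₂_lin (h1 h23 : H) : IsLinearMap k fun g => actExpr₂ R g h1 h23 :=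
  isLinearMap_tlift (fun _ => actExpr₁_bil R _ _) (fun _ _ => actExpr₁_lin R _ _ _) _

theorem actTrans_bil : IsBil k (actTrans (k := k) (fun h g => R h g)) :=
  isBil_tlift_left Coalgebra.comul (fun g => actExpr₂_bil R g) (fun _ _ => actExpr₂_lin R _ _)

/-- The transmutation action as a bilinear map. -/
noncomputable def actL : H →ₗ[k] H →ₗ[k] H := (actTrans_bil R).toLin

theorem actL_apply (x y : H) : actL R x y = actTrans (fun h g => R h g) x y := rfl

theorem actL_comat {n m : Type} [Fintype n] [DecidableEq n] [Fintype m] [DecidableEq m]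
    {x : Matrix n n H} {y : Matrix m m H} (hx : IsComat k x) (hy : IsComat k y)
    (i j : n) (c d : m) : actL R (x i j) (y c d) = ∑ a, ∑ b, ∑ e,
      (R (y c e) (x i a) * R (x b j) (y e d)) • x a b := by
  rw [actL_apply, actTrans_eq, hx.tlift (actExpr₂_bil R _)]
  refine Finset.sum_congr rfl fun a _ => ?_
  rw [actExpr₂, hx.tlift (actExpr₁_bil R _ _)]
  refine Finset.sum_congr rfl fun b _ => ?_
  rw [actExpr₁, hy.tlift (actExpr_bil R _ _ _)]
  rfl

end Act

section Ad

noncomputable def adExpr (k : Type*) [Field k] {H : Type*} [Ring H] [HopfAlgebra k H]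
    (h1 h2 h3 : H) : H ⊗[k] H :=
  h2 ⊗ₜ[k] (HopfAlgebra.antipode k h1 * h3)

noncomputable def adExpr₁ (k : Type*) [Field k] {H : Type*} [Ring H] [HopfAlgebra k H]
    (h1 h23 : H) : H ⊗[k] H :=
  tlift k (fun h2 h3 => adExpr k h1 h2 h3) (Coalgebra.comul (R := k) h23)

theorem adRTrans_eq (h : H) : adRTrans (k := k) h =
    tlift k (fun h1 h23 => adExpr₁ k h1 h23) (Coalgebra.comul (R := k) h) := rfl

theorem adExpr_bil (h1 : H) : IsBil k (adExpr k h1) :=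
  .of (by simp [adExpr, add_tmul]) (by simp [adExpr, smul_tmul'])
    (by simp [adExpr, mul_add, tmul_add]) (by simp [adExpr])

theorem adExpr₁_bil : IsBil k (adExpr₁ k (H := H)) :=
  isBil_tlift_right _ (fun _ => adExpr_bil _)
    (fun _ _ => ⟨by simp [adExpr, add_mul, tmul_add], by simp [adExpr]⟩)

/-- The right adjoint coaction as a linear map. -/
noncomputable def adL (k : Type*) [Field k] {H : Type*} [Ring H] [HopfAlgebra k H] :
    H →ₗ[k] H ⊗[k] H :=
  tlift k (fun h1 h23 => adExpr₁ k h1 h23) ∘ₗ Coalgebra.comul (R := k)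

theorem adL_apply (x : H) : adL k x = adRTrans (k := k) x := rfl

theorem adL_comat {n : Type} [Fintype n] [DecidableEq n]
    {x : Matrix n n H} (hx : IsComat k x) (i j : n) : adL k (x i j) = ∑ a, ∑ b,
      x a b ⊗ₜ[k] (HopfAlgebra.antipode k (x i a) * x b j) := by
  rw [adL_apply, adRTrans_eq, hx.tlift adExpr₁_bil]
  refine Finset.sum_congr rfl fun a _ => ?_
  rw [adExpr₁, hx.tlift (adExpr_bil _)]
  rfl

end Ad

end Operations

/-! ## Matrix identities for comatrices -/

section Sums

variable {M ι κ μ : Type*} [AddCommMonoid M] [Fintype ι] [Fintype κ] [Fintype μ]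

theorem sum_rot (f : ι → κ → μ → M) :
    ∑ a, ∑ b, ∑ c, f a b c = ∑ b, ∑ c, ∑ a, f a b c := by
  rw [Finset.sum_comm]
  exact Finset.sum_congr rfl fun b _ => Finset.sum_comm

theorem sum_swap₂ (f : ι → κ → μ → M) :
    ∑ a, ∑ b, ∑ c, f a b c = ∑ a, ∑ c, ∑ b, f a b c :=
  Finset.sum_congr rfl fun _ _ => Finset.sum_comm

end Sums

section MatrixIdentities

variable {k : Type*} [Field k] {H : Type*} [Ring H] [HopfAlgebra k H]
  {N : Type} [Fintype N] [DecidableEq N] {P Q Z : Matrix N N H}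

theorem sc_self (r : Matrix N N k) : sc k r = r := by ext; simp

theorem IsComat.mul (hP : IsComat k P) (hQ : IsComat k Q) (h : MComm k P Q) :
    IsComat k (P * Q) := by
  constructor
  · intro I J
    simp only [Matrix.mul_apply, map_sum, Bialgebra.comul_mul, hP.comul, hQ.comul,
      Finset.sum_mul_sum, Algebra.TensorProduct.tmul_mul_tmul, sum_tmul, tmul_sum]
    have e : ∀ E F, ∑ A, (P I E * Q A F) ⊗ₜ[k] (P E A * Q F J) =
        ∑ A, (P I E * Q E A) ⊗ₜ[k] (P A F * Q F J) := by
      intro E F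
      exact h.apply (f := fun a b => (P I E * b) ⊗ₜ[k] (a * Q F J))
        (.of (by simp [add_mul, tmul_add]) (by simp) (by simp [mul_add, add_tmul])
          (by simp [smul_tmul'])) E F
    rw [sum_rot]
    simp only [e]
    rw [sum_swap₂, sum_rot, sum_swap₂]
  · intro I J
    simp only [Matrix.mul_apply, map_sum, Bialgebra.counit_mul, hP.counit, hQ.counit]
    simp

variable {R : H →ₗ[k] H →ₗ[k] k} (hR : CQ R)

include hR in
theorem bmR_mul_left (hZ : IsComat k Z) (h : MComm k Q Z) :
    bm R (P * Q) Z = bm R P Z * bm R Q Z := by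
  ext I J
  simp only [Matrix.mul_apply, bm_apply, map_sum, LinearMap.sum_apply, hR.mul_left hZ,
    Finset.sum_mul_sum]
  rw [sum_rot]
  have e : ∀ A E, ∑ B, R (P I A) (Z B E) * R (Q A B) (Z E J) =
      ∑ B, R (P I A) (Z A B) * R (Q B E) (Z E J) := by
    intro A E
    exact h.apply (f := fun a b => R (P I A) b * R a (Z E J))
          (.of (by simp [mul_add]) (by simp [mul_left_comm]) (by simp [add_mul])
            (by simp [mul_assoc])) A E
  simp only [e]
  rw [sum_rot, sum_rot, sum_swap₂]

include hR in
theorem bmR_mul_right (hP : IsComat k P) (hQZ : MComm k Q Z) (hPZ : MComm k P Z) :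
    bm R P (Q * Z) = bm R P Z * bm R P Q := by
  ext I J
  simp only [Matrix.mul_apply, bm_apply, map_sum, hR.mul_right hP, Finset.sum_mul_sum]
  calc ∑ E, ∑ F, ∑ A, R (P I A) (Z F J) * R (P A E) (Q E F)
      = ∑ A, ∑ E, ∑ F, R (P I A) (Z F J) * R (P A E) (Q E F) := (sum_rot _).symm
    _ = ∑ A, ∑ E, ∑ F, R (P I A) (Z E F) * R (P A E) (Q F J) :=
        Finset.sum_congr rfl fun A _ => Finset.sum_congr rfl fun E _ =>
          hQZ.apply (f := fun a b => R (P I A) b * R (P A E) a)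
          (.of (by simp [mul_add]) (by simp [mul_left_comm]) (by simp [add_mul])
            (by simp [mul_assoc])) E J
    _ = ∑ A, ∑ F, ∑ E, R (P I A) (Z E F) * R (P A E) (Q F J) := sum_swap₂ _
    _ = ∑ A, ∑ F, ∑ E, R (P I A) (Z A E) * R (P E F) (Q F J) :=
        Finset.sum_congr rfl fun A _ => Finset.sum_congr rfl fun F _ =>
          hPZ.apply (f := fun a b => R (P I A) b * R a (Q F J))
          (.of (by simp [mul_add]) (by simp [mul_left_comm]) (by simp [add_mul])
            (by simp [mul_assoc])) A F
    _ = ∑ E, ∑ A, ∑ F, R (P I A) (Z A E) * R (P E F) (Q F J) := by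
        rw [sum_rot, sum_rot]

include hR in
theorem bm_rtt (hP : IsComat k P) (hQ : IsComat k Q) (h : MComm k P Q) :
    sc H (bm R P Q) * P * Q = Q * P * sc H (bm R P Q) := by
  ext I J
  have e1 : (sc H (bm R P Q) * P * Q) I J =
      ∑ A, ∑ E, ∑ F, R (P I E) (Q A F) • (P E A * Q F J) := by
    rw [mul_assoc, sc_mul_apply]
    simp only [Matrix.mul_apply, bm_apply, Finset.sum_smul, Finset.smul_sum]
    calc ∑ E, ∑ F, ∑ A, R (P I A) (Q A E) • (P E F * Q F J)
      _ = ∑ A, ∑ F, ∑ E, R (P I A) (Q A E) • (P E F * Q F J) := by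
        rw [← sum_rot, sum_swap₂]
      _ = ∑ A, ∑ F, ∑ E, R (P I A) (Q E F) • (P A E * Q F J) :=
        Finset.sum_congr rfl fun A _ => Finset.sum_congr rfl fun F _ =>
          (h.apply (f := fun a b => R (P I A) b • (a * Q F J))
          (.of (by simp [add_mul]) (by simp [smul_smul, mul_comm]) (by simp [add_smul])
            (by simp [smul_smul])) A F).symm
      _ = _ := by rw [← sum_rot]
  have e2 : (Q * P * sc H (bm R P Q)) I J =
      ∑ A, ∑ E, ∑ F, R (P E A) (Q F J) • (Q A F * P I E) := by
    rw [mul_sc_apply]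
    simp only [Matrix.mul_apply, bm_apply, Finset.sum_smul, Finset.smul_sum]
    calc ∑ E, ∑ F, ∑ A, R (P E A) (Q A J) • (Q I F * P F E)
      _ = ∑ E, ∑ A, ∑ F, R (P E A) (Q A J) • (Q I F * P F E) := sum_swap₂ _
      _ = ∑ E, ∑ A, ∑ F, R (P E A) (Q A J) • (Q F E * P I F) :=
        Finset.sum_congr rfl fun E _ => Finset.sum_congr rfl fun A _ =>
          (h.apply (f := fun a b => R (P E A) (Q A J) • (b * a))
          (.of (by simp [mul_add]) (by simp [smul_smul, mul_comm]) (by simp [add_mul])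
            (by simp [smul_smul, mul_comm])) I E).symm
      _ = ∑ A, ∑ F, ∑ E, R (P E A) (Q A J) • (Q F E * P I F) := sum_rot _
      _ = ∑ A, ∑ F, ∑ E, R (P F E) (Q A J) • (Q E A * P I F) :=
        Finset.sum_congr rfl fun A _ => Finset.sum_congr rfl fun F _ =>
          (h.apply (f := fun a b => R a (Q A J) • (b * P I F))
          (.of (by simp [add_smul]) (by simp [smul_smul]) (by simp [add_mul])
            (by simp [smul_smul, mul_comm])) F A).symm
      _ = _ := by rw [sum_rot, sum_rot, sum_swap₂]
  have e3 : ∑ A, ∑ E, ∑ F, R (P E A) (Q F J) • (Q A F * P I E) =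
      ∑ A, ∑ E, ∑ F, R (P I E) (Q A F) • (P E A * Q F J) := by
    refine Finset.sum_congr rfl fun A _ => ?_
    rw [← hR.rtt hP hQ I A A J, Finset.sum_comm]
  rw [e1, e2, e3]

theorem mcomm_bm {A : Type*} [Ring A] [Algebra k A] {Z : Matrix N N A}
    (F : H →ₗ[k] H →ₗ[k] k) (hP : MComm k P Z) (hQ : MComm k Q Z) :
    sc A (bm F P Q) * Z = Z * sc A (bm F P Q) := by
  ext I J
  rw [sc_mul_apply, mul_sc_apply]
  simp only [bm_apply, Finset.sum_smul]
  rw [Finset.sum_comm]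
  have e : ∀ E, ∑ B, F (P I E) (Q E B) • Z B J = ∑ B, F (P I E) (Q B J) • Z E B := fun E =>
    hQ.apply (f := fun a b => F (P I E) a • b) (.of (by simp [add_smul])
      (by simp [smul_smul]) (by simp) (by simp [smul_smul, mul_comm])) E J
  have e2 : ∀ B, ∑ E, F (P I E) (Q B J) • Z E B = ∑ E, F (P E B) (Q B J) • Z I E := fun B =>
    hP.apply (f := fun a b => F a (Q B J) • b) (.of (by simp [add_smul])
      (by simp [smul_smul]) (by simp) (by simp [smul_smul, mul_comm])) I B
  simp only [e]
  rw [Finset.sum_comm]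
  simp only [e2]
  rw [Finset.sum_comm]

end MatrixIdentities

section Antipode

variable {k : Type*} [Field k] {H : Type*} [Ring H] [HopfAlgebra k H]
  {N : Type} [Fintype N] [DecidableEq N] {P Q Z : Matrix N N H}

/-- Entrywise antipode. -/
noncomputable def apm (k : Type*) [Field k] {H : Type*} [Ring H] [HopfAlgebra k H] {N : Type}
    (P : Matrix N N H) : Matrix N N H :=
  P.map (HopfAlgebra.antipode k)

theorem apm_apply (P : Matrix N N H) (I J : N) :
    apm k P I J = HopfAlgebra.antipode k (P I J) := rfl

theorem apm_mul_self (hP : IsComat k P) : apm k P * P = 1 := by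
  ext I J
  have := HopfAlgebra.mul_antipode_rTensor_comul_apply (R := k) (P I J)
  rw [hP.comul, hP.counit] at this
  simpa [Matrix.mul_apply, Matrix.one_apply, apm_apply, apply_ite (algebraMap k H)] using this

theorem self_mul_apm (hP : IsComat k P) : P * apm k P = 1 := by
  ext I J
  have := HopfAlgebra.mul_antipode_lTensor_comul_apply (R := k) (P I J)
  rw [hP.comul, hP.counit] at this
  simpa [Matrix.mul_apply, Matrix.one_apply, apm_apply, apply_ite (algebraMap k H)] using this

theorem apm_mul (h : MComm k P Q) : apm k (P * Q) = apm k Q * apm k P := by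
  ext I J
  simp only [apm_apply, Matrix.mul_apply, map_sum, HopfAlgebra.antipode_mul_antidistrib]
  exact h.apply (f := fun a b => HopfAlgebra.antipode k b * HopfAlgebra.antipode k a)
    (.of (by simp [mul_add]) (by simp) (by simp [add_mul]) (by simp)) I J

/-- The inclusion of the first tensor factor, entrywise. -/
noncomputable def inl (k : Type*) [Field k] {H : Type*} [Ring H] [HopfAlgebra k H] {N : Type}
    (P : Matrix N N H) : Matrix N N (H ⊗[k] H) :=
  P.map fun a => a ⊗ₜ[k] 1

/-- The inclusion of the second tensor factor, entrywise. -/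
noncomputable def inr (k : Type*) [Field k] {H : Type*} [Ring H] [HopfAlgebra k H] {N : Type}
    (P : Matrix N N H) : Matrix N N (H ⊗[k] H) :=
  P.map fun a => 1 ⊗ₜ[k] a

theorem inl_apply (P : Matrix N N H) (I J : N) : inl k P I J = P I J ⊗ₜ[k] 1 := rfl

theorem inr_apply (P : Matrix N N H) (I J : N) : inr k P I J = 1 ⊗ₜ[k] P I J := rfl

theorem inl_mul (P Q : Matrix N N H) : inl k (P * Q) = inl k P * inl k Q := by
  ext I J; simp [inl_apply, Matrix.mul_apply, sum_tmul]

theorem inr_mul (P Q : Matrix N N H) : inr k (P * Q) = inr k P * inr k Q := by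
  ext I J; simp [inr_apply, Matrix.mul_apply, tmul_sum]

theorem inl_one : inl k (1 : Matrix N N H) = 1 := by
  ext I J
  rw [inl_apply, Matrix.one_apply, Matrix.one_apply]
  split_ifs <;> simp [Algebra.TensorProduct.one_def]

theorem inr_one : inr k (1 : Matrix N N H) = 1 := by
  ext I J
  rw [inr_apply, Matrix.one_apply, Matrix.one_apply]
  split_ifs <;> simp [Algebra.TensorProduct.one_def]

theorem inl_sc (r : Matrix N N k) : inl k (sc H r) = sc (H ⊗[k] H) r := by
  ext I J; simp [inl_apply]

theorem inr_sc (r : Matrix N N k) : inr k (sc H r) = sc (H ⊗[k] H) r := by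
  ext I J
  simp [inr_apply, Algebra.algebraMap_eq_smul_one, Algebra.TensorProduct.one_def]

theorem inl_mul_inr (hP : MComm k P Q) : inl k P * inr k Q = inr k Q * inl k P := by
  ext I J
  simp only [Matrix.mul_apply, inl_apply, inr_apply, Algebra.TensorProduct.tmul_mul_tmul, mul_one,
    one_mul]
  exact hP I J

theorem IsComat.comul_apm (hP : IsComat k P) (I J : N) :
    Coalgebra.comul (R := k) (apm k P I J) = ∑ A, apm k P A J ⊗ₜ[k] apm k P I A := by
  have h1 : (apm k P).map (Bialgebra.comulAlgHom k H) * P.map (Bialgebra.comulAlgHom k H) = 1 := by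
    have := congrArg (fun X : Matrix N N H => X.map (Bialgebra.comulAlgHom k H)) (apm_mul_self hP)
    simpa [Matrix.map_mul] using this
  have h2 : P.map (Bialgebra.comulAlgHom k H) = inl k P * inr k P := by
    ext I J
    simp [Matrix.mul_apply, inl_apply, inr_apply, hP.comul]
  have h3 : P.map (Bialgebra.comulAlgHom k H) * (inr k (apm k P) * inl k (apm k P)) = 1 := by
    rw [h2, mul_assoc, ← mul_assoc (inr k P), ← inr_mul, self_mul_apm hP, inr_one, one_mul,
      ← inl_mul, self_mul_apm hP, inl_one]
  have h4 := congrArg (fun X : Matrix N N (H ⊗[k] H) => X I J) (left_inv_eq_right_inv h1 h3)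
  simpa [Matrix.mul_apply, inl_apply, inr_apply] using h4

end Antipode

theorem sum_rot₄ {M ι κ μ ν : Type*} [AddCommMonoid M] [Fintype ι] [Fintype κ] [Fintype μ]
    [Fintype ν] (f : ι → κ → μ → ν → M) :
    ∑ a, ∑ b, ∑ c, ∑ d, f a b c d = ∑ b, ∑ c, ∑ d, ∑ a, f a b c d := by
  rw [Finset.sum_comm]
  exact Finset.sum_congr rfl fun b _ => sum_rot _

section Braid

variable {k : Type*} [Field k] {H : Type*} [Ring H] [HopfAlgebra k H]
  {N : Type} [Fintype N] [DecidableEq N] {P Q Z : Matrix N N H}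
  {R : H →ₗ[k] H →ₗ[k] k} (hR : CQ R)

include hR

/-- The Yang–Baxter equation. -/
theorem bm_ybe (hP : IsComat k P) (hQ : IsComat k Q) (hZ : IsComat k Z) (hPQ : MComm k P Q)
    (hPZ : MComm k P Z) (hQZ : MComm k Q Z) :
    bm R P Q * bm R P Z * bm R Q Z = bm R Q Z * bm R P Z * bm R P Q := by
  have h := congrArg (fun X => bm R X Z) (bm_rtt hR hP hQ hPQ)
  rw [mul_assoc, bm_sc_left, bm_sc_mid, mcomm_bm R hPZ hQZ, bm_sc_right, sc_self,
    bmR_mul_left hR hZ hQZ, bmR_mul_left hR hZ hPZ] at h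
  rw [mul_assoc, h]

theorem bm_act_eq (hP : IsComat k P) (hZ : IsComat k Z) (h : MComm k P Z) :
    bm (actL R) P Z = sc H (bm R Z P) * P * sc H (bm R P Z) := by
  ext I J
  rw [mul_sc_apply]
  simp only [sc_mul_apply, bm_apply, actL_comat R hP hZ, Finset.sum_smul, Finset.smul_sum]
  calc _ = ∑ a, ∑ b, ∑ e, ∑ E, (R (Z E e) (P I a) * R (P b E) (Z e J)) • P a b := sum_rot₄ _
    _ = ∑ a, ∑ b, ∑ e, ∑ E, (R (Z b E) (P I a) * R (P E e) (Z e J)) • P a b :=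
      Finset.sum_congr rfl fun a _ => Finset.sum_congr rfl fun b _ => Finset.sum_congr rfl
        fun e _ => h.apply (f := fun u v => (R v (P I a) * R u (Z e J)) • P a b)
          (.of (by simp [mul_add, add_smul]) (by simp [smul_smul, mul_left_comm])
            (by simp [add_mul, add_smul]) (by simp [smul_smul, mul_assoc])) b e
    _ = ∑ a, ∑ e, ∑ E, ∑ b, (R (Z b E) (P I a) * R (P E e) (Z e J)) • P a b :=
      Finset.sum_congr rfl fun a _ => sum_rot _
    _ = ∑ a, ∑ e, ∑ E, ∑ b, (R (Z a b) (P I a) * R (P E e) (Z e J)) • P b E :=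
      Finset.sum_congr rfl fun a _ => Finset.sum_congr rfl fun e _ => Finset.sum_congr rfl
        fun E _ => h.apply (f := fun u v => (R v (P I a) * R (P E e) (Z e J)) • u)
          (.of (by simp) (by simp [smul_smul, mul_comm])
            (by simp [add_mul, add_smul]) (by simp [smul_smul, mul_assoc])) a E
    _ = ∑ e, ∑ E, ∑ b, ∑ a, (R (Z a b) (P I a) * R (P E e) (Z e J)) • P b E := sum_rot₄ _
    _ = ∑ e, ∑ E, ∑ b, ∑ a, (R (Z I a) (P a b) * R (P E e) (Z e J)) • P b E :=
      Finset.sum_congr rfl fun e _ => Finset.sum_congr rfl fun E _ => Finset.sum_congr rfl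
        fun b _ => h.apply (f := fun u v => (R v u * R (P E e) (Z e J)) • P b E)
          (.of (by simp [add_mul, add_smul]) (by simp [smul_smul, mul_assoc])
            (by simp [add_mul, add_smul]) (by simp [smul_smul, mul_assoc])) I b
    _ = _ := by
      rw [Finset.sum_comm]
      refine Finset.sum_congr rfl fun E _ => ?_
      rw [sum_rot]
      simp only [smul_smul, mul_comm]

theorem bm_bul_eq (hP : IsComat k P) (hQ : IsComat k Q) (h : MComm k P Q) :
    bm (bulL R) (P * sc H (bm R P Q)) Q = sc H (bm R P Q) * P * Q := by
  ext I J
  rw [mul_assoc, sc_mul_apply]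
  let v : N → N → H := fun b e => ∑ a, ∑ f, R (P I a) (Q e f) • (P a b * Q f J)
  have e1 : ∀ E F, bulL R (P I E) (Q F J) =
      ∑ b, ∑ e, R (P b E) (HopfAlgebra.antipode k (Q F e)) • v b e := by
    intro E F
    rw [bulL_comat R hP hQ, Finset.sum_comm]
    simp only [v, Finset.smul_sum, smul_smul]
    exact Finset.sum_congr rfl fun b _ => Finset.sum_comm
  have e2 : ∀ b e, ∑ F, ∑ E, (∑ G, R (P E G) (Q G F)) *
      R (P b E) (HopfAlgebra.antipode k (Q F e)) = if b = e then 1 else 0 := by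
    intro b e
    have e3 : ∀ F G, ∑ E, R (P E G) (Q G F) * R (P b E) (HopfAlgebra.antipode k (Q F e)) =
        R (P b G) (Q G F * HopfAlgebra.antipode k (Q F e)) := by
      intro F G
      rw [hR.mul_right hP]
      simp only [mul_comm]
    have e4 : ∀ G, ∑ F, Q G F * HopfAlgebra.antipode k (Q F e) = (1 : Matrix N N H) G e := by
      intro G
      rw [← self_mul_apm hQ, Matrix.mul_apply]
      rfl
    simp only [Finset.sum_mul]
    rw [← sum_rot]
    simp only [e3, ← map_sum]
    simp only [e4]
    rw [Finset.sum_eq_single e (fun B _ hB => by rw [Matrix.one_apply_ne hB, map_zero]) (by simp),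
      Matrix.one_apply_eq, hR.one_right, hP.counit]
  calc _ = ∑ F, ∑ E, (∑ G, R (P E G) (Q G F)) • ∑ b, ∑ e,
        R (P b E) (HopfAlgebra.antipode k (Q F e)) • v b e := by
        simp only [← e1]
        rw [bm_apply]
        simp only [mul_sc_apply, map_sum, LinearMap.sum_apply, map_smul, LinearMap.smul_apply,
          bm_apply]
    _ = ∑ b, ∑ e, (∑ F, ∑ E, (∑ G, R (P E G) (Q G F)) *
        R (P b E) (HopfAlgebra.antipode k (Q F e))) • v b e := by
        simp only [Finset.smul_sum (r := ∑ G, _), smul_smul]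
        rw [sum_rot₄, sum_rot₄]
        simp only [Finset.sum_smul]
    _ = ∑ b, v b b := by simp [e2]
    _ = _ := by
      simp only [v, Matrix.mul_apply, bm_apply, Finset.sum_smul, Finset.smul_sum]
      rw [sum_rot]
      have e : ∀ a f, ∑ b, R (P I a) (Q b f) • (P a b * Q f J) =
          ∑ b, R (P I a) (Q a b) • (P b f * Q f J) := fun a f =>
        h.apply (f := fun u v => R (P I a) v • (u * Q f J))
          (.of (by simp [add_mul]) (by simp [smul_smul, mul_comm])
            (by simp [add_smul]) (by simp [smul_smul])) a f
      simp only [e]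
      rw [sum_rot, Finset.sum_comm]

omit hR in
theorem map_adL (hP : IsComat k P) :
    P.map (adL k) = inr k (apm k P) * inl k P * inr k P := by
  ext I J
  simp only [Matrix.map_apply, adL_comat hP, Matrix.mul_apply, inl_apply, inr_apply, apm_apply,
    Algebra.TensorProduct.tmul_mul_tmul, one_mul, mul_one, Finset.sum_mul]
  exact Finset.sum_comm

end Braid

/-! ## Extensionality on commuting comatrices -/

section Rows

variable {k : Type*} [Field k] {A M : Type*} [Zero A] [AddCommMonoid M]
  {n m : Type} [Fintype n] [DecidableEq n] [Fintype m] [DecidableEq m]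

theorem kron₁_row (x : Matrix n n A) (I : n × m) (g : A → n × m → M) (hg : ∀ E, g 0 E = 0) :
    ∑ E, g (kron₁ m x I E) E = ∑ a, g (x I.1 a) (a, I.2) := by
  rw [Fintype.sum_prod_type]
  refine Finset.sum_congr rfl fun a _ => ?_
  rw [Finset.sum_eq_single I.2 (fun b _ hb => by simp [kron₁, Ne.symm hb, hg]) (by simp)]
  simp [kron₁]

theorem kron₁_col (x : Matrix n n A) (J : n × m) (g : A → n × m → M) (hg : ∀ E, g 0 E = 0) :
    ∑ E, g (kron₁ m x E J) E = ∑ a, g (x a J.1) (a, J.2) := by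
  rw [Fintype.sum_prod_type]
  refine Finset.sum_congr rfl fun a _ => ?_
  rw [Finset.sum_eq_single J.2 (fun b _ hb => by simp [kron₁, hb, hg]) (by simp)]
  simp [kron₁]

theorem kron₂_col (y : Matrix m m A) (J : n × m) (g : A → n × m → M) (hg : ∀ E, g 0 E = 0) :
    ∑ E, g (kron₂ n y E J) E = ∑ e, g (y e J.2) (J.1, e) := by
  rw [Fintype.sum_prod_type_right]
  refine Finset.sum_congr rfl fun a _ => ?_
  rw [Finset.sum_eq_single J.1 (fun b _ hb => by simp [kron₂, hb, hg]) (by simp)]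
  simp [kron₂]

end Rows

section Ext

variable {k : Type*} [Field k] {H : Type*} [Ring H] [HopfAlgebra k H]
  {M : Type*} [AddCommGroup M] [Module k M]

theorem comat_ext₂ {F G : H →ₗ[k] H →ₗ[k] M}
    (h : ∀ (n m : ℕ) (x : Matrix (Fin n) (Fin n) H) (y : Matrix (Fin m) (Fin m) H),
      IsComat k x → IsComat k y → ∀ i j c d, F (x i j) (y c d) = G (x i j) (y c d)) : F = G :=
  comat_ext fun n x hx i j => comat_ext fun m y hy c d => h n m x y hx hy i j c d

theorem comat_ext₃ {F G : H →ₗ[k] H →ₗ[k] H →ₗ[k] M}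
    (h : ∀ (n m p : ℕ) (x : Matrix (Fin n) (Fin n) H) (y : Matrix (Fin m) (Fin m) H)
      (z : Matrix (Fin p) (Fin p) H), IsComat k x → IsComat k y → IsComat k z →
      ∀ i j c d s t, F (x i j) (y c d) (z s t) = G (x i j) (y c d) (z s t)) : F = G :=
  comat_ext₂ fun n m x y hx hy i j c d =>
    comat_ext fun p z hz s t => h n m p x y z hx hy hz i j c d s t

theorem mcomm_ext₂ {F G : H →ₗ[k] H →ₗ[k] M}
    (h : ∀ (N : Type) [Fintype N] [DecidableEq N] (P Q : Matrix N N H), IsComat k P →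
      IsComat k Q → MComm k P Q →
      ∀ I J, ∑ A, F (P I A) (Q A J) = ∑ A, G (P I A) (Q A J)) : F = G := by
  refine comat_ext₂ fun n m x y hx hy i j c d => ?_
  have := h _ _ _ (isComat_kron₁ (m := Fin m) hx) (isComat_kron₂ (n := Fin n) hy)
    (mcomm_kron₁_kron₂ x y) (i, c) (j, d)
  rwa [sum_kron₁_kron₂, sum_kron₁_kron₂] at this

variable {R : H →ₗ[k] H →ₗ[k] k} (hR : CQ R)

include hR in
theorem CQ.cancel {n m : Type} [Fintype n] [DecidableEq n] [Fintype m] [DecidableEq m]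
    {x : Matrix n n H} {y : Matrix m m H} (hx : IsComat k x) (hy : IsComat k y)
    {f g : n → m → M}
    (h : ∀ j c, ∑ a, ∑ e, R (x a j) (y c e) • f a e = ∑ a, ∑ e, R (x a j) (y c e) • g a e) :
    f = g := by
  have key : ∀ (f : n → m → M) (l : n) (r : m), ∑ j, ∑ c,
      R (x j l) (HopfAlgebra.antipode k (y r c)) • ∑ a, ∑ e, R (x a j) (y c e) • f a e =
      f l r := by
    intro f l r
    have e3 : ∀ a e c, ∑ j, R (x j l) (HopfAlgebra.antipode k (y r c)) * R (x a j) (y c e) =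
        R (x a l) (HopfAlgebra.antipode k (y r c) * y c e) := by
      intro a e c
      rw [hR.mul_right hx]
      simp only [mul_comm]
    have e4 : ∀ e, ∑ c, HopfAlgebra.antipode k (y r c) * y c e = (1 : Matrix m m H) r e := by
      intro e
      rw [← apm_mul_self hy, Matrix.mul_apply]
      rfl
    simp only [Finset.smul_sum, smul_smul]
    rw [sum_rot₄, sum_rot₄, sum_rot₄]
    rw [sum_rot₄]
    rw [sum_rot₄, sum_rot₄]
    have e5 : ∀ a e, ∑ j, ∑ c, (R (x j l) (HopfAlgebra.antipode k (y r c)) * R (x a j) (y c e)) •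
        f a e = (if a = l then if r = e then (1 : k) else 0 else 0) • f a e := by
      intro a e
      rw [Finset.sum_comm]
      simp only [← Finset.sum_smul, e3, ← map_sum, e4]
      by_cases hre : r = e
      · subst hre
        rw [Matrix.one_apply_eq, hR.one_right, hx.counit]; simp
      · rw [Matrix.one_apply_ne hre, map_zero]; simp [hre]
    simp only [e5]
    simp
  funext l r
  rw [← key f l r, ← key g l r]
  simp only [h]

include hR in
theorem mcomm_ext₂_twist {F G : H →ₗ[k] H →ₗ[k] M}
    (h : ∀ (N : Type) [Fintype N] [DecidableEq N] (P Q : Matrix N N H), IsComat k P →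
      IsComat k Q → MComm k P Q →
      ∀ I J, ∑ A, ∑ B, bm R P Q A B • F (P I A) (Q B J) =
        ∑ A, ∑ B, bm R P Q A B • G (P I A) (Q B J)) : F = G := by
  refine comat_ext₂ fun n m x y hx hy i j c d => ?_
  have key : ∀ (F : H →ₗ[k] H →ₗ[k] M) (j : Fin n) (c : Fin m),
      ∑ A, ∑ B, bm R (kron₁ (Fin m) x) (kron₂ (Fin n) y) A B •
        F (kron₁ (Fin m) x (i, c) A) (kron₂ (Fin n) y B (j, d)) =
      ∑ a, ∑ e, R (x a j) (y c e) • F (x i a) (y e d) := by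
    intro F j c
    rw [kron₁_row x (i, c) (fun u A => ∑ B, bm R (kron₁ (Fin m) x) (kron₂ (Fin n) y) A B •
        F u (kron₂ (Fin n) y B (j, d))) (by simp)]
    refine Finset.sum_congr rfl fun a _ => ?_
    rw [kron₂_col y (j, d) (fun u B => bm R (kron₁ (Fin m) x) (kron₂ (Fin n) y) (a, c) B •
        F (x i a) u) (by simp)]
    refine Finset.sum_congr rfl fun e _ => ?_
    rw [bm_apply, sum_kron₁_kron₂]
  have := hR.cancel hx hy (f := fun a e => F (x i a) (y e d))
    (g := fun a e => G (x i a) (y e d)) fun j c => by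
      rw [← key, ← key]
      exact h _ _ _ (isComat_kron₁ hx) (isComat_kron₂ hy) (mcomm_kron₁_kron₂ x y) _ _
  exact congrFun (congrFun this j) c

end Ext

theorem sum_perm₆ {M ι₁ ι₂ ι₃ ι₄ ι₅ ι₆ : Type*} [AddCommMonoid M] [Fintype ι₁] [Fintype ι₂]
    [Fintype ι₃] [Fintype ι₄] [Fintype ι₅] [Fintype ι₆] (T : ι₁ → ι₂ → ι₃ → ι₄ → ι₅ → ι₆ → M) :
    ∑ e, ∑ f, ∑ r, ∑ b, ∑ a, ∑ g, T e f r b a g = ∑ g, ∑ r, ∑ a, ∑ b, ∑ f, ∑ e, T e f r b a g := by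
  simp only [← Fintype.sum_prod_type']
  exact Fintype.sum_equiv
    ⟨fun x => ⟨x.2.2.2.2.2, x.2.2.1, x.2.2.2.2.1, x.2.2.2.1, x.2.1, x.1⟩,
      fun x => ⟨x.2.2.2.2.2, x.2.2.2.2.1, x.2.1, x.2.2.2.1, x.2.2.1, x.1⟩,
      fun _ => rfl, fun _ => rfl⟩ _ _ fun _ => rfl

section Triple

variable {k : Type*} [Field k] {H : Type*} [Ring H] [HopfAlgebra k H]
  {n m p : Type} [Fintype n] [DecidableEq n] [Fintype m] [DecidableEq m]
  [Fintype p] [DecidableEq p]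

theorem bm_kron₁₂ (R : H →ₗ[k] H →ₗ[k] k) (x : Matrix n n H) (y : Matrix m m H) (i j : n)
    (c d : m) (s t : p) : bm R (kron₁ p (kron₁ m x)) (kron₁ p (kron₂ n y)) ((i, c), s) ((j, d), t) =
      if s = t then R (x i j) (y c d) else 0 := by
  rw [bm_apply, sum_kron₁_kron₁ R]
  simp only [kron₁]
  congr 1
  exact sum_kron₁_kron₂ R x y (i, c) (j, d)

theorem bm_kron₁₃ (R : H →ₗ[k] H →ₗ[k] k) (x : Matrix n n H) (z : Matrix p p H) (i j : n)
    (c d : m) (s t : p) : bm R (kron₁ p (kron₁ m x)) (kron₂ (n × m) z) ((i, c), s) ((j, d), t) =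
      if c = d then R (x i j) (z s t) else 0 := by
  rw [bm_apply, sum_kron₁_kron₂ R]
  by_cases h : c = d <;> simp [kron₁, h]

theorem bm_kron₂₃ (R : H →ₗ[k] H →ₗ[k] k) (y : Matrix m m H) (z : Matrix p p H) (i j : n)
    (c d : m) (s t : p) : bm R (kron₁ p (kron₂ n y)) (kron₂ (n × m) z) ((i, c), s) ((j, d), t) =
      if i = j then R (y c d) (z s t) else 0 := by
  rw [bm_apply, sum_kron₁_kron₂ R]
  by_cases h : i = j <;> simp [kron₂, h]

theorem bm_kron₁₂_mul_kron₁₃ (R : H →ₗ[k] H →ₗ[k] k) (x : Matrix n n H) (y : Matrix m m H)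
    (z : Matrix p p H) (i j : n) (c d : m) (s t : p) :
    (bm R (kron₁ p (kron₁ m x)) (kron₁ p (kron₂ n y)) *
      bm R (kron₁ p (kron₁ m x)) (kron₂ (n × m) z)) ((i, c), s) ((j, d), t) =
      ∑ g, R (x i g) (y c d) * R (x g j) (z s t) := by
  simp only [Matrix.mul_apply, Fintype.sum_prod_type, bm_kron₁₂, bm_kron₁₃, ite_mul, zero_mul,
    mul_ite, mul_zero]
  simp

variable {M : Type*} [AddCommGroup M] [Module k M] {F G : H →ₗ[k] H →ₗ[k] H →ₗ[k] M}

theorem mcomm_ext₃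
    (h : ∀ (N : Type) [Fintype N] [DecidableEq N] (P Q Z : Matrix N N H), IsComat k P →
      IsComat k Q → IsComat k Z → MComm k P Q → MComm k P Z → MComm k Q Z →
      ∀ I J, ∑ B, ∑ A, F (P I A) (Q A B) (Z B J) = ∑ B, ∑ A, G (P I A) (Q A B) (Z B J)) :
    F = G := by
  refine comat_ext₃ fun n m p x y z hx hy hz i j c d s t => ?_
  have key : ∀ F : H →ₗ[k] H →ₗ[k] H →ₗ[k] M, ∑ B, ∑ A,
      F (kron₁ (Fin p) (kron₁ (Fin m) x) ((i, c), s) A) (kron₁ (Fin p) (kron₂ (Fin n) y) A B)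
        (kron₂ (Fin n × Fin m) z B ((j, d), t)) = F (x i j) (y c d) (z s t) := by
    intro F
    rw [kron₂_col z ((j, d), t) (fun u B => ∑ A,
      F (kron₁ (Fin p) (kron₁ (Fin m) x) ((i, c), s) A) (kron₁ (Fin p) (kron₂ (Fin n) y) A B) u)
      (by simp)]
    have : ∀ e, ∑ A, F (kron₁ (Fin p) (kron₁ (Fin m) x) ((i, c), s) A)
        (kron₁ (Fin p) (kron₂ (Fin n) y) A ((j, d), e)) (z e t) =
        if s = e then F (x i j) (y c d) (z e t) else 0 := by
      intro e
      rw [kron₁_row (kron₁ (Fin m) x) ((i, c), s) (fun u A => F u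
        (kron₁ (Fin p) (kron₂ (Fin n) y) A ((j, d), e)) (z e t)) (by simp)]
      by_cases hse : s = e
      · simp only [kron₁, hse, if_true]
        exact (congrArg (fun f : H →ₗ[k] M => f (z e t))
          (show _ = F (x i j) (y c d) from sum_kron₁_kron₂ F x y (i, c) (j, d)) ▸ by
            simp [LinearMap.sum_apply, kron₁])
      · simp [kron₁, hse]
    simp only [this]
    simp
  have := h _ _ _ _ (isComat_kron₁ (m := Fin p) (isComat_kron₁ (m := Fin m) hx))
    (isComat_kron₁ (m := Fin p) (isComat_kron₂ (n := Fin n) hy))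
    (isComat_kron₂ (n := Fin n × Fin m) hz) (mcomm_kron₁ (mcomm_kron₁_kron₂ x y))
    (mcomm_kron₁_kron₂ _ z) (mcomm_kron₁_kron₂ _ z) ((i, c), s) ((j, d), t)
  rwa [key, key] at this

variable {R : H →ₗ[k] H →ₗ[k] k} (hR : CQ R)

include hR in
/-- The extensionality principle for `P R₁₂ Q Z`. -/
theorem mcomm_ext₃_twist
    (h : ∀ (N : Type) [Fintype N] [DecidableEq N] (P Q Z : Matrix N N H), IsComat k P →
      IsComat k Q → IsComat k Z → MComm k P Q → MComm k P Z → MComm k Q Z →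
      ∀ I J, ∑ C, ∑ B, ∑ A, bm R P Q A B • F (P I A) (Q B C) (Z C J) =
        ∑ C, ∑ B, ∑ A, bm R P Q A B • G (P I A) (Q B C) (Z C J)) : F = G := by
  refine comat_ext₃ fun n m p x y z hx hy hz i j c d s t => ?_
  have key : ∀ (F : H →ₗ[k] H →ₗ[k] H →ₗ[k] M) (j : Fin n) (c : Fin m), ∑ C, ∑ B, ∑ A,
      bm R (kron₁ (Fin p) (kron₁ (Fin m) x)) (kron₁ (Fin p) (kron₂ (Fin n) y)) A B •
      F (kron₁ (Fin p) (kron₁ (Fin m) x) ((i, c), s) A) (kron₁ (Fin p) (kron₂ (Fin n) y) B C)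
        (kron₂ (Fin n × Fin m) z C ((j, d), t)) =
      ∑ a, ∑ e, R (x a j) (y c e) • F (x i a) (y e d) (z s t) := by
    intro F j c
    rw [kron₂_col z ((j, d), t) (fun u C => ∑ B, ∑ A,
      bm R (kron₁ (Fin p) (kron₁ (Fin m) x)) (kron₁ (Fin p) (kron₂ (Fin n) y)) A B •
      F (kron₁ (Fin p) (kron₁ (Fin m) x) ((i, c), s) A) (kron₁ (Fin p) (kron₂ (Fin n) y) B C) u)
      (by simp)]
    have e1 : ∀ e, ∑ B, ∑ A,
      bm R (kron₁ (Fin p) (kron₁ (Fin m) x)) (kron₁ (Fin p) (kron₂ (Fin n) y)) A B •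
      F (kron₁ (Fin p) (kron₁ (Fin m) x) ((i, c), s) A)
        (kron₁ (Fin p) (kron₂ (Fin n) y) B ((j, d), e)) (z e t) =
        if s = e then ∑ b, ∑ a, R (x a j) (y c b) • F (x i a) (y b d) (z s t) else 0 := by
      intro e
      rw [kron₁_col (kron₂ (Fin n) y) ((j, d), e) (fun u B => ∑ A,
          bm R (kron₁ (Fin p) (kron₁ (Fin m) x)) (kron₁ (Fin p) (kron₂ (Fin n) y)) A B •
          F (kron₁ (Fin p) (kron₁ (Fin m) x) ((i, c), s) A) u (z e t)) (by simp),
        kron₂_col y (j, d) (fun u B => ∑ A,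
          bm R (kron₁ (Fin p) (kron₁ (Fin m) x)) (kron₁ (Fin p) (kron₂ (Fin n) y)) A (B, e) •
          F (kron₁ (Fin p) (kron₁ (Fin m) x) ((i, c), s) A) u (z e t)) (by simp)]
      have e2 : ∀ b, ∑ A,
        bm R (kron₁ (Fin p) (kron₁ (Fin m) x)) (kron₁ (Fin p) (kron₂ (Fin n) y)) A ((j, b), e) •
        F (kron₁ (Fin p) (kron₁ (Fin m) x) ((i, c), s) A) (y b d) (z e t) =
        if s = e then ∑ a, R (x a j) (y c b) • F (x i a) (y b d) (z s t) else 0 := by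
        intro b
        rw [kron₁_row (kron₁ (Fin m) x) ((i, c), s) (fun u A =>
            bm R (kron₁ (Fin p) (kron₁ (Fin m) x)) (kron₁ (Fin p) (kron₂ (Fin n) y)) A ((j, b), e) •
            F u (y b d) (z e t)) (by simp),
          kron₁_row x (i, c) (fun u A =>
            bm R (kron₁ (Fin p) (kron₁ (Fin m) x)) (kron₁ (Fin p) (kron₂ (Fin n) y))
            (A, s) ((j, b), e) • F u (y b d) (z e t)) (by simp)]
        simp only [bm_kron₁₂]
        by_cases hse : s = e <;> simp [hse]
      simp only [e2]
      by_cases hse : s = e <;> simp [hse]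
    simp only [e1]
    simp only [Finset.sum_ite_eq, Finset.mem_univ, if_true]
    exact Finset.sum_comm
  have := hR.cancel hx hy (f := fun a e => F (x i a) (y e d) (z s t))
    (g := fun a e => G (x i a) (y e d) (z s t)) fun j c => by
      rw [← key, ← key]
      exact h _ _ _ _ (isComat_kron₁ (isComat_kron₁ hx)) (isComat_kron₁ (isComat_kron₂ hy))
        (isComat_kron₂ hz) (mcomm_kron₁ (mcomm_kron₁_kron₂ x y))
        (mcomm_kron₁_kron₂ _ z) (mcomm_kron₁_kron₂ _ z) _ _
  exact congrFun (congrFun this j) c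

include hR in
/-- The extensionality principle for `P R₁₂ R₁₃ Q R₂₃ Z`. -/
theorem mcomm_ext₃_twist_all
    (h : ∀ (N : Type) [Fintype N] [DecidableEq N] (P Q Z : Matrix N N H), IsComat k P →
      IsComat k Q → IsComat k Z → MComm k P Q → MComm k P Z → MComm k Q Z →
      ∀ I J, ∑ E, ∑ C, ∑ B, ∑ A, bm R Q Z C E • (bm R P Q * bm R P Z) A B •
          F (P I A) (Q B C) (Z E J) =
        ∑ E, ∑ C, ∑ B, ∑ A, bm R Q Z C E • (bm R P Q * bm R P Z) A B •
          G (P I A) (Q B C) (Z E J)) : F = G := by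
  refine comat_ext₃ fun n m p x y z hx hy hz i j c d s t => ?_
  have key : ∀ (F : H →ₗ[k] H →ₗ[k] H →ₗ[k] M) (j : Fin n) (c d : Fin m) (s : Fin p),
      ∑ E, ∑ C, ∑ B, ∑ A,
      bm R (kron₁ (Fin p) (kron₂ (Fin n) y)) (kron₂ (Fin n × Fin m) z) C E •
      (bm R (kron₁ (Fin p) (kron₁ (Fin m) x)) (kron₁ (Fin p) (kron₂ (Fin n) y)) *
        bm R (kron₁ (Fin p) (kron₁ (Fin m) x)) (kron₂ (Fin n × Fin m) z)) A B •
      F (kron₁ (Fin p) (kron₁ (Fin m) x) ((i, c), s) A) (kron₁ (Fin p) (kron₂ (Fin n) y) B C)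
        (kron₂ (Fin n × Fin m) z E ((j, d), t)) =
      ∑ g, ∑ r, R (x g j) (z s r) • ∑ a, ∑ b, R (x a g) (y c b) • ∑ f, ∑ u,
        R (y f d) (z r u) • F (x i a) (y b f) (z u t) := by
    intro F j c d s
    rw [kron₂_col z ((j, d), t) (fun u E => ∑ C, ∑ B, ∑ A,
      bm R (kron₁ (Fin p) (kron₂ (Fin n) y)) (kron₂ (Fin n × Fin m) z) C E •
      (bm R (kron₁ (Fin p) (kron₁ (Fin m) x)) (kron₁ (Fin p) (kron₂ (Fin n) y)) *
        bm R (kron₁ (Fin p) (kron₁ (Fin m) x)) (kron₂ (Fin n × Fin m) z)) A B •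
      F (kron₁ (Fin p) (kron₁ (Fin m) x) ((i, c), s) A) (kron₁ (Fin p) (kron₂ (Fin n) y) B C) u)
      (by simp)]
    have e1 : ∀ e C, ∑ B, ∑ A,
      bm R (kron₁ (Fin p) (kron₂ (Fin n) y)) (kron₂ (Fin n × Fin m) z) C ((j, d), e) •
      (bm R (kron₁ (Fin p) (kron₁ (Fin m) x)) (kron₁ (Fin p) (kron₂ (Fin n) y)) *
        bm R (kron₁ (Fin p) (kron₁ (Fin m) x)) (kron₂ (Fin n × Fin m) z)) A B •
      F (kron₁ (Fin p) (kron₁ (Fin m) x) ((i, c), s) A) (kron₁ (Fin p) (kron₂ (Fin n) y) B C)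
        (z e t) =
        ∑ b, ∑ a, (if C.1.1 = j then R (y C.1.2 d) (z C.2 e) else 0) •
          (∑ g, R (x a g) (y c b) * R (x g C.1.1) (z s C.2)) •
          F (x i a) (y b C.1.2) (z e t) := by
      rintro e ⟨⟨c1, f⟩, r⟩
      rw [kron₁_col (kron₂ (Fin n) y) ((c1, f), r) (fun u B => ∑ A,
          bm R (kron₁ (Fin p) (kron₂ (Fin n) y)) (kron₂ (Fin n × Fin m) z) ((c1, f), r) ((j, d), e) •
          (bm R (kron₁ (Fin p) (kron₁ (Fin m) x)) (kron₁ (Fin p) (kron₂ (Fin n) y)) *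
            bm R (kron₁ (Fin p) (kron₁ (Fin m) x)) (kron₂ (Fin n × Fin m) z)) A B •
          F (kron₁ (Fin p) (kron₁ (Fin m) x) ((i, c), s) A) u (z e t)) (by simp),
        kron₂_col y (c1, f) (fun u B => ∑ A,
          bm R (kron₁ (Fin p) (kron₂ (Fin n) y)) (kron₂ (Fin n × Fin m) z) ((c1, f), r) ((j, d), e) •
          (bm R (kron₁ (Fin p) (kron₁ (Fin m) x)) (kron₁ (Fin p) (kron₂ (Fin n) y)) *
            bm R (kron₁ (Fin p) (kron₁ (Fin m) x)) (kron₂ (Fin n × Fin m) z)) A (B, r) •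
          F (kron₁ (Fin p) (kron₁ (Fin m) x) ((i, c), s) A) u (z e t)) (by simp)]
      refine Finset.sum_congr rfl fun b _ => ?_
      rw [kron₁_row (kron₁ (Fin m) x) ((i, c), s) (fun u A =>
          bm R (kron₁ (Fin p) (kron₂ (Fin n) y)) (kron₂ (Fin n × Fin m) z) ((c1, f), r) ((j, d), e) •
          (bm R (kron₁ (Fin p) (kron₁ (Fin m) x)) (kron₁ (Fin p) (kron₂ (Fin n) y)) *
            bm R (kron₁ (Fin p) (kron₁ (Fin m) x)) (kron₂ (Fin n × Fin m) z)) A ((c1, b), r) •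
          F u (y b f) (z e t)) (by simp),
        kron₁_row x (i, c) (fun u A =>
          bm R (kron₁ (Fin p) (kron₂ (Fin n) y)) (kron₂ (Fin n × Fin m) z) ((c1, f), r) ((j, d), e) •
          (bm R (kron₁ (Fin p) (kron₁ (Fin m) x)) (kron₁ (Fin p) (kron₂ (Fin n) y)) *
            bm R (kron₁ (Fin p) (kron₁ (Fin m) x)) (kron₂ (Fin n × Fin m) z))
            (A, s) ((c1, b), r) •
          F u (y b f) (z e t)) (by simp)]
      simp only [bm_kron₁₂_mul_kron₁₃, bm_kron₂₃]
    simp only [e1]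
    have e2 : ∀ e, ∑ C : (Fin n × Fin m) × Fin p,
        ∑ b, ∑ a, (if C.1.1 = j then R (y C.1.2 d) (z C.2 e) else 0) •
          (∑ g, R (x a g) (y c b) * R (x g C.1.1) (z s C.2)) •
          F (x i a) (y b C.1.2) (z e t) =
        ∑ f, ∑ r, ∑ b, ∑ a, ∑ g, R (x g j) (z s r) • R (x a g) (y c b) •
          R (y f d) (z r e) • F (x i a) (y b f) (z e t) := by
      intro e
      simp only [Fintype.sum_prod_type]
      rw [Finset.sum_eq_single j (fun b _ hb => by simp [hb]) (by simp)]
      simp only [if_true, Finset.sum_smul, Finset.smul_sum, smul_smul]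
      refine Finset.sum_congr rfl fun f _ => Finset.sum_congr rfl fun r _ =>
        Finset.sum_congr rfl fun b _ => Finset.sum_congr rfl fun a _ =>
        Finset.sum_congr rfl fun g _ => ?_
      congr 1
      ring
    simp only [e2]
    simp only [Finset.smul_sum]
    exact sum_perm₆ _
  have h1 := fun c d => hR.cancel hx hz (f := fun g r => ∑ a, ∑ b, R (x a g) (y c b) • ∑ f, ∑ u,
        R (y f d) (z r u) • F (x i a) (y b f) (z u t))
      (g := fun g r => ∑ a, ∑ b, R (x a g) (y c b) • ∑ f, ∑ u,
        R (y f d) (z r u) • G (x i a) (y b f) (z u t)) fun j s => by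
      rw [← key, ← key]
      exact h _ _ _ _ (isComat_kron₁ (isComat_kron₁ hx)) (isComat_kron₁ (isComat_kron₂ hy))
        (isComat_kron₂ hz) (mcomm_kron₁ (mcomm_kron₁_kron₂ x y))
        (mcomm_kron₁_kron₂ _ z) (mcomm_kron₁_kron₂ _ z) _ _
  have h2 := fun d r => hR.cancel hx hy (f := fun a b => ∑ f, ∑ u,
        R (y f d) (z r u) • F (x i a) (y b f) (z u t))
      (g := fun a b => ∑ f, ∑ u,
        R (y f d) (z r u) • G (x i a) (y b f) (z u t)) fun g c =>
      congrFun (congrFun (h1 c d) g) r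
  have h3 := hR.cancel hy hz (f := fun f u => F (x i j) (y c f) (z u t))
      (g := fun f u => G (x i j) (y c f) (z u t)) fun d r =>
      congrFun (congrFun (h2 d r) j) c
  exact congrFun (congrFun h3 d) s

end Triple

theorem tlift_eq {k : Type*} [CommRing k] {M N Q : Type*} [AddCommGroup M] [Module k M]
    [AddCommGroup N] [Module k N] [AddCommGroup Q] [Module k Q] {f : M → N → Q}
    (L : M ⊗[k] N →ₗ[k] Q) (h : ∀ x y, L (x ⊗ₜ[k] y) = f x y) : tlift k f = L := by
  have : f = fun x y => (TensorProduct.curry L) x y := by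
    funext x y; simp [h]
  rw [this, tlift_lin]
  ext; simp

section Transmutation

variable {k : Type*} [Field k] {H : Type*} [Ring H] [HopfAlgebra k H]
  {R : H →ₗ[k] H →ₗ[k] k} (hR : CQ R)

include hR

theorem bulL_assoc (x y z : H) : bulL R (bulL R x y) z = bulL R x (bulL R y z) := by
  let G : H →ₗ[k] H →ₗ[k] H →ₗ[k] H := LinearMap.mk₂ k (fun x y => (bulL R x).comp (bulL R y))
    (by intros; ext; simp) (by intros; ext; simp) (by intros; ext; simp) (by intros; ext; simp)
  suffices (bulL R).compr₂ (bulL R) = G from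
    congrArg (fun F : H →ₗ[k] H →ₗ[k] H →ₗ[k] H => F x y z) this
  refine mcomm_ext₃_twist_all hR fun N _ _ P Q Z hP hQ hZ hPQ hPZ hQZ I J => ?_
  have hl : bm (bulL R) (bm (bulL R) (P * sc H (bm R P Q * bm R P Z)) Q * sc H (bm R Q Z)) Z =
      sc H (bm R P Q * bm R P Z * bm R Q Z) * P * Q * Z := by
    rw [sc_mul, ← mul_assoc, bm_sc_mid _ (P * sc H (bm R P Q)), mcomm_bm R hPQ hQZ.symm, bm_sc_right,
      bm_bul_eq hR hP hQ hPQ, mul_assoc _ (sc H (bm R P Z)), ← sc_mul,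
      ← bmR_mul_left hR hZ hQZ, mul_assoc (sc H (bm R P Q)), mul_assoc (sc H (bm R P Q)),
      bm_sc_left, bm_bul_eq hR (hP.mul hQ hPQ) hZ (hPZ.mul_left hQZ), bmR_mul_left hR hZ hQZ,
      mul_assoc (bm R P Q)]
    simp only [mul_assoc, sc_mul]
  have hr : bm (bulL R) (P * sc H (bm R P Q * bm R P Z)) (bm (bulL R) (Q * sc H (bm R Q Z)) Z) =
      sc H (bm R P Q * bm R P Z * bm R Q Z) * P * Q * Z := by
    rw [bm_bul_eq hR hQ hZ hQZ, mul_assoc (sc H (bm R Q Z)), ← bm_sc_mid, mul_assoc P, ← sc_mul,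
      bm_ybe hR hP hQ hZ hPQ hPZ hQZ, mul_assoc (bm R Q Z), sc_mul, ← mul_assoc P,
      ← mcomm_bm R hPQ.symm hPZ.symm, mul_assoc (sc H (bm R Q Z)), bm_sc_left,
      ← bmR_mul_right hR hP hQZ hPZ, bm_bul_eq hR hP (hQ.mul hZ hQZ) (hPQ.mul_right hPZ)]
    simp only [mul_assoc]
  have h := congrFun (congrFun (hl.trans hr.symm) I) J
  simp only [bm_apply, mul_sc_apply (A := H), map_sum, map_smul, LinearMap.sum_apply,
    LinearMap.smul_apply, Finset.smul_sum] at h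
  simp only [LinearMap.compr₂_apply, G, LinearMap.mk₂_apply, LinearMap.comp_apply]
  exact h.trans (sum_rot _)

theorem actL_mul (a g h : H) : actL R (actL R a g) h = actL R a (g * h) := by
  let G : H →ₗ[k] H →ₗ[k] H →ₗ[k] H := LinearMap.mk₂ k
    (fun a g => (actL R a).comp (LinearMap.mul k H g))
    (by intros; ext; simp) (by intros; ext; simp) (by intros; ext; simp) (by intros; ext; simp)
  suffices (actL R).compr₂ (actL R) = G from
    congrArg (fun F : H →ₗ[k] H →ₗ[k] H →ₗ[k] H => F a g h) this
  refine mcomm_ext₃ fun N _ _ P Q Z hP hQ hZ hPQ hPZ hQZ I J => ?_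
  have hm : bm (actL R) (bm (actL R) P Q) Z = bm (actL R) P (Q * Z) := by
    rw [bm_act_eq hR hP hQ hPQ, bm_act_eq hR hP (hQ.mul hZ hQZ) (hPQ.mul_right hPZ),
      bmR_mul_left hR hP hPZ.symm, bmR_mul_right hR hP hQZ hPZ, bm_sc_mid, mul_assoc,
      mcomm_bm R hPZ hQZ, bm_sc_left, bm_sc_right, bm_act_eq hR hP hZ hPZ]
    simp only [sc_mul, mul_assoc]
  have h := congrFun (congrFun hm I) J
  simp only [bm_apply, Matrix.mul_apply, map_sum, LinearMap.sum_apply] at h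
  simp only [LinearMap.compr₂_apply, G, LinearMap.mk₂_apply, LinearMap.comp_apply,
    LinearMap.mul_apply']
  exact h.trans Finset.sum_comm

omit hR in
theorem isComat_one : IsComat k (1 : Matrix (Fin 1) (Fin 1) H) := by
  constructor
  · intro i j
    rw [Subsingleton.elim i 0, Subsingleton.elim j 0]
    simp [Algebra.TensorProduct.one_def]
  · intro i j
    rw [Subsingleton.elim i 0, Subsingleton.elim j 0]
    simp

omit hR in
theorem comat_induction {M : Type*} [AddCommGroup M] [Module k M] {F G : H →ₗ[k] M}
    (h : ∀ (n : ℕ) (x : Matrix (Fin n) (Fin n) H), IsComat k x → ∀ i j, F (x i j) = G (x i j))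
    (a : H) : F a = G a := by
  rw [comat_ext h]

theorem one_bulL (a : H) : bulL R 1 a = a := by
  refine comat_induction (F := bulL R 1) (G := LinearMap.id) (fun n x hx i j => ?_) a
  have := bulL_comat R (isComat_one (k := k) (H := H)) hx 0 0 i j
  simpa [hR.one_left, hx.counit, HopfAlgebra.counit_antipode] using this

theorem bulL_one (a : H) : bulL R a 1 = a := by
  refine comat_induction (F := (bulL R).flip 1) (G := LinearMap.id) (fun n x hx i j => ?_) a
  have := bulL_comat R hx (isComat_one (k := k) (H := H)) i j 0 0
  simpa [hR.one_right, hx.counit] using this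

theorem actL_one (a : H) : actL R a 1 = a := by
  refine comat_induction (F := (actL R).flip 1) (G := LinearMap.id) (fun n x hx i j => ?_) a
  have := actL_comat R hx (isComat_one (k := k) (H := H)) i j 0 0
  simpa [hR.one_right, hR.one_left, hx.counit] using this

theorem one_actL (h : H) : actL R 1 h = (Coalgebra.counit (R := k) h : k) • (1 : H) := by
  refine comat_induction (F := actL R 1) (G := (Coalgebra.counit (R := k)).smulRight 1)
    (fun n x hx i j => ?_) h
  have := actL_comat R (isComat_one (k := k) (H := H)) hx 0 0 i j
  simpa [hR.one_right, hR.one_left, hx.counit] using this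

omit hR in
theorem adL_one : adL k (1 : H) = 1 ⊗ₜ 1 := by
  simpa using adL_comat (isComat_one (k := k) (H := H)) 0 0

end Transmutation

section ModuleAlgebra

variable {k : Type*} [Field k] {H : Type*} [Ring H] [HopfAlgebra k H]
  {R : H →ₗ[k] H →ₗ[k] k} (hR : CQ R)

include hR

theorem actL_bulL (a b h : H) : actL R (bulL R a b) h =
    tlift k (fun h1 h2 => bulL R (actL R a h1) (actL R b h2)) (Coalgebra.comul (R := k) h) := by
  let G : H →ₗ[k] H →ₗ[k] H →ₗ[k] H := LinearMap.mk₂ k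
    (fun a b => TensorProduct.lift (bulL R) ∘ₗ TensorProduct.map (actL R a) (actL R b) ∘ₗ
      Coalgebra.comul)
    (by intros; simp [TensorProduct.map_add_left, LinearMap.add_comp, LinearMap.comp_add])
    (by intros; simp [TensorProduct.map_smul_left, LinearMap.smul_comp, LinearMap.comp_smul])
    (by intros; simp [TensorProduct.map_add_right, LinearMap.add_comp, LinearMap.comp_add])
    (by intros; simp [TensorProduct.map_smul_right, LinearMap.smul_comp, LinearMap.comp_smul])
  rw [tlift_eq (TensorProduct.lift (bulL R) ∘ₗ TensorProduct.map (actL R a) (actL R b))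
    (fun _ _ => by simp)]
  suffices (bulL R).compr₂ (actL R) = G from
    congrArg (fun F : H →ₗ[k] H →ₗ[k] H →ₗ[k] H => F a b h) this
  refine mcomm_ext₃_twist hR fun N _ _ P Q Z hP hQ hZ hPQ hPZ hQZ I J => ?_
  have hm : bm (actL R) (bm (bulL R) (P * sc H (bm R P Q)) Q) Z =
      bm (bulL R) (bm (actL R) (P * sc H (bm R P Q)) Z) (bm (actL R) Q Z) := by
    rw [bm_bul_eq hR hP hQ hPQ, mul_assoc, bm_sc_left,
      bm_act_eq hR (hP.mul hQ hPQ) hZ (hPZ.mul_left hQZ), bmR_mul_left hR hZ hQZ,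
      bmR_mul_right hR hZ hPQ hQZ.symm, bm_sc_mid _ P, mcomm_bm R hPZ hQZ, bm_sc_right,
      bm_act_eq hR hP hZ hPZ, bm_act_eq hR hQ hZ hQZ, bm_sc_right]
    rw [mul_assoc (sc H (bm R Z P)), mul_assoc (sc H (bm R Z P)), bm_sc_left]
    have hy : P * (sc H (bm R P Z) * sc H (bm R P Q)) * sc H (bm R Z Q) =
        sc H (bm R Z Q) * (P * sc H (bm R P Q) * sc H (bm R P Z)) := by
      rw [mul_assoc, ← sc_mul, ← sc_mul, bm_ybe hR hP hZ hQ hPZ hPQ hQZ.symm, sc_mul, sc_mul,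
        mul_assoc, ← mul_assoc P, ← mcomm_bm R hPZ.symm hPQ.symm]
      simp only [mul_assoc]
    have hz := bm_ybe hR hZ hP hQ hPZ.symm hQZ.symm hPQ
    rw [mul_assoc P, ← bm_sc_mid, hy, bm_sc_left, bm_sc_mid, mcomm_bm R hPQ hQZ.symm,
      bm_sc_right, bm_bul_eq hR hP hQ hPQ]
    simp only [← mul_assoc, ← sc_mul]
    rw [← hz]
    simp only [← mul_assoc, sc_mul]
  have h := congrFun (congrFun hm I) J
  simp only [bm_apply, mul_sc_apply (A := H), map_sum, map_smul, LinearMap.sum_apply,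
    LinearMap.smul_apply] at h
  simp only [LinearMap.compr₂_apply, G, LinearMap.mk₂_apply, LinearMap.comp_apply,
    hZ.comul, map_sum, TensorProduct.map_tmul, TensorProduct.lift.tmul, Finset.smul_sum]
  refine h.trans ?_
  rw [sum_rot₄, sum_rot, sum_rot₄ fun (x x_1 x_2 x_3 : N) => bm R P Q x_2 x_1 •
    bulL R (actL R (P I x_2) (Z x x_3)) (actL R (Q x_1 x) (Z x_3 J))]
  refine Finset.sum_congr rfl fun B _ => Finset.sum_congr rfl fun A _ =>
    Finset.sum_congr rfl fun D _ => ?_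
  rw [← bm_apply, ← Finset.smul_sum, ← Finset.smul_sum]
  exact congrArg _ (hQZ.symm.apply (f := fun z q => bulL R (actL R (P I A) z) (actL R q (Z D J)))
    (IsBil.of (by simp) (by simp) (by simp) (by simp)) B D)

end ModuleAlgebra

section Crossed

variable {k : Type*} [Field k] {H : Type*} [Ring H] [HopfAlgebra k H]
  {N : Type} [Fintype N] [DecidableEq N] {P Q Z : Matrix N N H}

theorem sc_mul_map {A B : Type*} [Ring A] [Algebra k A] [Ring B] [Algebra k B] (f : A →ₗ[k] B)
    (r : Matrix N N k) (M : Matrix N N A) : (sc A r * M).map f = sc B r * M.map f := by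
  ext I J
  simp [sc_mul_apply]

theorem mul_sc_map {A B : Type*} [Ring A] [Algebra k A] [Ring B] [Algebra k B] (f : A →ₗ[k] B)
    (r : Matrix N N k) (M : Matrix N N A) : (M * sc A r).map f = M.map f * sc B r := by
  ext I J
  simp [mul_sc_apply]

/-- The product of a bilinear operation on the first factor with the product of the second. -/
def tensOp (F : H →ₗ[k] H →ₗ[k] H) : H ⊗[k] H →ₗ[k] H ⊗[k] H →ₗ[k] H ⊗[k] H :=
  TensorProduct.map₂ F (LinearMap.mul k H)

@[simp] theorem tensOp_tmul (F : H →ₗ[k] H →ₗ[k] H) (a b c d : H) :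
    tensOp F (a ⊗ₜ b) (c ⊗ₜ d) = F a c ⊗ₜ (b * d) := by
  simp [tensOp]

theorem tensOp_left (F : H →ₗ[k] H →ₗ[k] H) (x : H) (u v : H ⊗[k] H) :
    tensOp F (1 ⊗ₜ x * u) v = 1 ⊗ₜ x * tensOp F u v := by
  induction u with
  | zero => simp
  | add u u' h h' => simp [mul_add, h, h']
  | tmul a b => induction v with
    | zero => simp
    | add v v' h h' => simp only [mul_add, map_add, h, h']
    | tmul c d => simp [mul_assoc]

theorem tensOp_right (F : H →ₗ[k] H →ₗ[k] H) (x : H) (u v : H ⊗[k] H) :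
    tensOp F u (v * 1 ⊗ₜ x) = tensOp F u v * 1 ⊗ₜ x := by
  induction u with
  | zero => simp
  | add u u' h h' => simp [add_mul, h, h']
  | tmul a b => induction v with
    | zero => simp
    | add v v' h h' => simp only [add_mul, map_add, h, h']
    | tmul c d => simp [mul_assoc]

theorem tensOp_mid (F : H →ₗ[k] H →ₗ[k] H) (x : H) (u v : H ⊗[k] H) :
    tensOp F (u * 1 ⊗ₜ x) v = tensOp F u (1 ⊗ₜ x * v) := by
  induction u with
  | zero => simp
  | add u u' h h' => simp [add_mul, h, h']
  | tmul a b => induction v with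
    | zero => simp
    | add v v' h h' => simp only [mul_add, map_add, h, h']
    | tmul c d => simp [mul_assoc]

theorem bm_tensOp_left (F : H →ₗ[k] H →ₗ[k] H) (X : Matrix N N H) (U V : Matrix N N (H ⊗[k] H)) :
    bm (tensOp F) (inr k X * U) V = inr k X * bm (tensOp F) U V := by
  ext I J
  simp only [bm_apply, Matrix.mul_apply, map_sum, LinearMap.sum_apply, inr_apply, tensOp_left,
    Finset.mul_sum]
  exact Finset.sum_comm

theorem bm_tensOp_right (F : H →ₗ[k] H →ₗ[k] H) (X : Matrix N N H)
    (U V : Matrix N N (H ⊗[k] H)) :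
    bm (tensOp F) U (V * inr k X) = bm (tensOp F) U V * inr k X := by
  ext I J
  simp only [bm_apply, Matrix.mul_apply, map_sum, inr_apply, tensOp_right,
    Finset.sum_mul]
  exact Finset.sum_comm

theorem bm_tensOp_mid (F : H →ₗ[k] H →ₗ[k] H) (X : Matrix N N H) (U V : Matrix N N (H ⊗[k] H)) :
    bm (tensOp F) (U * inr k X) V = bm (tensOp F) U (inr k X * V) := by
  ext I J
  simp only [bm_apply, Matrix.mul_apply, map_sum, LinearMap.sum_apply, inr_apply, tensOp_mid]
  exact Finset.sum_comm

theorem bm_tensOp_inl (F : H →ₗ[k] H →ₗ[k] H) (P Q : Matrix N N H) :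
    bm (tensOp F) (inl k P) (inl k Q) = inl k (bm F P Q) := by
  ext I J
  simp [bm_apply, inl_apply, TensorProduct.sum_tmul]

theorem MComm.apm_right (h : MComm k P Q) : MComm k P (apm k Q) :=
  h.map LinearMap.id (HopfAlgebra.antipode k)

variable {R : H →ₗ[k] H →ₗ[k] k} (hR : CQ R)

include hR

theorem mul_sc_apm (hP : IsComat k P) (hQ : IsComat k Q) (h : MComm k P Q) :
    P * sc H (bm R P Q) * apm k Q = apm k Q * sc H (bm R P Q) * P := by
  have h1 := congrArg (fun M => apm k Q * M * apm k Q) (bm_rtt hR hP hQ h)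
  simp only [← mul_assoc, apm_mul_self hQ, one_mul] at h1
  rw [mul_assoc _ Q, self_mul_apm hQ, mul_one] at h1
  exact h1.symm

theorem apm_mul_apm_sc (hP : IsComat k P) (hQ : IsComat k Q) (h : MComm k P Q) :
    apm k P * apm k Q * sc H (bm R P Q) = sc H (bm R P Q) * apm k Q * apm k P := by
  have h1 := congrArg (fun M => apm k P * M * apm k P) (mul_sc_apm hR hP hQ h)
  simp only [← mul_assoc, apm_mul_self hP, one_mul] at h1
  rw [mul_assoc _ P, self_mul_apm hP, mul_one] at h1
  exact h1.symm

theorem adL_bulL (a b : H) : adL k (bulL R a b) = tensOp (bulL R) (adL k a) (adL k b) := by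
  suffices (bulL R).compr₂ (adL k) = (tensOp (bulL R)).compl₁₂ (adL k) (adL k) from
    congrArg (fun F : H →ₗ[k] H →ₗ[k] H ⊗[k] H => F a b) this
  refine mcomm_ext₂_twist hR fun N _ _ P Q hP hQ hPQ I J => ?_
  have hm : (bm (bulL R) (P * sc H (bm R P Q)) Q).map (adL k) =
      bm (tensOp (bulL R)) (P.map (adL k) * sc _ (bm R P Q)) (Q.map (adL k)) := by
    rw [bm_bul_eq hR hP hQ hPQ, mul_assoc, sc_mul_map, map_adL (hP.mul hQ hPQ), map_adL hP,
      map_adL hQ, ← inr_sc, mul_assoc (inr k (apm k P)), mul_assoc (inr k (apm k P)),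
      bm_tensOp_left, mul_assoc (inl k P), ← inr_mul, bm_tensOp_right, bm_tensOp_mid, ← mul_assoc (inr k (P * _)), ← inr_mul,
      mul_sc_apm hR hP hQ hPQ, inr_mul _ P, mul_assoc _ (inr k P), ← inl_mul_inr hPQ.symm,
      ← bm_tensOp_mid, inr_mul (apm k Q), ← mul_assoc (inl k P), inl_mul_inr hPQ.apm_right,
      mul_assoc (inr k (apm k Q)), bm_tensOp_left, bm_tensOp_right,
      inr_sc, ← inl_sc, ← inl_mul, bm_tensOp_inl, bm_bul_eq hR hP hQ hPQ, mul_assoc (sc H _),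
      inl_mul (sc H _), inl_sc, ← inr_sc, apm_mul hPQ]
    simp only [← mul_assoc, ← inr_mul]
    rw [apm_mul_apm_sc hR hP hQ hPQ]
    simp only [mul_assoc, inr_mul]
  have h := congrFun (congrFun hm I) J
  simp only [bm_apply, mul_sc_apply (A := H), mul_sc_apply (A := H ⊗[k] H), map_sum, map_smul,
    LinearMap.sum_apply, LinearMap.smul_apply, Matrix.map_apply] at h
  simp only [LinearMap.compr₂_apply, LinearMap.compl₁₂_apply]
  exact (Finset.sum_comm.trans h).trans Finset.sum_comm

end Crossed

section Crossed

variable {k : Type*} [Field k] {H : Type*} [Ring H] [HopfAlgebra k H]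

theorem IsComat.map_comul {N : Type} [Fintype N] [DecidableEq N] {P : Matrix N N H}
    (hP : IsComat k P) (I J : N) :
    Coalgebra.comul (R := k) (P I J) = (inl k P * inr k P) I J := by
  simp [hP.comul, Matrix.mul_apply, inl_apply, inr_apply]

theorem tlift_tlift_map₂ {A B C D M N' : Type*} [AddCommGroup A] [Module k A] [AddCommGroup B]
    [Module k B] [AddCommGroup C] [Module k C] [AddCommGroup D] [Module k D] [AddCommGroup M]
    [Module k M] [AddCommGroup N'] [Module k N']
    (F : A →ₗ[k] C →ₗ[k] M) (G : B →ₗ[k] D →ₗ[k] N') (s : A ⊗[k] B) (t : C ⊗[k] D) :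
    tlift k (fun a b => tlift k (fun c d => F a c ⊗ₜ[k] G b d) t) s = TensorProduct.map₂ F G s t := by
  rw [tlift_eq ((TensorProduct.map₂ F G).flip t) fun a b => ?_]
  · rfl
  · rw [tlift_eq (TensorProduct.map₂ F G (a ⊗ₜ b)) fun c d => by simp]
    rfl

theorem tlift_adL_coassoc (a : H) :
    tlift k (fun a0 a1 => (a0 ⊗ₜ[k] (Coalgebra.comul (R := k) a1) : H ⊗[k] (H ⊗[k] H)))
      (adL k a) =
    tlift k (fun a0 a1 => tlift k (fun c0 c1 => (c0 ⊗ₜ[k] (c1 ⊗ₜ[k] a1) : H ⊗[k] (H ⊗[k] H)))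
      (adL k a0)) (adL k a) := by
  rw [tlift_eq (LinearMap.lTensor H (Coalgebra.comul (R := k))) fun x y => by simp,
    tlift_eq ((TensorProduct.assoc k H H H).toLinearMap ∘ₗ LinearMap.rTensor H (adL k))
      fun x y => by
        rw [tlift_eq ((TensorProduct.assoc k H H H).toLinearMap ∘ₗ
          (TensorProduct.mk k (H ⊗[k] H) H).flip y) fun c d => by simp]
        simp]
  refine comat_induction (F := LinearMap.lTensor H (Coalgebra.comul (R := k)) ∘ₗ adL k)
    (G := (TensorProduct.assoc k H H H).toLinearMap ∘ₗ LinearMap.rTensor H (adL k) ∘ₗ adL k)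
    (fun n x hx i j => ?_) a
  simp only [LinearMap.comp_apply, adL_comat hx, map_sum, LinearMap.lTensor_tmul,
    LinearMap.rTensor_tmul, Bialgebra.comul_mul, hx.comul, LinearEquiv.coe_coe]
  have h := fun i a => hx.comul_apm i a
  simp only [apm_apply] at h
  simp only [h, Finset.sum_mul_sum, Algebra.TensorProduct.tmul_mul_tmul, tmul_sum, sum_tmul,
    map_sum, assoc_tmul]
  exact (sum_rot₄ _).trans (sum_rot₄ _)

theorem tlift_adL_counit (a : H) :
    tlift k (fun a0 a1 => (Coalgebra.counit (R := k) a1 : k) • a0) (adL k a) = a := by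
  rw [tlift_eq ((TensorProduct.rid k H).toLinearMap ∘ₗ
    LinearMap.lTensor H (Coalgebra.counit (R := k))) fun x y => by simp]
  refine comat_induction (F := (TensorProduct.rid k H).toLinearMap ∘ₗ
    LinearMap.lTensor H (Coalgebra.counit (R := k)) ∘ₗ adL k) (G := LinearMap.id)
    (fun n x hx i j => ?_) a
  simp [adL_comat hx, HopfAlgebra.counit_antipode, hx.counit]

variable {R : H →ₗ[k] H →ₗ[k] k} (hR : CQ R)

include hR

theorem actL_adL_compat (a h : H) :
    tlift k (fun h1 h2 => tlift k (fun c0 c1 => c0 ⊗ₜ[k] (h1 * c1)) (adL k (actL R a h2)))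
      (Coalgebra.comul (R := k) h) =
    tlift k (fun a0 a1 => tlift k (fun h1 h2 => actL R a0 h1 ⊗ₜ[k] (a1 * h2))
      (Coalgebra.comul (R := k) h)) (adL k a) := by
  let inc : H →ₗ[k] H ⊗[k] H := TensorProduct.mk k H H 1
  let F : H →ₗ[k] H →ₗ[k] H ⊗[k] H := LinearMap.mk₂ k
    (fun a h => (LinearMap.mul' k (H ⊗[k] H) ∘ₗ TensorProduct.map inc (adL k ∘ₗ actL R a) ∘ₗ
      Coalgebra.comul) h)
    (by intros; simp [TensorProduct.map_add_right, LinearMap.comp_add])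
    (by intros; simp [TensorProduct.map_smul_right, LinearMap.comp_smul])
    (by intros; simp) (by intros; simp)
  have hr := tlift_tlift_map₂ (actL R) (LinearMap.mul k H) (adL k a) (Coalgebra.comul (R := k) h)
  simp only [LinearMap.mul_apply'] at hr
  rw [hr, tlift_eq (LinearMap.mul' k (H ⊗[k] H) ∘ₗ TensorProduct.map inc (adL k ∘ₗ actL R a))
    fun h1 h2 => by
      rw [tlift_eq (LinearMap.mulLeft k ((1 : H) ⊗ₜ[k] h1)) fun c d => by simp]
      simp [inc]]
  suffices F = (tensOp (actL R)).compl₁₂ (adL k) Coalgebra.comul from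
    congrArg (fun F : H →ₗ[k] H →ₗ[k] H ⊗[k] H => F a h) this
  refine mcomm_ext₂ fun N _ _ P Q hP hQ hPQ I J => ?_
  have hl : ∑ A, F (P I A) (Q A J) = (inr k Q * (bm (actL R) P Q).map (adL k)) I J := by
    simp only [F, LinearMap.mk₂_apply, LinearMap.comp_apply, hQ.comul, map_sum,
      TensorProduct.map_tmul, LinearMap.mul'_apply, Matrix.mul_apply, Matrix.map_apply, bm_apply,
      inr_apply, Finset.mul_sum]
    refine Finset.sum_comm.trans (Eq.trans ?_ Finset.sum_comm)
    refine Finset.sum_congr rfl fun D _ => ?_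
    exact hPQ.apply (f := fun p q => inc q * adL k (actL R p (Q D J)))
      (IsBil.of (by simp [mul_add]) (by simp) (by simp [add_mul]) (by simp)) I D
  have hr' : ∑ A, (tensOp (actL R)).compl₁₂ (adL k) Coalgebra.comul (P I A) (Q A J) =
      bm (tensOp (actL R)) (P.map (adL k)) (inl k Q * inr k Q) I J := by
    simp [bm_apply, ← hQ.map_comul]
  rw [hl, hr']
  refine congrFun (congrFun ?_ I) J
  rw [map_adL hP, mul_assoc (inr k (apm k P)), bm_tensOp_left, bm_tensOp_right, bm_tensOp_mid,
    ← inl_mul_inr hPQ.symm, bm_tensOp_right, bm_tensOp_inl, bm_act_eq hR hP hQ hPQ, mul_sc_map,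
    sc_mul_map, map_adL hP, inl_mul, inl_mul, inl_sc, inl_sc]
  simp only [← inr_sc, mul_assoc, ← inr_mul]
  rw [← mul_assoc (sc H (bm R P Q)), bm_rtt hR hP hQ hPQ, mul_assoc Q, inr_mul Q, ← mul_assoc (inl k P),
    inl_mul_inr hPQ]
  simp only [← mul_assoc, ← inr_mul]
  rw [mul_sc_apm hR hQ hP hPQ.symm]

theorem bulL_actL_comm (a b : H) :
    TensorProduct.lift (bulL R) (TensorProduct.map (actL R a) LinearMap.id
      (Coalgebra.comul (R := k) b)) =
    TensorProduct.lift (bulL R) (TensorProduct.map LinearMap.id (actL R a)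
      (Coalgebra.comul (R := k) b)) := by
  let F : H →ₗ[k] H →ₗ[k] H := LinearMap.mk₂ k
    (fun a b => (TensorProduct.lift (bulL R) ∘ₗ TensorProduct.map (actL R a) LinearMap.id ∘ₗ
      Coalgebra.comul) b)
    (by intros; simp [TensorProduct.map_add_left])
    (by intros; simp [TensorProduct.map_smul_left])
    (by intros; simp) (by intros; simp)
  let G : H →ₗ[k] H →ₗ[k] H := LinearMap.mk₂ k
    (fun a b => (TensorProduct.lift (bulL R) ∘ₗ TensorProduct.map LinearMap.id (actL R a) ∘ₗ
      Coalgebra.comul) b)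
    (by intros; simp [TensorProduct.map_add_right])
    (by intros; simp [TensorProduct.map_smul_right])
    (by intros; simp) (by intros; simp)
  suffices F = G from congrArg (fun F : H →ₗ[k] H →ₗ[k] H => F a b) this
  refine mcomm_ext₂ fun N _ _ P Q hP hQ hPQ I J => ?_
  have hl : ∑ A, F (P I A) (Q A J) = bm (bulL R) (bm (actL R) P Q) Q I J := by
    simp only [F, LinearMap.mk₂_apply, LinearMap.comp_apply, hQ.comul, map_sum, bm_apply,
      TensorProduct.map_tmul, TensorProduct.lift.tmul, LinearMap.id_apply, LinearMap.sum_apply]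
    exact Finset.sum_comm
  have hr : ∑ A, G (P I A) (Q A J) = bm (bulL R) Q (bm (actL R) P Q) I J := by
    simp only [G, LinearMap.mk₂_apply, LinearMap.comp_apply, hQ.comul, map_sum, bm_apply,
      TensorProduct.map_tmul, TensorProduct.lift.tmul, LinearMap.id_apply]
    refine Finset.sum_comm.trans (Eq.trans ?_ Finset.sum_comm)
    refine Finset.sum_congr rfl fun D _ => ?_
    exact hPQ.apply (f := fun p q => bulL R q (actL R p (Q D J)))
      (IsBil.of (by simp) (by simp) (by simp) (by simp)) I D
  rw [hl, hr]
  refine congrFun (congrFun ?_ I) J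
  rw [bm_act_eq hR hP hQ hPQ, bm_sc_right, mul_assoc (sc H (bm R Q P)) P, bm_sc_left,
    bm_bul_eq hR hP hQ hPQ, ← bm_sc_mid, bm_bul_eq hR hQ hP hPQ.symm, mul_assoc (sc H (bm R Q P)),
    mul_assoc (sc H (bm R Q P)), ← bm_rtt hR hP hQ hPQ]

theorem bulL_braided (a b : H) :
    bulL R a b = tlift k (fun b0 b1 => bulL R b0 (actL R a b1)) (adL k b) := by
  rw [tlift_eq (TensorProduct.lift (bulL R) ∘ₗ TensorProduct.map LinearMap.id (actL R a))
    fun x y => by simp]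
  refine comat_induction (F := bulL R a) (G := TensorProduct.lift (bulL R) ∘ₗ
    TensorProduct.map LinearMap.id (actL R a) ∘ₗ adL k) (fun n y hy i j => ?_) b
  have h := fun c => bulL_actL_comm hR (actL R a (HopfAlgebra.antipode k (y i c))) (y c j)
  simp only [hy.comul, map_sum, TensorProduct.map_tmul, TensorProduct.lift.tmul,
    LinearMap.id_apply, actL_mul hR] at h
  simp only [LinearMap.comp_apply, adL_comat hy, map_sum, TensorProduct.map_tmul,
    TensorProduct.lift.tmul, LinearMap.id_apply, ← h]
  rw [Finset.sum_comm]
  have h1 := fun d => congrFun (congrFun (apm_mul_self hy) i) d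
  simp only [Matrix.mul_apply, apm_apply] at h1
  simp only [← LinearMap.sum_apply, ← map_sum, h1, Matrix.one_apply]
  simp [apply_ite, actL_one hR]
  rw [Finset.sum_eq_single i (fun b _ hb => by simp [Ne.symm hb]) (by simp)]
  simp

end Crossed

/-! ## Bijectivity of the antipode -/

section AntipodeInverse

variable {k : Type*} [Field k] {H : Type*} [Ring H] [HopfAlgebra k H]

/-- The right convolution action `a ↦ a₁ w(a₂)` of a linear form. -/
def rightConv (w : H →ₗ[k] k) : H →ₗ[k] H :=
  (TensorProduct.rid k H).toLinearMap ∘ₗ LinearMap.lTensor H w ∘ₗ Coalgebra.comul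

/-- The left convolution action `a ↦ z(a₁) a₂` of a linear form. -/
def leftConv (z : H →ₗ[k] k) : H →ₗ[k] H :=
  (TensorProduct.lid k H).toLinearMap ∘ₗ LinearMap.rTensor H z ∘ₗ Coalgebra.comul

theorem rightConv_comat (w : H →ₗ[k] k) {N : Type} [Fintype N] [DecidableEq N] {P : Matrix N N H}
    (hP : IsComat k P) : P.map (rightConv w) = P * sc H (P.map w) := by
  ext I J
  simp [rightConv, hP.comul, mul_sc_apply]

theorem leftConv_comat (z : H →ₗ[k] k) {N : Type} [Fintype N] [DecidableEq N] {P : Matrix N N H}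
    (hP : IsComat k P) : P.map (leftConv z) = sc H (P.map z) * P := by
  ext I J
  simp [leftConv, hP.comul, sc_mul_apply]

/-- The linear form `a ↦ R(a₂ ⊗ S a₁)`. -/
def formW (R : H →ₗ[k] H →ₗ[k] k) : H →ₗ[k] k :=
  TensorProduct.lift (R.flip ∘ₗ HopfAlgebra.antipode k) ∘ₗ Coalgebra.comul

/-- The linear form `a ↦ R(S² a₂ ⊗ a₁)`. -/
def formZ (R : H →ₗ[k] H →ₗ[k] k) : H →ₗ[k] k :=
  TensorProduct.lift (R ∘ₗ HopfAlgebra.antipode k ∘ₗ HopfAlgebra.antipode k).flip ∘ₗ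
    Coalgebra.comul

variable {N : Type} [Fintype N] [DecidableEq N] {P : Matrix N N H}
  {R : H →ₗ[k] H →ₗ[k] k} (hR : CQ R)

theorem formW_comat (R : H →ₗ[k] H →ₗ[k] k) (hP : IsComat k P) (I J : N) :
    formW R (P I J) = ∑ E, R (P E J) (HopfAlgebra.antipode k (P I E)) := by
  simp [formW, hP.comul]

theorem formZ_comat (R : H →ₗ[k] H →ₗ[k] k) (hP : IsComat k P) (I J : N) :
    formZ R (P I J) =
      ∑ E, R (HopfAlgebra.antipode k (HopfAlgebra.antipode k (P E J))) (P I E) := by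
  simp [formZ, hP.comul]

theorem IsComat.transpose_apm (hP : IsComat k P) : IsComat k (apm k P).transpose where
  comul I J := by simp [hP.comul_apm]
  counit I J := by simp [apm_apply, HopfAlgebra.counit_antipode, hP.counit, eq_comm]

include hR

theorem formW_smul_one (hP : IsComat k P) (I J : N) :
    formW R (P I J) • (1 : H) =
      ∑ E, (sc H (P.map (formW R)) * P) E J * HopfAlgebra.antipode k (P I E) := by
  have h : ∑ c, ∑ e, ∑ a, R (P a J) (HopfAlgebra.antipode k (P I e)) •
        (HopfAlgebra.antipode k (P e c) * P c a) =
      ∑ c, ∑ a, ∑ e, R (P c a) (HopfAlgebra.antipode k (P e c)) •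
        (P a J * HopfAlgebra.antipode k (P I e)) :=
    Finset.sum_congr rfl fun c _ => hR.rtt hP hP.transpose_apm c J c I
  have h1 := fun e d => congrFun (congrFun (apm_mul_self hP) e) d
  simp only [Matrix.mul_apply, apm_apply] at h1
  rw [sum_rot] at h
  simp only [← Finset.smul_sum, h1] at h
  have h2 : formW R (P I J) • (1 : H) = ∑ e, ∑ a, R (P a J) (HopfAlgebra.antipode k (P I e)) •
      (1 : Matrix N N H) e a := by
    rw [formW_comat R hP, Finset.sum_smul]
    refine Finset.sum_congr rfl fun e _ => ?_
    rw [Finset.sum_eq_single e (fun b _ hb => by simp [Ne.symm hb]) (by simp)]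
    simp
  rw [h2, h, Finset.sum_comm]
  simp only [sc_mul_apply, Matrix.map_apply, formW_comat R hP, Finset.sum_mul, Finset.sum_smul,
    smul_mul_assoc]
  rw [sum_rot, sum_rot]

theorem antipode_sq_mul_sc (hP : IsComat k P) :
    apm k (apm k P) * sc H (P.map (formW R)) = sc H (P.map (formW R)) * P := by
  ext F J
  have h := congrArg (fun f => ∑ d, f d) (funext fun d =>
    congrArg (· * HopfAlgebra.antipode k (HopfAlgebra.antipode k (P F d)))
      (formW_smul_one hR hP d J))
  simp only [Finset.sum_mul, smul_mul_assoc, one_mul, mul_assoc] at h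
  rw [mul_sc_apply]
  refine h.trans ?_
  rw [Finset.sum_comm]
  simp only [← HopfAlgebra.antipode_mul_antidistrib, ← Finset.mul_sum, ← map_sum]
  have h1 := fun d => congrFun (congrFun (apm_mul_self hP) F) d
  simp only [Matrix.mul_apply, apm_apply] at h1
  simp only [h1]
  rw [Finset.sum_eq_single F (fun b _ hb => by simp [Ne.symm hb]) (by simp)]
  simp

theorem formZ_mul_formW (hP : IsComat k P) : P.map (formZ R) * P.map (formW R) = 1 := by
  ext I J
  have h : ∀ E, ∑ A, (formW R) (P A J) * R (apm k (apm k P) E A) (P I E) =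
      ∑ A, formW R (P E A) * R (P A J) (P I E) := fun E => by
    have := congrArg (fun f => R f (P I E))
      (congrFun (congrFun (antipode_sq_mul_sc hR hP) E) J)
    simpa [mul_sc_apply, sc_mul_apply] using this
  simp only [Matrix.mul_apply, Matrix.map_apply, formZ_comat R hP, Finset.sum_mul]
  rw [Finset.sum_comm]
  simp only [mul_comm (R _ _) (formW R _)]
  refine (Finset.sum_congr rfl fun E _ => h E).trans ?_
  simp only [formW_comat R hP, Finset.sum_mul]
  rw [sum_rot, sum_rot]
  have h1 := fun F => congrFun (congrFun (self_mul_apm hP) I) F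
  simp only [Matrix.mul_apply, apm_apply] at h1
  simp only [← hR.mul_right hP, ← map_sum, h1]
  rw [Finset.sum_eq_single I (fun b _ hb => by simp [Ne.symm hb]) (by simp)]
  simp [hR.one_right, hP.counit, Matrix.one_apply]

theorem antipode_bijective : Function.Bijective (HopfAlgebra.antipode k (A := H)) := by
  have hw : ∀ {n : ℕ} {x : Matrix (Fin n) (Fin n) H}, IsComat k x →
      apm k (apm k x) = sc H (x.map (formW R)) * x * sc H (x.map (formZ R)) := fun hx => by
    rw [← antipode_sq_mul_sc hR hx, mul_assoc, ← sc_mul,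
      mul_eq_one_comm.1 (formZ_mul_formW hR hx), sc_one, mul_one]
  let φ : H →ₗ[k] H := rightConv (formW R) ∘ₗ leftConv (formZ R)
  have hφ : ∀ {n : ℕ} {x : Matrix (Fin n) (Fin n) H}, IsComat k x →
      x.map φ = sc H (x.map (formZ R)) * x * sc H (x.map (formW R)) := fun {n x} hx => by
    have : x.map φ = (x.map (leftConv (formZ R))).map (rightConv (formW R)) := rfl
    rw [this, leftConv_comat _ hx, sc_mul_map, rightConv_comat _ hx, mul_assoc]
  have hl : ∀ a, φ (HopfAlgebra.antipode k (HopfAlgebra.antipode k a)) = a := by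
    refine comat_induction (F := φ ∘ₗ HopfAlgebra.antipode k ∘ₗ HopfAlgebra.antipode k)
      (G := LinearMap.id) fun n x hx i j => ?_
    refine congrFun (congrFun (?_ : (apm k (apm k x)).map φ = x) i) j
    rw [hw hx, mul_sc_map, sc_mul_map, hφ hx, mul_assoc, mul_assoc, ← sc_mul,
      mul_eq_one_comm.1 (formZ_mul_formW hR hx), ← mul_assoc, ← mul_assoc, ← sc_mul,
      mul_eq_one_comm.1 (formZ_mul_formW hR hx)]
    simp [sc_one]
  have hr : ∀ a, HopfAlgebra.antipode k (HopfAlgebra.antipode k (φ a)) = a := by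
    refine comat_induction (F := HopfAlgebra.antipode k ∘ₗ HopfAlgebra.antipode k ∘ₗ φ)
      (G := LinearMap.id) fun n x hx i j => ?_
    refine congrFun (congrFun (?_ : (x.map φ).map
      (HopfAlgebra.antipode k ∘ₗ HopfAlgebra.antipode k) = x) i) j
    have : x.map (HopfAlgebra.antipode k ∘ₗ HopfAlgebra.antipode k) = apm k (apm k x) := rfl
    rw [hφ hx, mul_sc_map, sc_mul_map, this, hw hx, mul_assoc, mul_assoc, ← sc_mul,
      formZ_mul_formW hR hx, ← mul_assoc, ← mul_assoc, ← sc_mul, formZ_mul_formW hR hx]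
    simp [sc_one]
  exact ⟨fun a b hab => by rw [← hl a, hab, hl], fun a => ⟨_, hr a⟩⟩

end AntipodeInverse

/-! ## The inverse antipode -/

theorem comul_antipode_swap {k : Type*} [Field k] {H : Type*} [Ring H] [HopfAlgebra k H] (a : H) :
    Coalgebra.comul (R := k) (HopfAlgebra.antipode k a) = TensorProduct.comm k H H
      (TensorProduct.map (HopfAlgebra.antipode k) (HopfAlgebra.antipode k)
        (Coalgebra.comul (R := k) a)) := by
  refine comat_induction (F := Coalgebra.comul ∘ₗ HopfAlgebra.antipode k)
    (G := (TensorProduct.comm k H H).toLinearMap ∘ₗ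
      TensorProduct.map (HopfAlgebra.antipode k) (HopfAlgebra.antipode k) ∘ₗ Coalgebra.comul)
    (fun n x hx i j => ?_) a
  have := hx.comul_apm i j
  simp only [apm_apply] at this
  simp [this, hx.comul]

section InverseAntipode

variable {k : Type*} [Field k] {H : Type*} [Ring H] [HopfAlgebra k H] {T : H →ₗ[k] H}
  (hTS : ∀ a, T (HopfAlgebra.antipode k a) = a) (hST : ∀ a, HopfAlgebra.antipode k (T a) = a)
  {N : Type} [Fintype N] [DecidableEq N] {P : Matrix N N H}

include hTS hST

theorem invAntipode_one : T 1 = 1 := by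
  have := hTS 1
  rwa [HopfAlgebra.antipode_one] at this

theorem invAntipode_mul (a b : H) : T (a * b) = T b * T a := by
  rw [← hTS (T b * T a), HopfAlgebra.antipode_mul_antidistrib, hST, hST]

theorem IsComat.sum_invAntipode_mul (hP : IsComat k P) (I J : N) :
    ∑ E, T (P E J) * P I E = (1 : Matrix N N H) I J := by
  have h := congrArg T (congrFun (congrFun (apm_mul_self hP) I) J)
  simp only [Matrix.mul_apply, apm_apply, map_sum, invAntipode_mul hTS hST, hTS] at h
  rw [h, Matrix.one_apply]
  split_ifs <;> simp [invAntipode_one hTS hST]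

theorem IsComat.sum_mul_invAntipode (hP : IsComat k P) (I J : N) :
    ∑ E, P E J * T (P I E) = (1 : Matrix N N H) I J := by
  have h := congrArg T (congrFun (congrFun (self_mul_apm hP) I) J)
  simp only [Matrix.mul_apply, apm_apply, map_sum, invAntipode_mul hTS hST, hTS] at h
  rw [h, Matrix.one_apply]
  split_ifs <;> simp [invAntipode_one hTS hST]

theorem IsComat.transpose_invAntipode (hP : IsComat k P) :
    IsComat k (P.map T).transpose where
  counit I J := by
    have := HopfAlgebra.counit_antipode (R := k) (T (P J I))
    rw [hST, hP.counit] at this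
    simp [← this, eq_comm]
  comul I J := by
    have h := comul_antipode_swap (k := k) (T (P J I))
    rw [hST, hP.comul] at h
    have h2 := congrArg (fun z => TensorProduct.map T T (TensorProduct.comm k H H z)) h
    have h3 : ∀ z : H ⊗[k] H, TensorProduct.map T T (TensorProduct.comm k H H
        (TensorProduct.comm k H H (TensorProduct.map (HopfAlgebra.antipode k)
          (HopfAlgebra.antipode k) z))) = z := fun z => by
      induction z with
      | zero => simp
      | tmul a b => simp [hTS]
      | add a b ha hb => simpa using congrArg₂ (· + ·) ha hb
    simp only [h3] at h2
    simpa using h2.symm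

end InverseAntipode

/-! ## Maps out of the balanced tensor products -/

theorem qtlift_eq {k : Type*} [CommRing k] {M N Q : Type*} [AddCommGroup M] [Module k M]
    [AddCommGroup N] [Module k N] [AddCommGroup Q] [Module k Q] {p : Submodule k (M ⊗[k] N)}
    {f : M → N → Q} (L : ((M ⊗[k] N) ⧸ p) →ₗ[k] Q)
    (h : ∀ x y, L (Submodule.Quotient.mk (x ⊗ₜ[k] y)) = f x y) : qtlift k p f = L := by
  have hex : ∃ F : ((M ⊗[k] N) ⧸ p) →ₗ[k] Q,
      ∀ x y, F (Submodule.Quotient.mk (x ⊗ₜ[k] y)) = f x y := ⟨L, h⟩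
  rw [qtlift, dif_pos hex]
  refine Submodule.linearMap_qext _ (TensorProduct.ext' fun x y => ?_)
  exact (hex.choose_spec x y).trans (h x y).symm

namespace BgdST

variable {k : Type*} [Field k] {B L : Type*} [Ring B] [Algebra k B] [Ring L] [Algebra k L]
variable (st : BgdST k B L) {Q : Type*} [AddCommGroup Q] [Module k Q]

/-- The class of a pure tensor in `L ⊗_B L`, as a bilinear map. -/
def mk2L : L →ₗ[k] L →ₗ[k] st.T2 := (TensorProduct.mk k L L).compr₂ st.rel.mkQ

/-- The class of a pure tensor in `L ⊗_{B^op} L`, as a bilinear map. -/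
def mkOpL : L →ₗ[k] L →ₗ[k] st.TOp := (TensorProduct.mk k L L).compr₂ st.relOp.mkQ

/-- The class of a pure tensor in `L ⊗^{B^op} L`, as a bilinear map. -/
def mkAL : L →ₗ[k] L →ₗ[k] st.TA := (TensorProduct.mk k L L).compr₂ st.relA.mkQ

theorem mk2L_apply (X Y : L) : st.mk2L X Y = st.mk2 X Y := rfl
theorem mk2L_t (b : B) (X Y : L) : st.mk2L (st.t b * X) Y = st.mk2L X (st.s b * Y) :=
  (Submodule.Quotient.eq _).2 (Submodule.subset_span ⟨b, X, Y, rfl⟩)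

theorem mkOpL_t (b : B) (X Y : L) : st.mkOpL (X * st.t b) Y = st.mkOpL X (st.t b * Y) :=
  (Submodule.Quotient.eq _).2 (Submodule.subset_span ⟨b, X, Y, rfl⟩)

theorem mkAL_s (b : B) (X Y : L) : st.mkAL (st.s b * X) Y = st.mkAL X (Y * st.s b) :=
  (Submodule.Quotient.eq _).2 (Submodule.subset_span ⟨b, X, Y, rfl⟩)

theorem exists_desc2 (F : L →ₗ[k] L →ₗ[k] Q)
    (h : ∀ b X Y, F (st.t b * X) Y = F X (st.s b * Y)) :
    ∃ G : st.T2 →ₗ[k] Q, ∀ X Y, G (st.mk2 X Y) = F X Y :=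
  ⟨st.rel.liftQ (TensorProduct.lift F) (Submodule.span_le.2 (by
    rintro _ ⟨b, X, Y, rfl⟩; simp [h])), fun X Y => TensorProduct.lift.tmul X Y⟩

theorem exists_descOp (F : L →ₗ[k] L →ₗ[k] Q)
    (h : ∀ b X Y, F (X * st.t b) Y = F X (st.t b * Y)) :
    ∃ G : st.TOp →ₗ[k] Q, ∀ X Y, G (st.mkOp X Y) = F X Y :=
  ⟨st.relOp.liftQ (TensorProduct.lift F) (Submodule.span_le.2 (by
    rintro _ ⟨b, X, Y, rfl⟩; simp [h])), fun X Y => TensorProduct.lift.tmul X Y⟩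

theorem exists_descA (F : L →ₗ[k] L →ₗ[k] Q)
    (h : ∀ b X Y, F (st.s b * X) Y = F X (Y * st.s b)) :
    ∃ G : st.TA →ₗ[k] Q, ∀ X Y, G (st.mkA X Y) = F X Y :=
  ⟨st.relA.liftQ (TensorProduct.lift F) (Submodule.span_le.2 (by
    rintro _ ⟨b, X, Y, rfl⟩; simp [h])), fun X Y => TensorProduct.lift.tmul X Y⟩

theorem lift2_mk2 (F : L →ₗ[k] L →ₗ[k] Q)
    (h : ∀ b X Y, F (st.t b * X) Y = F X (st.s b * Y)) (X Y : L) :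
    st.lift2 (fun x y => F x y) (st.mk2L X Y) = F X Y := by
  obtain ⟨G, hG⟩ := st.exists_desc2 F h
  rw [lift2, qtlift_eq G hG]
  exact hG X Y

theorem liftOp_mkOp (F : L →ₗ[k] L →ₗ[k] Q)
    (h : ∀ b X Y, F (X * st.t b) Y = F X (st.t b * Y)) (X Y : L) :
    st.liftOp (fun x y => F x y) (st.mkOpL X Y) = F X Y := by
  obtain ⟨G, hG⟩ := st.exists_descOp F h
  rw [liftOp, qtlift_eq G hG]
  exact hG X Y

theorem liftA_mkA (F : L →ₗ[k] L →ₗ[k] Q)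
    (h : ∀ b X Y, F (st.s b * X) Y = F X (Y * st.s b)) (X Y : L) :
    st.liftA (fun x y => F x y) (st.mkAL X Y) = F X Y := by
  obtain ⟨G, hG⟩ := st.exists_descA F h
  rw [liftA, qtlift_eq G hG]
  exact hG X Y

theorem ext2 {F G : st.T2 →ₗ[k] Q} (h : ∀ X Y, F (st.mk2L X Y) = G (st.mk2L X Y)) : F = G :=
  Submodule.linearMap_qext _ (TensorProduct.ext' h)

theorem extOp {F G : st.TOp →ₗ[k] Q} (h : ∀ X Y, F (st.mkOpL X Y) = G (st.mkOpL X Y)) : F = G :=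
  Submodule.linearMap_qext _ (TensorProduct.ext' h)

theorem extA {F G : st.TA →ₗ[k] Q} (h : ∀ X Y, F (st.mkAL X Y) = G (st.mkAL X Y)) : F = G :=
  Submodule.linearMap_qext _ (TensorProduct.ext' h)

end BgdST

/-! ## Action bialgebroids -/

/-- The structure of the action bialgebroid `B # H^op`, with `s b * j h` standing for `b # h`. -/
structure IsActionBgd {k : Type*} [Field k] {B L H : Type*} [Ring B] [Algebra k B] [Ring L]
    [Algebra k L] [Ring H] [HopfAlgebra k H] (st : BgdST k B L) (cop : L →ₗ[k] st.T2)
    (act : B →ₗ[k] H →ₗ[k] B) (j : H →ₗ[k] L) (ψ : L ≃ₗ[k] B ⊗[k] H) : Prop where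
  psi : ∀ b h, ψ (st.s b * j h) = b ⊗ₜ[k] h
  j_one : j 1 = 1
  j_mul : ∀ g h, j h * j g = j (g * h)
  j_s : ∀ {N : Type} [Fintype N] [DecidableEq N] {x : Matrix N N H}, IsComat k x → ∀ i l b,
    j (x i l) * st.s b = ∑ e, st.s (act b (x i e)) * j (x e l)
  j_t : ∀ {N : Type} [Fintype N] [DecidableEq N] {x : Matrix N N H}, IsComat k x → ∀ i l b,
    j (x i l) * st.t b = ∑ e, st.t (act b (x e l)) * j (x i e)
  act_one : ∀ b, act b 1 = b
  act_mul : ∀ b g h, act (act b g) h = act b (g * h)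
  cop_apply : ∀ {N : Type} [Fintype N] [DecidableEq N] {x : Matrix N N H}, IsComat k x →
    ∀ i l b, cop (st.s b * j (x i l)) = ∑ e, st.mk2L (st.s b * j (x i e)) (j (x e l))
  span_comod : Submodule.span k {b | ∃ (N : Type) (_ : Fintype N) (_ : DecidableEq N)
    (β : N → B) (C : Matrix N N H) (p : N), IsComat k C ∧
    (∀ q, st.t (β q) = ∑ r, st.s (β r) * j (C r q)) ∧ b = β p} = ⊤

namespace IsActionBgd

variable {k : Type*} [Field k] {B L H : Type*} [Ring B] [Algebra k B] [Ring L] [Algebra k L]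
  [Ring H] [HopfAlgebra k H] {st : BgdST k B L} {cop : L →ₗ[k] st.T2} {act : B →ₗ[k] H →ₗ[k] B}
  {j : H →ₗ[k] L} {ψ : L ≃ₗ[k] B ⊗[k] H} (A : IsActionBgd st cop act j ψ)
  {M : Type*} [AddCommGroup M] [Module k M]
  {N : Type} [Fintype N] [DecidableEq N] {x : Matrix N N H}

include A

theorem ind {F G : L →ₗ[k] M} (h : ∀ (n : ℕ) (x : Matrix (Fin n) (Fin n) H), IsComat k x →
    ∀ i l b, F (st.s b * j (x i l)) = G (st.s b * j (x i l))) (X : L) : F X = G X := by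
  have h1 : F ∘ₗ ψ.symm.toLinearMap = G ∘ₗ ψ.symm.toLinearMap := by
    refine TensorProduct.ext' fun b h' => ?_
    simp only [LinearMap.comp_apply, LinearEquiv.coe_coe, ← A.psi, LinearEquiv.symm_apply_apply]
    exact comat_induction (F := F ∘ₗ LinearMap.mulLeft k (st.s b) ∘ₗ j)
      (G := G ∘ₗ LinearMap.mulLeft k (st.s b) ∘ₗ j) (fun n x hx i l => h n x hx i l b) h'
  simpa using LinearMap.congr_fun h1 (ψ X)

theorem ind_base {F G : B →ₗ[k] M} (h : ∀ (N : Type) [Fintype N] [DecidableEq N] (β : N → B)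
    (C : Matrix N N H) (p : N), IsComat k C →
    (∀ q, st.t (β q) = ∑ r, st.s (β r) * j (C r q)) → F (β p) = G (β p)) (b : B) : F b = G b := by
  have : F = G := LinearMap.ext_on A.span_comod (by
    rintro _ ⟨N, _, _, β, C, p, hC, ht, rfl⟩
    exact h N β C p hC ht)
  rw [this]

end IsActionBgd

section Splitting

variable {k : Type*} [Field k] {B L H : Type*} [Ring B] [Algebra k B] [Ring L] [Algebra k L]
  [Ring H] [HopfAlgebra k H]  {Q : Type*} [AddCommGroup Q] [Module k Q]

/-- The map `b # h ↦ E (P b h₁) h₂`. -/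
def splitMap {k : Type*} [Field k] {B L H : Type*} [AddCommGroup B] [Module k B]
    [AddCommGroup L] [Module k L] [Ring H] [HopfAlgebra k H] {Q : Type*} [AddCommGroup Q]
    [Module k Q] {V : Type*} [AddCommGroup V] [Module k V] (ψ : L ≃ₗ[k] B ⊗[k] H)
    (P : B →ₗ[k] H →ₗ[k] V) (E : V →ₗ[k] H →ₗ[k] Q) : L →ₗ[k] Q :=
  TensorProduct.lift E ∘ₗ TensorProduct.map (TensorProduct.lift P) LinearMap.id ∘ₗ
    (TensorProduct.assoc k B H H).symm.toLinearMap ∘ₗ LinearMap.lTensor B Coalgebra.comul ∘ₗ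
    ψ.toLinearMap

/-- `X ⊗ h ↦ (Y ↦ m X (f h * Y))`. -/
def mulRightLeg (m : L →ₗ[k] L →ₗ[k] Q) (f : H →ₗ[k] L) : L →ₗ[k] H →ₗ[k] L →ₗ[k] Q :=
  LinearMap.mk₂ k (fun X h => m X ∘ₗ LinearMap.mulLeft k (f h))
    (fun _ _ _ => by ext; simp) (fun _ _ _ => by ext; simp)
    (fun _ _ _ => by ext; simp [add_mul]) (fun _ _ _ => by ext; simp)

/-- `X ⊗ h ↦ (Y ↦ m (X * Y) (f h))`. -/
def mulLeftLeg (m : L →ₗ[k] L →ₗ[k] Q) (f : H →ₗ[k] L) : L →ₗ[k] H →ₗ[k] L →ₗ[k] Q :=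
  LinearMap.mk₂ k (fun X h => m.flip (f h) ∘ₗ LinearMap.mulLeft k X)
    (fun _ _ _ => by ext; simp [add_mul]) (fun _ _ _ => by ext; simp)
    (fun _ _ _ => by ext; simp) (fun _ _ _ => by ext; simp)

@[simp] theorem mulRightLeg_apply (m : L →ₗ[k] L →ₗ[k] Q) (f : H →ₗ[k] L) (X h Y) :
    mulRightLeg m f X h Y = m X (f h * Y) := rfl

@[simp] theorem mulLeftLeg_apply (m : L →ₗ[k] L →ₗ[k] Q) (f : H →ₗ[k] L) (X h Y) :
    mulLeftLeg m f X h Y = m (X * Y) (f h) := rfl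

/-- `b ⊗ h ↦ s b * j h`. -/
def smashL (s : B →ₗ[k] L) (j : H →ₗ[k] L) : B →ₗ[k] H →ₗ[k] L :=
  (LinearMap.mul k L).compl₁₂ s j

@[simp] theorem smashL_apply (s : B →ₗ[k] L) (j : H →ₗ[k] L) (b h) : smashL s j b h = s b * j h :=
  rfl

/-- `b ⊗ h ↦ j h * s b`. -/
def smashR (s : B →ₗ[k] L) (j : H →ₗ[k] L) : B →ₗ[k] H →ₗ[k] L :=
  ((LinearMap.mul k L).compl₁₂ j s).flip

@[simp] theorem smashR_apply (s : B →ₗ[k] L) (j : H →ₗ[k] L) (b h) : smashR s j b h = j h * s b :=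
  rfl

end Splitting

namespace IsActionBgd

variable {k : Type*} [Field k] {B L H : Type*} [Ring B] [Algebra k B] [Ring L] [Algebra k L]
  [Ring H] [HopfAlgebra k H] {st : BgdST k B L} {cop : L →ₗ[k] st.T2} {act : B →ₗ[k] H →ₗ[k] B}
  {j : H →ₗ[k] L} {ψ : L ≃ₗ[k] B ⊗[k] H} (A : IsActionBgd st cop act j ψ)
  {Q : Type*} [AddCommGroup Q] [Module k Q]
  {N : Type} [Fintype N] [DecidableEq N] {x : Matrix N N H}

include A

theorem splitMap_comat (P : B →ₗ[k] H →ₗ[k] L) (E : L →ₗ[k] H →ₗ[k] Q) (hx : IsComat k x)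
    (b : B) (i l : N) : splitMap ψ P E (st.s b * j (x i l)) = ∑ e, E (P b (x i e)) (x e l) := by
  simp [splitMap, A.psi, hx.comul, tmul_sum]

theorem splitMap_comat_mul (P : B →ₗ[k] H →ₗ[k] L) (E : L →ₗ[k] H →ₗ[k] Q) (hx : IsComat k x)
    {N' : Type} [Fintype N'] [DecidableEq N'] {C : Matrix N' N' H} (hC : IsComat k C)
    (b : B) (i l : N) (q p : N') : splitMap ψ P E (st.s b * j (x i l * C q p)) =
      ∑ e, ∑ r, E (P b (x i e * C q r)) (x e l * C r p) := by
  simp [splitMap, A.psi, hx.comul, hC.comul, tmul_sum, Bialgebra.comul_mul, Finset.sum_mul_sum]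

end IsActionBgd

namespace BgdST

variable {k : Type*} [Field k] {B L H : Type*} [Ring B] [Algebra k B] [Ring L] [Algebra k L]
  [Ring H] [HopfAlgebra k H] (st : BgdST k B L) (j : H →ₗ[k] L) (ψ : L ≃ₗ[k] B ⊗[k] H)

theorem lift2_mulRight (X Y Z : L) :
    st.lift2 (fun x y => st.mk2 x (y * Z)) (st.mk2L X Y) = st.mk2L X (Y * Z) :=
  st.lift2_mk2 (st.mk2L.compl₂ (LinearMap.mulRight k Z))
    (fun b X X' => by simp [st.mk2L_t, mul_assoc]) X Y

theorem lift2_mulLeft (X Y Z : L) :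
    st.lift2 (fun x y => st.mk2 (x * Z) y) (st.mk2L X Y) = st.mk2L (X * Z) Y :=
  st.lift2_mk2 (st.mk2L ∘ₗ LinearMap.mulRight k Z)
    (fun b X X' => by simp [st.mk2L_t, mul_assoc]) X Y

/-- The map `X ⊗ Y ↦ X₁ ⊗ X₂ Y` of the action bialgebroid. -/
def lamBil : L →ₗ[k] L →ₗ[k] st.T2 :=
  splitMap ψ (smashL st.s.toLinearMap j) (mulRightLeg st.mk2L j)

/-- The map `(b # h) ⊗ Y ↦ (b # h₁) ⊗ (1 # T h₂) Y`. -/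
def lamInvBil (T : H →ₗ[k] H) : L →ₗ[k] L →ₗ[k] st.TOp :=
  splitMap ψ (smashL st.s.toLinearMap j) (mulRightLeg st.mkOpL (j ∘ₗ T))

/-- The map `Y ⊗ X ↦ Y₁ X ⊗ Y₂` of the action bialgebroid. -/
def muBil : L →ₗ[k] L →ₗ[k] st.T2 :=
  splitMap ψ (smashL st.s.toLinearMap j) (mulLeftLeg st.mk2L j)

/-- The map `(b # h) ⊗ X ↦ (1 # S h₁) t b X ⊗ (1 # h₂)`. -/
def muInvBil : L →ₗ[k] L →ₗ[k] st.TA :=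
  splitMap ψ (smashR st.t (j ∘ₗ HopfAlgebra.antipode k)) (mulLeftLeg st.mkAL j)

end BgdST

namespace IsActionBgd

variable {k : Type*} [Field k] {B L H : Type*} [Ring B] [Algebra k B] [Ring L] [Algebra k L]
  [Ring H] [HopfAlgebra k H] {st : BgdST k B L} {cop : L →ₗ[k] st.T2} {act : B →ₗ[k] H →ₗ[k] B}
  {j : H →ₗ[k] L} {ψ : L ≃ₗ[k] B ⊗[k] H} (A : IsActionBgd st cop act j ψ)
  {N : Type} [Fintype N] [DecidableEq N] {x : Matrix N N H}

include A

/-! ### The canonical map `λ` -/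

theorem lamBil_comat (hx : IsComat k x) (b : B) (i l : N) (Y : L) :
    st.lamBil j ψ (st.s b * j (x i l)) Y =
      ∑ e, st.mk2L (st.s b * j (x i e)) (j (x e l) * Y) := by
  simp [BgdST.lamBil, A.splitMap_comat _ _ hx, LinearMap.sum_apply]

theorem lamInvBil_comat (T : H →ₗ[k] H) (hx : IsComat k x) (b : B) (i l : N) (Y : L) :
    st.lamInvBil j ψ T (st.s b * j (x i l)) Y =
      ∑ e, st.mkOpL (st.s b * j (x i e)) (j (T (x e l)) * Y) := by
  simp [BgdST.lamInvBil, A.splitMap_comat _ _ hx, LinearMap.sum_apply]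

theorem lift2_cop_mulRight (X Y : L) :
    st.lift2 (fun x1 x2 => st.mk2 x1 (x2 * Y)) (cop X) = st.lamBil j ψ X Y :=
  A.ind (F := st.lift2 (fun x1 x2 => st.mk2 x1 (x2 * Y)) ∘ₗ cop) (G := (st.lamBil j ψ).flip Y)
    (fun n x hx i l b => by
      simp [A.cop_apply hx, A.lamBil_comat hx, st.lift2_mulRight]) X

/-- `t(b) (a # h)` in terms of a finite comodule containing `b`. -/
theorem t_mul_smash {N' : Type} [Fintype N'] [DecidableEq N'] {β : N' → B} {C : Matrix N' N' H}
    (ht : ∀ q, st.t (β q) = ∑ r, st.s (β r) * j (C r q)) (a : B) (h : H) (p : N') :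
    st.t (β p) * (st.s a * j h) = ∑ q, st.s (a * β q) * j (h * C q p) := by
  rw [← mul_assoc, ← st.st_comm, ht]
  simp [Finset.mul_sum, Finset.sum_mul, mul_assoc, A.j_mul]

theorem lamBil_t_mul (hx : IsComat k x) (c b : B) (i l : N) (Y : L) :
    st.lamBil j ψ (st.t c * (st.s b * j (x i l))) Y =
      ∑ e, st.mk2L (st.s b * j (x i e)) (st.t c * (j (x e l) * Y)) := by
  refine A.ind_base (F := (st.lamBil j ψ).flip Y ∘ₗ LinearMap.mulRight k (st.s b * j (x i l)) ∘ₗ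
      st.t) (G := ∑ e, st.mk2L (st.s b * j (x i e)) ∘ₗ
        LinearMap.mulRight k (j (x e l) * Y) ∘ₗ st.t) (fun N' _ _ β C p hC ht => ?_) c |>.trans ?_
  · simp only [LinearMap.comp_apply, LinearMap.mulRight_apply, LinearMap.flip_apply,
      A.t_mul_smash ht, LinearMap.sum_apply, map_sum]
    simp only [BgdST.lamBil, A.splitMap_comat_mul _ _ hx hC, LinearMap.sum_apply,
      mulRightLeg_apply, smashL_apply, AlgHom.toLinearMap_apply]
    rw [sum_rot]
    refine Finset.sum_congr rfl fun e _ => ?_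
    rw [ht p]
    simp only [Finset.sum_mul, map_sum, mul_assoc (st.s _), ← st.mk2L_t, A.t_mul_smash ht,
      LinearMap.sum_apply]
    refine Finset.sum_congr rfl fun r _ => Finset.sum_congr rfl fun q _ => ?_
    rw [← mul_assoc (j _), A.j_mul]
  · simp [LinearMap.sum_apply, mul_assoc]

theorem lamBil_balanced (c : B) (X Y : L) :
    st.lamBil j ψ (X * st.t c) Y = st.lamBil j ψ X (st.t c * Y) := by
  refine A.ind (F := (st.lamBil j ψ).flip Y ∘ₗ LinearMap.mulRight k (st.t c))
    (G := (st.lamBil j ψ).flip (st.t c * Y)) (fun n x hx i l b => ?_) X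
  simp only [LinearMap.comp_apply, LinearMap.mulRight_apply, LinearMap.flip_apply,
    A.lamBil_comat hx, mul_assoc, A.j_t hx, Finset.mul_sum, map_sum]
  have : ∀ e, st.s b * (st.t (act c (x e l)) * j (x i e)) =
      st.t (act c (x e l)) * (st.s b * j (x i e)) := fun e => by
    rw [← mul_assoc, st.st_comm, mul_assoc]
  simp only [this, A.lamBil_t_mul hx]
  rw [Finset.sum_comm]
  refine Finset.sum_congr rfl fun e _ => ?_
  rw [← mul_assoc, A.j_t hx, Finset.sum_mul, map_sum]
  simp [mul_assoc]

theorem lam_mkOp (X Y : L) : st.lam cop (st.mkOpL X Y) = st.lamBil j ψ X Y := by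
  have h1 : (fun X Y => st.lift2 (fun x1 x2 => st.mk2 x1 (x2 * Y)) (cop X)) =
      fun X Y => st.lamBil j ψ X Y := by
    funext X Y
    exact A.lift2_cop_mulRight X Y
  rw [BgdST.lam, h1, st.liftOp_mkOp _ A.lamBil_balanced]

section Inverse

variable {T : H →ₗ[k] H} (hTS : ∀ a, T (HopfAlgebra.antipode k a) = a)
  (hST : ∀ a, HopfAlgebra.antipode k (T a) = a)

include hTS hST

theorem t_mul_j (hx : IsComat k x) (c : B) (i l : N) :
    st.t c * j (x i l) = ∑ f, j (x i f) * st.t (act c (T (x f l))) := by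
  simp only [A.j_t hx, A.act_mul]
  rw [Finset.sum_comm]
  simp only [← Finset.sum_mul, ← map_sum, hx.sum_invAntipode_mul hTS hST]
  rw [Finset.sum_eq_single l (fun b _ hb => by simp [hb]) (by simp)]
  simp [A.act_one]

/-- The source map expressed through the target map of a finite comodule. -/
theorem s_eq_sum_t {N' : Type} [Fintype N'] [DecidableEq N'] {β : N' → B} {C : Matrix N' N' H}
    (hC : IsComat k C) (ht : ∀ q, st.t (β q) = ∑ r, st.s (β r) * j (C r q)) (p : N') :
    st.s (β p) = ∑ d, st.t (β d) * j (T (C d p)) := by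
  simp only [ht, Finset.sum_mul, mul_assoc, A.j_mul]
  rw [Finset.sum_comm]
  simp only [← Finset.mul_sum, ← map_sum, hC.sum_invAntipode_mul hTS hST]
  rw [Finset.sum_eq_single p (fun b _ hb => by simp [hb]) (by simp)]
  simp [A.j_one]

theorem lamInvBil_balanced (c : B) (X Y : L) :
    st.lamInvBil j ψ T (st.t c * X) Y = st.lamInvBil j ψ T X (st.s c * Y) := by
  refine A.ind (F := (st.lamInvBil j ψ T).flip Y ∘ₗ LinearMap.mulLeft k (st.t c))
    (G := (st.lamInvBil j ψ T).flip (st.s c * Y)) (fun n x hx i l b => ?_) X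
  refine A.ind_base (F := (st.lamInvBil j ψ T).flip Y ∘ₗ
      LinearMap.mulRight k (st.s b * j (x i l)) ∘ₗ st.t)
    (G := st.lamInvBil j ψ T (st.s b * j (x i l)) ∘ₗ LinearMap.mulRight k Y ∘ₗ
      st.s.toLinearMap) (fun N' _ _ β C p hC ht => ?_) c
  simp only [LinearMap.comp_apply, LinearMap.mulRight_apply, LinearMap.flip_apply,
      A.t_mul_smash ht, map_sum, AlgHom.toLinearMap_apply,
      A.lamInvBil_comat T hx]
  simp only [BgdST.lamInvBil, A.splitMap_comat_mul _ _ hx hC, LinearMap.sum_apply,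
      mulRightLeg_apply, smashL_apply, AlgHom.toLinearMap_apply, LinearMap.comp_apply,
      invAntipode_mul hTS hST]
  have h1 : ∀ e d Z, ∑ q, st.mkOpL (st.s (b * β q) * j (x i e * C q d)) Z =
      ∑ f, st.mkOpL (st.s b * j (x i f)) (st.t (act (β d) (T (x f e))) * Z) := fun e d Z => by
    rw [← LinearMap.sum_apply, ← map_sum, ← A.t_mul_smash ht, ← mul_assoc, ← st.st_comm, mul_assoc,
      A.t_mul_j hTS hST hx, Finset.mul_sum]
    simp only [← mul_assoc, map_sum, LinearMap.sum_apply, st.mkOpL_t]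
  have h2 := fun f => A.j_t (hx.transpose_invAntipode hTS hST) l f
  simp only [Matrix.transpose_apply, Matrix.map_apply] at h2
  rw [sum_rot]
  simp only [h1]
  simp only [← A.j_mul (T _)]
  rw [sum_rot, sum_rot]
  refine Finset.sum_congr rfl fun f _ => ?_
  rw [A.s_eq_sum_t hTS hST hC ht p, Finset.sum_mul, Finset.mul_sum, map_sum, Finset.sum_comm]
  refine Finset.sum_congr rfl fun d _ => ?_
  simp only [← mul_assoc, h2, Finset.sum_mul, map_sum]

theorem lam_bijective : Function.Bijective (st.lam cop) := by
  obtain ⟨G, hG⟩ := st.exists_desc2 (st.lamInvBil j ψ T) (A.lamInvBil_balanced hTS hST)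
  have h1 : G ∘ₗ st.lam cop = LinearMap.id := by
    refine st.extOp fun X Y => ?_
    rw [LinearMap.comp_apply, A.lam_mkOp]
    refine A.ind (F := G ∘ₗ (st.lamBil j ψ).flip Y) (G := st.mkOpL.flip Y)
      (fun n x hx i l b => ?_) X
    simp only [LinearMap.comp_apply, LinearMap.flip_apply, A.lamBil_comat hx, map_sum]
    simp only [st.mk2L_apply, hG, A.lamInvBil_comat T hx, ← mul_assoc, A.j_mul]
    rw [Finset.sum_comm]
    simp only [← map_sum, ← Finset.sum_mul, hx.sum_mul_invAntipode hTS hST]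
    rw [Finset.sum_eq_single l (fun b _ hb => by simp [hb]) (by simp)]
    simp [A.j_one]
  have h2 : st.lam cop ∘ₗ G = LinearMap.id := by
    refine st.ext2 fun X Y => ?_
    rw [LinearMap.comp_apply, st.mk2L_apply, hG]
    refine A.ind (F := st.lam cop ∘ₗ (st.lamInvBil j ψ T).flip Y) (G := st.mk2L.flip Y)
      (fun n x hx i l b => ?_) X
    simp only [LinearMap.comp_apply, LinearMap.flip_apply, A.lamInvBil_comat T hx, map_sum,
      A.lam_mkOp, A.lamBil_comat hx, ← mul_assoc, A.j_mul]
    rw [Finset.sum_comm]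
    simp only [← map_sum, ← Finset.sum_mul, hx.sum_invAntipode_mul hTS hST]
    rw [Finset.sum_eq_single l (fun b _ hb => by simp [hb]) (by simp)]
    simp [A.j_one]
  exact Function.bijective_iff_has_inverse.2 ⟨G, LinearMap.congr_fun h1, LinearMap.congr_fun h2⟩

end Inverse

/-! ### The canonical map `μ` -/

theorem muBil_comat (hx : IsComat k x) (b : B) (i l : N) (X : L) :
    st.muBil j ψ (st.s b * j (x i l)) X =
      ∑ e, st.mk2L (st.s b * j (x i e) * X) (j (x e l)) := by
  simp [BgdST.muBil, A.splitMap_comat _ _ hx, LinearMap.sum_apply]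

theorem muInvBil_comat (hx : IsComat k x) (b : B) (i l : N) (X : L) :
    st.muInvBil j ψ (st.s b * j (x i l)) X =
      ∑ e, st.mkAL (j (HopfAlgebra.antipode k (x i e)) * st.t b * X) (j (x e l)) := by
  simp [BgdST.muInvBil, A.splitMap_comat _ _ hx, LinearMap.sum_apply]

theorem lift2_cop_mulLeft (X Y : L) :
    st.lift2 (fun y1 y2 => st.mk2 (y1 * X) y2) (cop Y) = st.muBil j ψ Y X :=
  A.ind (F := st.lift2 (fun y1 y2 => st.mk2 (y1 * X) y2) ∘ₗ cop) (G := (st.muBil j ψ).flip X)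
    (fun n x hx i l b => by
      simp [A.cop_apply hx, A.muBil_comat hx, st.lift2_mulLeft]) Y

theorem muBil_balanced (c : B) (X Y : L) :
    st.muBil j ψ Y (st.s c * X) = st.muBil j ψ (Y * st.s c) X := by
  refine A.ind (F := (st.muBil j ψ).flip (st.s c * X))
    (G := (st.muBil j ψ).flip X ∘ₗ LinearMap.mulRight k (st.s c)) (fun n x hx i l b => ?_) Y
  have h1 : ∀ i l, st.s b * j (x i l) * st.s c =
      ∑ e, st.s (b * act c (x i e)) * j (x e l) := fun i l => by
    rw [mul_assoc, A.j_s hx, Finset.mul_sum]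
    simp [mul_assoc]
  simp only [LinearMap.comp_apply, LinearMap.mulRight_apply, LinearMap.flip_apply, h1, map_sum,
    A.muBil_comat hx, ← mul_assoc]
  simp only [Finset.sum_mul, map_sum, LinearMap.sum_apply]
  rw [Finset.sum_comm]

theorem mu_mkA (X Y : L) : st.mu cop (st.mkAL X Y) = st.muBil j ψ Y X := by
  have h1 : (fun X Y => st.lift2 (fun y1 y2 => st.mk2 (y1 * X) y2) (cop Y)) =
      fun X Y => (st.muBil j ψ).flip X Y := by
    funext X Y
    exact A.lift2_cop_mulLeft X Y
  rw [BgdST.mu, h1, st.liftA_mkA _ A.muBil_balanced]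
  rfl

theorem muInvBil_balanced (c : B) (X Y : L) :
    st.muInvBil j ψ Y (st.t c * X) = st.muInvBil j ψ (st.s c * Y) X := by
  refine A.ind (F := (st.muInvBil j ψ).flip (st.t c * X))
    (G := (st.muInvBil j ψ).flip X ∘ₗ LinearMap.mulLeft k (st.s c)) (fun n x hx i l b => ?_) Y
  simp only [LinearMap.comp_apply, LinearMap.mulLeft_apply, LinearMap.flip_apply, ← mul_assoc,
    ← map_mul, A.muInvBil_comat hx]
  simp [st.t_mul, mul_assoc]

theorem mu_bijective : Function.Bijective (st.mu cop) := by
  obtain ⟨G, hG⟩ := st.exists_desc2 (st.muInvBil j ψ).flip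
    (fun c X Y => A.muInvBil_balanced c X Y)
  have h1 : G ∘ₗ st.mu cop = LinearMap.id := by
    refine st.extA fun X Y => ?_
    rw [LinearMap.comp_apply, A.mu_mkA]
    refine A.ind (F := G ∘ₗ (st.muBil j ψ).flip X) (G := st.mkAL X)
      (fun n x hx i l b => ?_) Y
    have h3 := fun e l X => A.muInvBil_comat hx 1 e l X
    simp only [map_one, one_mul, st.t_one, mul_one] at h3
    simp only [LinearMap.comp_apply, LinearMap.flip_apply, A.muBil_comat hx, map_sum]
    simp only [st.mk2L_apply, hG, LinearMap.flip_apply, h3]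
    have h4 : ∀ f, ∑ e, j (HopfAlgebra.antipode k (x e f)) * (st.s b * j (x i e) * X) =
        st.s (act b (HopfAlgebra.antipode k (x i f))) * X := fun f => by
      have h5 := fun e => A.j_s hx.transpose_apm f e b
      simp only [Matrix.transpose_apply, apm_apply] at h5
      simp only [← mul_assoc, h5, Finset.sum_mul]
      simp only [mul_assoc (st.s _), A.j_mul]
      rw [Finset.sum_comm]
      have h6 := fun d => congrFun (congrFun (self_mul_apm hx) i) d
      simp only [Matrix.mul_apply, apm_apply] at h6
      simp only [← Finset.mul_sum, ← Finset.sum_mul, ← map_sum, h6]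
      rw [Finset.sum_eq_single i (fun b _ hb => by simp [Ne.symm hb]) (by simp)]
      simp [A.j_one]
    rw [Finset.sum_comm]
    simp only [← LinearMap.sum_apply, ← map_sum, h4]
    simp only [st.mkAL_s, ← map_sum]
    congr 1
    simp only [A.j_s hx, A.act_mul]
    rw [Finset.sum_comm]
    have h6 := fun d => congrFun (congrFun (apm_mul_self hx) i) d
    simp only [Matrix.mul_apply, apm_apply] at h6
    simp only [← Finset.sum_mul, ← map_sum, h6]
    rw [Finset.sum_eq_single i (fun b _ hb => by simp [Ne.symm hb]) (by simp)]
    simp [A.act_one]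
  have h2 : st.mu cop ∘ₗ G = LinearMap.id := by
    refine st.ext2 fun X Y => ?_
    rw [LinearMap.comp_apply, st.mk2L_apply, hG]
    refine A.ind (F := st.mu cop ∘ₗ (st.muInvBil j ψ).flip X) (G := st.mk2L X)
      (fun n x hx i l b => ?_) Y
    have h3 := fun e l X => A.muBil_comat hx 1 e l X
    simp only [map_one, one_mul] at h3
    simp only [LinearMap.comp_apply, LinearMap.flip_apply, A.muInvBil_comat hx, map_sum,
      A.mu_mkA, h3, ← mul_assoc, A.j_mul]
    rw [Finset.sum_comm]
    have h4 := fun e d => congrFun (congrFun (apm_mul_self hx) e) d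
    simp only [Matrix.mul_apply, apm_apply] at h4
    simp only [← LinearMap.sum_apply, ← map_sum, ← Finset.sum_mul, h4]
    rw [Finset.sum_eq_single i (fun b _ hb => by simp [Ne.symm hb]) (by simp)]
    simp [A.j_one, st.mk2L_t]
  exact Function.bijective_iff_has_inverse.2 ⟨G, LinearMap.congr_fun h1, LinearMap.congr_fun h2⟩

end IsActionBgd

section Smash

universe u v
variable {k : Type u} [Field k] {H : Type v} [Ring H] [HopfAlgebra k H]
  {B : Type v} [Ring B] [Algebra k B]

theorem splitMap_refl_tmul {V Q : Type*} [AddCommGroup V] [Module k V] [AddCommGroup Q]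
    [Module k Q] (P : B →ₗ[k] H →ₗ[k] V) (E : V →ₗ[k] H →ₗ[k] Q) (a : B) (h : H) :
    splitMap (LinearEquiv.refl k (B ⊗[k] H)) P E (a ⊗ₜ h) =
      tlift k (fun h1 h2 => E (P a h1) h2) (Coalgebra.comul (R := k) h) := by
  rw [tlift_eq (f := fun h1 h2 => E (P a h1) h2) (TensorProduct.lift E ∘ₗ
    TensorProduct.map (TensorProduct.lift P) LinearMap.id ∘ₗ
    (TensorProduct.assoc k B H H).symm.toLinearMap ∘ₗ TensorProduct.mk k B (H ⊗[k] H) a)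
    (fun x y => rfl)]
  rfl

theorem splitMap_refl_comat {V Q : Type*} [AddCommGroup V] [Module k V] [AddCommGroup Q]
    [Module k Q] (P : B →ₗ[k] H →ₗ[k] V) (E : V →ₗ[k] H →ₗ[k] Q) {N : Type} [Fintype N]
    [DecidableEq N] {x : Matrix N N H} (hx : IsComat k x) (a : B) (i l : N) :
    splitMap (LinearEquiv.refl k (B ⊗[k] H)) P E (a ⊗ₜ x i l) =
      ∑ e, E (P a (x i e)) (x e l) := by
  rw [splitMap_refl_tmul]
  exact hx.tlift (f := fun h1 h2 => E (P a h1) h2)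
    (IsBil.of (by simp) (by simp) (by simp) (by simp)) i l

theorem smashMul_comat (act : B →ₗ[k] H →ₗ[k] B) {N : Type} [Fintype N] [DecidableEq N]
    {x : Matrix N N H} (hx : IsComat k x) (a : B) (i l : N) (b : B) (g : H) :
    smashMul (k := k) (fun b h => act b h) (a ⊗ₜ x i l) (b ⊗ₜ g) =
      ∑ e, (a * act b (x i e)) ⊗ₜ[k] (g * x e l) := by
  let P : B →ₗ[k] H →ₗ[k] (B →ₗ[k] B) := LinearMap.mk₂ k
    (fun a h => LinearMap.mulLeft k a ∘ₗ act.flip h)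
    (by intros; ext; simp [add_mul]) (by intros; ext; simp)
    (by intros; ext; simp [mul_add]) (by intros; ext; simp)
  let E : (B →ₗ[k] B) →ₗ[k] H →ₗ[k] (B ⊗[k] H →ₗ[k] B ⊗[k] H) :=
    (TensorProduct.mapBilinear (RingHom.id k) B H B H).compl₂ (LinearMap.mul k H).flip
  let S := splitMap (LinearEquiv.refl k (B ⊗[k] H)) P E
  have hS : ∀ a h b g, S (a ⊗ₜ h) (b ⊗ₜ g) =
      tlift k (fun h1 h2 => (a * act b h1) ⊗ₜ[k] (g * h2)) (Coalgebra.comul (R := k) h) := by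
    intro a h b g
    refine comat_induction (F := LinearMap.applyₗ (b ⊗ₜ[k] g) ∘ₗ S ∘ₗ TensorProduct.mk k B H a)
      (G := tlift k (fun h1 h2 => (a * act b h1) ⊗ₜ[k] (g * h2)) ∘ₗ Coalgebra.comul)
      (fun n x hx i j => ?_) h
    have hf : IsBil k fun h1 h2 => (a * act b h1) ⊗ₜ[k] (g * h2) :=
      IsBil.of (by simp [mul_add, TensorProduct.add_tmul]) (by simp [TensorProduct.smul_tmul'])
        (by simp [mul_add, TensorProduct.tmul_add]) (by simp)
    refine Eq.trans ?_ (hx.tlift hf i j).symm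
    change S (a ⊗ₜ x i j) (b ⊗ₜ g) = _
    simp only [S, splitMap_refl_comat P E hx, LinearMap.sum_apply]
    rfl
  have h2 : ∀ z w, smashMul (k := k) (fun b h => act b h) z w = S z w := by
    intro z w
    rw [smashMul, tlift_eq (S.flip w)]
    · rfl
    · intro a h
      rw [tlift_eq (S (a ⊗ₜ h)) (hS a h)]
      rfl
  rw [h2]
  simp only [S, splitMap_refl_comat P E hx, LinearMap.sum_apply]
  rfl

theorem IsComat.adjoint {N : Type} [Fintype N] [DecidableEq N] {x : Matrix N N H}
    (hx : IsComat k x) : IsComat k (Matrix.of fun p q : N × N =>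
      HopfAlgebra.antipode k (x q.1 p.1) * x p.2 q.2) where
  comul p q := by
    have h := hx.comul_apm q.1 p.1
    simp only [apm_apply] at h
    rw [Matrix.of_apply, Bialgebra.comul_mul, h, hx.comul, Fintype.sum_prod_type]
    simp only [Finset.sum_mul, Finset.mul_sum, Algebra.TensorProduct.tmul_mul_tmul,
      Matrix.of_apply]
    exact Finset.sum_comm
  counit p q := by
    rw [Matrix.of_apply, Bialgebra.counit_mul, HopfAlgebra.counit_antipode, hx.counit, hx.counit]
    simp only [Prod.ext_iff, eq_comm (a := q.1)]
    split_ifs <;> simp_all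

variable {L : Type v} [Ring L] [Algebra k L]

/-- The action of `H` transported along a linear identification with `H̲`. -/
noncomputable def actB (R : H →ₗ[k] H →ₗ[k] k) (e : B ≃ₗ[k] H) : B →ₗ[k] H →ₗ[k] B :=
  ((actL R) ∘ₗ e.toLinearMap).compr₂ e.symm.toLinearMap

theorem actB_apply (R : H →ₗ[k] H →ₗ[k] k) (e : B ≃ₗ[k] H) (b : B) (h : H) :
    actB R e b h = e.symm (actL R (e b) h) := rfl

/-- The inclusion `h ↦ 1 # h`. -/
noncomputable def inclH (ψ : L ≃ₗ[k] B ⊗[k] H) : H →ₗ[k] L :=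
  ψ.symm.toLinearMap ∘ₗ TensorProduct.mk k B H 1

theorem inclH_apply (ψ : L ≃ₗ[k] B ⊗[k] H) (h : H) : inclH ψ h = ψ.symm (1 ⊗ₜ h) := rfl

theorem isActionBgd_transmutation {R : H →ₗ[k] H →ₗ[k] k} (hR : CQ R) (e : B ≃ₗ[k] H)
    (he1 : e 1 = 1) (ψ : L ≃ₗ[k] B ⊗[k] H) (hψ1 : ψ 1 = 1)
    (hψm : ∀ x y, ψ (x * y) = smashMul (fun b h => actB R e b h) (ψ x) (ψ y))
    (st : BgdST k B L) (cop : L →ₗ[k] st.T2)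
    (hs : ∀ b, st.s b = ψ.symm (b ⊗ₜ[k] (1 : H)))
    (ht : ∀ b, st.t b = ψ.symm (TensorProduct.map e.symm.toLinearMap LinearMap.id (adL k (e b))))
    (hcop : ∀ z, cop z = tlift k (fun a h => tlift k (fun h1 h2 => st.mk2 (ψ.symm (a ⊗ₜ[k] h1))
      (ψ.symm ((1 : B) ⊗ₜ[k] h2))) (Coalgebra.comul (R := k) h)) (ψ z)) :
    IsActionBgd st cop (actB R e) (inclH ψ) ψ := by
  have hact1 : ∀ b, actB R e b 1 = b := fun b => by simp [actB_apply, actL_one hR]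
  have hact : ∀ h, actB R e 1 h = (Coalgebra.counit (R := k) h : k) • (1 : B) := fun h => by
    rw [actB_apply, he1, one_actL hR, map_smul, ← he1, e.symm_apply_apply]
  have hmul : ∀ {N : Type} [Fintype N] [DecidableEq N] {x : Matrix N N H}, IsComat k x →
      ∀ a i l b g, ψ.symm (a ⊗ₜ x i l) * ψ.symm (b ⊗ₜ g) =
        ψ.symm (∑ f, (a * actB R e b (x i f)) ⊗ₜ[k] (g * x f l)) := by
    intro N _ _ x hx a i l b g
    apply ψ.injective
    rw [hψm, ψ.apply_symm_apply, ψ.apply_symm_apply, ψ.apply_symm_apply, smashMul_comat _ hx]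
  have hpsi : ∀ b h, st.s b * inclH ψ h = ψ.symm (b ⊗ₜ h) := by
    intro b h
    have := hmul (isComat_one (k := k) (H := H)) b 0 0 1 h
    simp only [Matrix.one_apply_eq, Fin.sum_univ_one, hact1, mul_one] at this
    rw [hs, inclH_apply, this]
  have hjmul : ∀ g h, inclH ψ h * ψ.symm (1 ⊗ₜ g) = inclH ψ (g * h) := by
    intro g h
    refine comat_induction (F := LinearMap.mulRight k (ψ.symm (1 ⊗ₜ g)) ∘ₗ inclH ψ)
      (G := inclH ψ ∘ₗ LinearMap.mulLeft k g) (fun n x hx i j => ?_) h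
    simp [inclH_apply, hmul hx, hact, hx.counit, TensorProduct.ite_tmul]
  refine ⟨fun b h => by rw [hpsi, ψ.apply_symm_apply], ?_, hjmul, ?_, ?_, hact1, ?_, ?_, ?_⟩
  · rw [inclH_apply, ← Algebra.TensorProduct.one_def, ← hψ1, ψ.symm_apply_apply]
  · intro N _ _ x hx i l b
    rw [inclH_apply, hs, hmul hx, map_sum]
    simp [hpsi]
  · intro N _ _ x hx i l b
    let σ : H ⊗[k] H →ₗ[k] L :=
      ψ.symm.toLinearMap ∘ₗ TensorProduct.map e.symm.toLinearMap LinearMap.id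
    have hσ : ∀ c d, σ (c ⊗ₜ d) = ψ.symm (e.symm c ⊗ₜ d) := fun c d => rfl
    have hσt : ∀ b, st.t b = σ (adL k (e b)) := ht
    have hl : ∀ h W, σ (LinearMap.lTensor H (LinearMap.mulLeft k h) W) = σ W * inclH ψ h := by
      intro h W
      induction W using TensorProduct.induction_on with
      | zero => simp
      | add u v hu hv => rw [map_add, map_add, hu, hv, map_add, add_mul]
      | tmul c d =>
        rw [LinearMap.lTensor_tmul, hσ, hσ, LinearMap.mulLeft_apply, ← hpsi, ← hpsi, mul_assoc,
          inclH_apply ψ h, hjmul]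
    have hr : ∀ W, σ (∑ f, TensorProduct.map₂ (actL R) (LinearMap.mul k H) W
        (x i f ⊗ₜ x f l)) = inclH ψ (x i l) * σ W := by
      intro W
      induction W using TensorProduct.induction_on with
      | zero => simp
      | add u v hu hv =>
        simp only [map_add, LinearMap.add_apply, Finset.sum_add_distrib, mul_add, ← hu, ← hv]
      | tmul c d =>
        rw [hσ, inclH_apply, hmul hx, map_sum, map_sum]
        simp [hσ, actB_apply]
    have hin : ∀ h, tlift k (fun c0 c1 => c0 ⊗ₜ[k] (h * c1)) =
        LinearMap.lTensor H (LinearMap.mul k H h) := fun h => tlift_eq _ fun _ _ => rfl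
    have hc := actL_adL_compat hR (e b) (x i l)
    have h2 := tlift_tlift_map₂ (actL R) (LinearMap.mul k H) (adL k (e b))
      (Coalgebra.comul (R := k) (x i l))
    simp only [LinearMap.mul_apply'] at h2
    simp only [h2, hin] at hc
    rw [hx.tlift (f := fun h1 h2 => LinearMap.lTensor H (LinearMap.mul k H h1)
      (adL k (actL R (e b) h2))) (IsBil.of (by simp [LinearMap.lTensor_add])
      (by simp [LinearMap.lTensor_smul]) (by simp) (by simp)), hx.comul, map_sum] at hc
    rw [hσt, ← hr, ← hc, map_sum]
    refine Finset.sum_congr rfl fun f _ => (hl _ _).trans ?_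
    rw [hσt, actB_apply, e.apply_symm_apply]
  · intro b g h
    simp [actB_apply, actL_mul hR]
  · intro N _ _ x hx i l b
    rw [hcop, hpsi, ψ.apply_symm_apply]
    have h2 := splitMap_refl_tmul ((TensorProduct.mk k B H).compr₂ ψ.symm.toLinearMap)
      (st.mk2L.compl₂ (inclH ψ))
    refine (LinearMap.congr_fun (tlift_eq _ h2) (b ⊗ₜ x i l)).trans ?_
    rw [splitMap_refl_comat _ _ hx]
    simp only [hpsi]
    rfl
  · rw [eq_top_iff, ← LinearMap.range_eq_top.2 e.symm.surjective, LinearMap.range_eq_map,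
      ← comat_span, Submodule.map_span]
    refine Submodule.span_mono ?_
    rintro _ ⟨_, ⟨n, x, i, j, hx, rfl⟩, rfl⟩
    refine ⟨Fin n × Fin n, inferInstance, inferInstance, fun p => e.symm (x p.1 p.2), _, (i, j),
      hx.adjoint, fun q => ?_, rfl⟩
    rw [ht, e.apply_symm_apply, adL_comat hx, Fintype.sum_prod_type]
    simp [hpsi]

end Smash

/-- Let `H` be a coquasitriangular Hopf algebra.  Then the transmutation `H̲`
(the vector space `H` with the product `•`), with the right adjoint coaction `Ad_R` and the
action `h ◁ g = h₂ R(g₁⊗h₁) R(h₃⊗g₂)`, is a braided-commutative right-right `H`-crossed module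
algebra; consequently the action bialgebroid `H̲ # H^{op}` is a left and anti-left Hopf
algebroid. -/
theorem transmutation_is_crossed_and_action_Hopf
    {k : Type u} [Field k] {H : Type v} [Ring H] [HopfAlgebra k H]
    (R2 R2i : H → H → k) (hR : IsCQT R2 R2i) :
    -- `H̲` is a unital associative algebra:
    (∃ m' : H →ₗ[k] H →ₗ[k] H, ∀ x y : H, m' x y = bulletTrans R2 x y) ∧
    (∃ act' : H →ₗ[k] H →ₗ[k] H, ∀ (x : H) (h : H), act' x h = actTrans R2 x h) ∧
    (∃ co' : H →ₗ[k] H ⊗[k] H, ∀ x : H, co' x = adRTrans (k := k) x) ∧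
    (∀ x : H, bulletTrans R2 1 x = x ∧ bulletTrans R2 x 1 = x) ∧
    (∀ x y z : H,
      bulletTrans R2 (bulletTrans R2 x y) z = bulletTrans R2 x (bulletTrans R2 y z)) ∧
    -- `H̲` is a right `H`-module algebra:
    (∀ a : H, actTrans R2 a 1 = a) ∧
    (∀ a g h : H, actTrans R2 (actTrans R2 a g) h = actTrans R2 a (g * h)) ∧
    (∀ h : H, actTrans R2 1 h = (Coalgebra.counit (R := k) h : k) • (1 : H)) ∧
    (∀ a b h : H, actTrans R2 (bulletTrans R2 a b) h =
      tlift k (fun h1 h2 => bulletTrans R2 (actTrans R2 a h1) (actTrans R2 b h2))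
        (Coalgebra.comul (R := k) h)) ∧
    -- `H̲` is a right `H`-comodule algebra for `Ad_R`:
    (adRTrans (k := k) (1 : H) = (1 : H) ⊗ₜ[k] (1 : H)) ∧
    (∀ a b : H, adRTrans (k := k) (bulletTrans R2 a b) =
      tlift k (fun a0 a1 => tlift k (fun b0 b1 =>
        bulletTrans R2 a0 b0 ⊗ₜ[k] (a1 * b1)) (adRTrans (k := k) b)) (adRTrans (k := k) a)) ∧
    (∀ a : H,
      tlift k (fun a0 a1 => (a0 ⊗ₜ[k] (Coalgebra.comul (R := k) a1) : H ⊗[k] (H ⊗[k] H)))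
        (adRTrans (k := k) a) =
      tlift k (fun a0 a1 => tlift k (fun c0 c1 => (c0 ⊗ₜ[k] (c1 ⊗ₜ[k] a1) : H ⊗[k] (H ⊗[k] H)))
        (adRTrans (k := k) a0)) (adRTrans (k := k) a)) ∧
    (∀ a : H, tlift k (fun a0 a1 => (Coalgebra.counit (R := k) a1 : k) • a0)
      (adRTrans (k := k) a) = a) ∧
    -- the Drinfeld–Yetter condition:
    (∀ a h : H,
      tlift k (fun h1 h2 => tlift k (fun c0 c1 => c0 ⊗ₜ[k] (h1 * c1))
        (adRTrans (k := k) (actTrans R2 a h2))) (Coalgebra.comul (R := k) h) =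
      tlift k (fun a0 a1 => tlift k (fun h1 h2 => actTrans R2 a0 h1 ⊗ₜ[k] (a1 * h2))
        (Coalgebra.comul (R := k) h)) (adRTrans (k := k) a)) ∧
    -- braided commutativity:
    (∀ a b : H, bulletTrans R2 a b =
      tlift k (fun b0 b1 => bulletTrans R2 b0 (actTrans R2 a b1)) (adRTrans (k := k) b)) ∧
    -- consequently, `H̲ # H^{op}` is a left and anti-left Hopf algebroid:
    (∀ (B0 : Type v) [Ring B0] [Algebra k B0] (e0 : B0 ≃ₗ[k] H),
      e0 1 = 1 → (∀ x y : B0, e0 (x * y) = bulletTrans R2 (e0 x) (e0 y)) →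
      ∀ (L0 : Type v) [Ring L0] [Algebra k L0] (ψ : L0 ≃ₗ[k] B0 ⊗[k] H),
        ψ 1 = 1 →
        (∀ x y : L0, ψ (x * y) =
          smashMul (fun b h => e0.symm (actTrans R2 (e0 b) h)) (ψ x) (ψ y)) →
        ∀ (st : BgdST k B0 L0) (cop : L0 →ₗ[k] st.T2) (cou : L0 →ₗ[k] B0),
          st.IsLeftBialgebroid cop cou →
          (∀ b : B0, st.s b = ψ.symm (b ⊗ₜ[k] (1 : H))) →
          (∀ b : B0, st.t b = ψ.symm
            ((TensorProduct.map e0.symm.toLinearMap LinearMap.id)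
              (adRTrans (k := k) (e0 b)))) →
          (∀ z : L0, cou z =
            tlift k (fun a h => (Coalgebra.counit (R := k) h : k) • a) (ψ z)) →
          (∀ z : L0, cop z =
            tlift k (fun a h => tlift k (fun h1 h2 => st.mk2 (ψ.symm (a ⊗ₜ[k] h1))
              (ψ.symm ((1 : B0) ⊗ₜ[k] h2))) (Coalgebra.comul (R := k) h)) (ψ z)) →
          st.IsLeftHopf cop ∧ st.IsAntiLeftHopf cop) := by
  obtain ⟨R, hR2⟩ := hR.1
  obtain ⟨Ri, hR2i⟩ := hR.2.1
  obtain rfl : (fun h g => R h g) = R2 := funext fun h => funext fun g => hR2 h g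
  obtain rfl : (fun h g => Ri h g) = R2i := funext fun h => funext fun g => hR2i h g
  have hcq := hR.cq
  refine ⟨⟨bulL R, fun _ _ => rfl⟩, ⟨actL R, fun _ _ => rfl⟩, ⟨adL k, fun _ => rfl⟩,
    fun x => ⟨one_bulL hcq x, bulL_one hcq x⟩, bulL_assoc hcq, actL_one hcq, actL_mul hcq,
    one_actL hcq, actL_bulL hcq, adL_one, fun a b => (adL_bulL hcq a b).trans
      (tlift_tlift_map₂ (bulL R) (LinearMap.mul k H) (adL k a) (adL k b)).symm,
    tlift_adL_coassoc, tlift_adL_counit, actL_adL_compat hcq, bulL_braided hcq, ?_⟩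
  intro B0 _ _ e he1 _ L0 _ _ ψ hψ1 hψm st cop _ _ hs ht _ hcop
  have A := isActionBgd_transmutation hcq e he1 ψ hψ1 hψm st cop hs ht hcop
  let E := LinearEquiv.ofBijective (HopfAlgebra.antipode k (A := H)) (antipode_bijective hcq)
  exact ⟨A.lam_bijective (T := E.symm.toLinearMap) E.symm_apply_apply E.apply_symm_apply,
    A.mu_bijective⟩
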